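/- For every positive integer k and every integer λ > 1, setting D = λ(k^2 + 2), there exists Q such that for every prime power q ≥ Q the following holds, with n = q^k: there exists a bipartite graph G whose left vertex set A is the disjoint union of sets A_1, …, A_k, each of size n, and whose right vertex set B has size n, such that (i) every tuple (a_1, …, a_k) ∈ A_1 × ⋯ × A_k has at most D^k common neighbours in B; (ii) at least n^k / (4·(D^k)!) of the tuples (a_1, …, a_k) ∈ A_1 × ⋯ × A_k have exactly D^k common neighbours in B; and (iii) every k-element subset X ⊆ A with X ∩ A_i = ∅ for some i ∈ {1,…,k} has at most D^k/λ common neighbours in B. -/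

import Mathlib

set_option linter.unusedSimpArgs false
set_option linter.unusedVariables false
namespace S9
open Polynomial

section Lspace
variable (F : Type) [Field F] (K : Type) [Field K] [Algebra (RatFunc F) K]

noncomputable def polyMap : F[X] →+* K :=
  (algebraMap (RatFunc F) K).comp (algebraMap F[X] (RatFunc F))

open Classical in
noncomputable def infRing : Subring (RatFunc F) := (RatFunc.inftyValuation F).integer

open Classical in
lemma mem_infRing (x : RatFunc F) : x ∈ infRing F ↔ x = 0 ∨ x.intDegree ≤ 0 := by
  unfold infRing
  rw [Valuation.mem_integer_iff, RatFunc.inftyValuation_apply]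
  by_cases hx : x = 0
  · simp [hx, RatFunc.inftyValuationDef]
  · rw [RatFunc.inftyValuation_of_nonzero _ hx]
    simp only [hx, false_or]
    rw [← WithZero.exp_zero, WithZero.exp_le_exp]

noncomputable def infMap : infRing F →+* K := (algebraMap (RatFunc F) K).comp (infRing F).subtype

noncomputable def zK : K := polyMap F K X

lemma polyMap_injective : Function.Injective (polyMap F K) := by
  unfold polyMap
  rw [RingHom.coe_comp]
  exact (algebraMap (RatFunc F) K).injective.comp (RatFunc.algebraMap_injective F)

lemma zK_ne_zero : zK F K ≠ 0 := by
  unfold zK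
  rw [Ne, ← (polyMap F K).map_zero]
  exact fun h => X_ne_zero (polyMap_injective F K h)

def Lmem (n : ℕ) (u : K) : Prop :=
  (polyMap F K).IsIntegralElem u ∧ (infMap F K).IsIntegralElem (u / zK F K ^ n)

variable {F K}

lemma infMap_of {x : RatFunc F} (hx : x ∈ infRing F) :
    (infMap F K).IsIntegralElem (algebraMap (RatFunc F) K x) :=
  RingHom.isIntegralElem_map (infMap F K) (x := ⟨x, hx⟩)

lemma zK_eq : zK F K = algebraMap (RatFunc F) K RatFunc.X := by
  simp [zK, polyMap]

lemma Lmem.add {n : ℕ} {u v : K} (hu : Lmem F K n u) (hv : Lmem F K n v) :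
    Lmem F K n (u + v) := by
  refine ⟨hu.1.add _ hv.1, ?_⟩
  rw [add_div]
  exact hu.2.add _ hv.2

lemma Lmem.mul {n m : ℕ} {u v : K} (hu : Lmem F K n u) (hv : Lmem F K m v) :
    Lmem F K (n + m) (u * v) := by
  refine ⟨hu.1.mul _ hv.1, ?_⟩
  rw [pow_add, mul_div_mul_comm]
  exact hu.2.mul _ hv.2

lemma polyDiv_mem (p : F[X]) (n : ℕ) (h : p.natDegree ≤ n) :
    algebraMap F[X] (RatFunc F) p / RatFunc.X ^ n ∈ infRing F := by
  rw [mem_infRing]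
  by_cases hp : p = 0
  · left; simp [hp]
  · right
    have h1 : algebraMap F[X] (RatFunc F) p ≠ 0 := by simpa using hp
    have h2 : (RatFunc.X : RatFunc F) ^ n = algebraMap F[X] (RatFunc F) (X ^ n) := by simp
    rw [RatFunc.intDegree_div h1 (pow_ne_zero _ RatFunc.X_ne_zero), h2,
      RatFunc.intDegree_polynomial, RatFunc.intDegree_polynomial]
    simp only [natDegree_pow, natDegree_X]
    omega

lemma polyMap_div (p : F[X]) (n : ℕ) : polyMap F K p / zK F K ^ n =
    algebraMap (RatFunc F) K (algebraMap F[X] (RatFunc F) p / RatFunc.X ^ n) := by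
  rw [zK_eq, map_div₀, map_pow]; rfl

lemma Lmem_poly {n : ℕ} {p : F[X]} (h : p.natDegree ≤ n) : Lmem F K n (polyMap F K p) := by
  refine ⟨RingHom.isIntegralElem_map _, ?_⟩
  rw [polyMap_div]
  exact infMap_of (polyDiv_mem p n h)

lemma Lmem_one : Lmem F K 0 1 := by
  have := Lmem_poly (F := F) (K := K) (n := 0) (p := 1) (by simp)
  simpa using this

lemma Lmem_zero (n : ℕ) : Lmem F K n 0 := by
  have := Lmem_poly (F := F) (K := K) (n := n) (p := 0) (by simp)
  simpa using this

lemma Lmem.mono {n m : ℕ} (hnm : n ≤ m) {u : K} (hu : Lmem F K n u) : Lmem F K m u := by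
  have h := hu.mul (Lmem_poly (F := F) (K := K) (n := m - n) (p := 1) (by simp))
  simp only [map_one, mul_one] at h
  rwa [Nat.add_sub_cancel' hnm] at h

lemma Lmem.pow {n : ℕ} {u : K} (hu : Lmem F K n u) (a : ℕ) : Lmem F K (a * n) (u ^ a) := by
  induction a with
  | zero => simpa using Lmem_one
  | succ a ih => rw [pow_succ, Nat.succ_mul]; exact ih.mul hu

lemma Lmem.prod {ι : Type*} (s : Finset ι) (f : ι → K) (n : ℕ) (h : ∀ i ∈ s, Lmem F K n (f i)) :
    Lmem F K (s.card * n) (∏ i ∈ s, f i) := by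
  classical
  induction s using Finset.induction_on with
  | empty => simpa using Lmem_one
  | insert a s ha ih =>
    rw [Finset.prod_insert ha, Finset.card_insert_of_notMem ha, Nat.succ_mul, add_comm]
    exact (h a (by simp)).mul (ih fun i hi => h i (by simp [hi]))

lemma Lmem.sum {ι : Type*} (s : Finset ι) (f : ι → K) (n : ℕ) (h : ∀ i ∈ s, Lmem F K n (f i)) :
    Lmem F K n (∑ i ∈ s, f i) := by
  classical
  induction s using Finset.induction_on with
  | empty => simpa using Lmem_zero n
  | insert a s ha ih =>
    rw [Finset.sum_insert ha]
    exact (h a (by simp)).add (ih fun i hi => h i (by simp [hi]))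

lemma Lmem.map {n : ℕ} {u : K} (hu : Lmem F K n u) (σ : K ≃ₐ[RatFunc F] K) :
    Lmem F K n (σ u) := by
  have key : ∀ {R : Type} [CommRing R] (i : R →+* RatFunc F) (x : K),
      ((algebraMap (RatFunc F) K).comp i).IsIntegralElem x →
      ((algebraMap (RatFunc F) K).comp i).IsIntegralElem (σ x) := by
    rintro R _ i x ⟨p, hp, hx⟩
    refine ⟨p, hp, ?_⟩
    have := congrArg σ hx
    rw [map_zero] at this
    rw [← this]
    have h2 : (σ : K →+* K) (eval₂ ((algebraMap (RatFunc F) K).comp i) x p) = _ :=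
      Polynomial.hom_eval₂ p _ (σ : K →+* K) x
    rw [show σ (eval₂ ((algebraMap (RatFunc F) K).comp i) x p) = (σ : K →+* K) (eval₂ ((algebraMap (RatFunc F) K).comp i) x p) from rfl, h2]
    congr 1
    ext r
    simp
  refine ⟨key _ _ hu.1, ?_⟩
  have h := key _ _ hu.2
  rw [map_div₀, map_pow] at h
  rwa [zK_eq, AlgEquiv.commutes, ← zK_eq] at h

lemma Lmem_root {E : ℕ} (P : F[X][X]) (hP : P.Monic) (hE : ∀ i, (P.coeff i).natDegree ≤ E)
    (y : K) (hy : (P.map (polyMap F K)).eval y = 0) : Lmem F K E y := by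
  constructor
  · exact ⟨P, hP, by rwa [eval_map] at hy⟩
  · -- the polynomial with coefficients c_i / z^{E (M - i)}
    set M := P.natDegree with hM
    let c : ℕ → infRing F := fun i => if h : i < M then
      ⟨algebraMap F[X] (RatFunc F) (P.coeff i) / RatFunc.X ^ (E * (M - i)),
        polyDiv_mem _ _ ((hE i).trans (Nat.le_mul_of_pos_right _ (by omega)))⟩ else 1
    have hc : ∀ i ≤ M, infMap F K (c i) * (zK F K ^ E) ^ (M - i) = polyMap F K (P.coeff i) := by
      intro i hi
      by_cases h : i < M
      · have : infMap F K (c i) = polyMap F K (P.coeff i) / zK F K ^ (E * (M - i)) := by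
          rw [polyMap_div]
          simp only [c, h, dif_pos]
          rfl
        rw [this, ← pow_mul, div_mul_cancel₀ _ (pow_ne_zero _ (zK_ne_zero F K))]
      · have hi' : i = M := by omega
        subst hi'
        have : P.coeff P.natDegree = 1 := hP
        simp [c, this, hM]
    refine ⟨X ^ M + ∑ i ∈ Finset.range M, C (c i) * X ^ i, ?_, ?_⟩
    · apply monic_X_pow_add
      refine lt_of_le_of_lt (degree_sum_le _ _) ?_
      rw [Finset.sup_lt_iff (by simp)]
      intro i hi
      refine lt_of_le_of_lt (degree_C_mul_X_pow_le _ _) ?_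
      exact_mod_cast Finset.mem_range.1 hi
    · have hz : (zK F K ^ E) ≠ 0 := pow_ne_zero _ (zK_ne_zero F K)
      have : eval₂ (infMap F K) (y / zK F K ^ E) (X ^ M + ∑ i ∈ Finset.range M, C (c i) * X ^ i)
          * (zK F K ^ E) ^ M = 0 := by
        have hy2 : eval₂ (polyMap F K) y P = 0 := by rwa [eval_map] at hy
        rw [← hy2, eval₂_eq_sum_range (p := P), Finset.sum_range_succ]
        have h1 : P.coeff P.natDegree = 1 := hP
        simp only [eval₂_add, eval₂_pow, eval₂_X, eval₂_finsetSum, eval₂_mul, eval₂_C, add_mul,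
          Finset.sum_mul, h1, map_one, one_mul]
        rw [add_comm]
        congr 1
        · refine Finset.sum_congr rfl fun i hi => ?_
          have hi := Finset.mem_range.1 hi
          rw [← hc i hi.le, div_pow]
          have : (zK F K ^ E) ^ M = (zK F K ^ E) ^ (M - i) * (zK F K ^ E) ^ i := by
            rw [← pow_add]; congr 1; omega
          rw [this]
          field_simp
        · rw [div_pow, div_mul_cancel₀ _ (pow_ne_zero _ hz)]
      exact (mul_eq_zero.1 this).resolve_right (pow_ne_zero _ hz)

open Classical in
lemma Lmem_base {n : ℕ} (x : RatFunc F) (h : Lmem F K n (algebraMap (RatFunc F) K x)) :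
    ∃ p : F[X], p.natDegree ≤ n ∧ x = algebraMap F[X] (RatFunc F) p := by
  have key : ∀ {R : Type} [CommRing R] (i : R →+* RatFunc F) (x : RatFunc F),
      ((algebraMap (RatFunc F) K).comp i).IsIntegralElem (algebraMap (RatFunc F) K x) →
      i.IsIntegralElem x := by
    rintro R _ i x ⟨p, hp, hx⟩
    refine ⟨p, hp, ?_⟩
    rw [← Polynomial.hom_eval₂] at hx
    exact (map_eq_zero_iff _ (algebraMap (RatFunc F) K).injective).1 hx
  obtain ⟨h1, h2⟩ := h
  have h1' := key _ _ h1
  have h3 : IsIntegral F[X] x := h1'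
  obtain ⟨p, hp⟩ := (IsIntegrallyClosed.isIntegral_iff (R := F[X]) (K := RatFunc F)).1 h3
  refine ⟨p, ?_, hp.symm⟩
  rw [zK_eq, ← map_pow, ← map_div₀] at h2
  have h2' := key _ _ h2
  have h4 : x / RatFunc.X ^ n ∈ (RatFunc.inftyValuation F).integer :=
    (Valuation.integer.integers (RatFunc.inftyValuation F)).mem_of_integral h2'
  have h5 := (mem_infRing F _).1 h4
  by_cases hx : x = 0
  · have : p = 0 := by rw [hx] at hp; simpa using hp
    simp [this]
  · have hXn : (RatFunc.X : RatFunc F) ^ n ≠ 0 := pow_ne_zero _ RatFunc.X_ne_zero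
    rcases h5 with h5 | h5
    · exact absurd h5 (div_ne_zero hx hXn)
    · rw [RatFunc.intDegree_div hx hXn, ← hp, ← RatFunc.algebraMap_X, ← map_pow,
        RatFunc.intDegree_polynomial, RatFunc.intDegree_polynomial, natDegree_X_pow] at h5
      omega

lemma Lmem_norm [FiniteDimensional (RatFunc F) K] [IsGalois (RatFunc F) K]
    {n : ℕ} {u : K} (h : Lmem F K n u) :
    ∃ p : F[X], p.natDegree ≤ Fintype.card (K ≃ₐ[RatFunc F] K) * n ∧
      polyMap F K p = ∏ σ : K ≃ₐ[RatFunc F] K, σ u := by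
  have h1 := Lmem.prod (F := F) (K := K) Finset.univ (fun σ : K ≃ₐ[RatFunc F] K => σ u) n
    (fun σ _ => h.map σ)
  rw [← Algebra.norm_eq_prod_automorphisms] at h1 
  obtain ⟨p, hp, hx⟩ := Lmem_base _ h1
  exact ⟨p, hp, by rw [← Algebra.norm_eq_prod_automorphisms, hx]; rfl⟩

end Lspace
end S9

set_option linter.unusedSimpArgs false
set_option linter.style.haveILetI false
set_option linter.unusedVariables false
namespace S9
open Polynomial

section place
variable {F : Type} [Field F] (F' : Type) [Field F'] [Algebra F F']

noncomputable def ser (ζ : F) : F[X] →+* PowerSeries F' :=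
  eval₂RingHom ((PowerSeries.C (R := F')).comp (algebraMap F F'))
    (PowerSeries.C (algebraMap F F' ζ) + PowerSeries.X)

lemma ser_eq (ζ : F) (p : F[X]) :
    ser F' ζ p = (((taylor ζ p).map (algebraMap F F') : F'[X]) : PowerSeries F') := by
  have : ser F' ζ = (coeToPowerSeries.ringHom (R := F')).comp
      ((mapRingHom (algebraMap F F')).comp (taylorAlgHom ζ : F[X] →ₐ[F] F[X]).toRingHom) := by
    apply Polynomial.ringHom_ext
    · intro a
      simp [ser]
    · simp [ser, add_comm]
  rw [this]
  simp

lemma ser_injective (ζ : F) : Function.Injective (ser F' ζ) := by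
  intro p q h
  rw [ser_eq, ser_eq] at h
  exact taylor_injective ζ (map_injective _ (algebraMap F F').injective (coe_injective _ h))

lemma constantCoeff_ser (ζ : F) (p : F[X]) :
    PowerSeries.constantCoeff (ser F' ζ p) = algebraMap F F' (p.eval ζ) := by
  rw [ser_eq]
  simp [aeval_algebraMap_apply]

lemma hensel_ps (Q : (PowerSeries F')[X]) (hQ : Q.Monic) (a : F')
    (h0 : (Q.map (PowerSeries.constantCoeff (R := F'))).eval a = 0)
    (h1 : (Q.map (PowerSeries.constantCoeff (R := F'))).derivative.eval a ≠ 0) :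
    ∃ y : PowerSeries F', Q.eval y = 0 ∧ PowerSeries.constantCoeff y = a := by
  have hcc : ∀ (f : (PowerSeries F')[X]) (y : PowerSeries F'), PowerSeries.constantCoeff (f.eval y)
      = (f.map (PowerSeries.constantCoeff (R := F'))).eval (PowerSeries.constantCoeff y) := by
    intro f y
    rw [eval_map, eval₂_at_apply]
  have hmem : ∀ y : PowerSeries F', y ∈ Ideal.span {(PowerSeries.X : PowerSeries F')} ↔
      PowerSeries.constantCoeff y = 0 := by
    intro y
    rw [Ideal.mem_span_singleton, PowerSeries.X_dvd_iff]
  obtain ⟨y, hy, hy2⟩ := HenselianRing.is_henselian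
    (I := Ideal.span {(PowerSeries.X : PowerSeries F')}) Q hQ (PowerSeries.C a) (by
      rw [hmem, hcc]; simpa using h0) (by
      apply RingHom.isUnit_map
      rw [PowerSeries.isUnit_iff_constantCoeff, hcc]
      rw [derivative_map] at h1
      simpa using h1)
  refine ⟨y, hy, ?_⟩
  rw [hmem, map_sub, sub_eq_zero] at hy2
  simpa using hy2

lemma splits_ps (Q : (PowerSeries F')[X]) (hQ : Q.Monic)
    (hs : (Q.map (PowerSeries.constantCoeff (R := F'))).Splits)
    (hsep : (Q.map (PowerSeries.constantCoeff (R := F'))).Separable) :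
    (Q.map (algebraMap (PowerSeries F') (FractionRing (PowerSeries F')))).Splits := by
  classical
  set q := Q.map (PowerSeries.constantCoeff (R := F')) with hq
  have hq0 : q ≠ 0 := (hQ.map _).ne_zero
  have h : ∀ a : F', ∃ y : PowerSeries F', a ∈ q.roots → Q.eval y = 0 ∧
      PowerSeries.constantCoeff y = a := by
    intro a
    by_cases ha : a ∈ q.roots
    · obtain ⟨y, hy⟩ := hensel_ps F' Q hQ a ((mem_roots hq0).1 ha)
        (hsep.eval₂_derivative_ne_zero (RingHom.id _) (by simpa using (mem_roots hq0).1 ha))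
      exact ⟨y, fun _ => hy⟩
    · exact ⟨0, fun h => absurd h ha⟩
  choose Y hY using h
  set Ω := FractionRing (PowerSeries F')
  have hQm : (Q.map (algebraMap (PowerSeries F') Ω)) ≠ 0 := (hQ.map _).ne_zero
  rw [splits_iff_card_roots]
  apply le_antisymm (card_roots' _)
  have h1 : (Q.map (algebraMap (PowerSeries F') Ω)).natDegree = q.roots.toFinset.card := by
    rw [hQ.natDegree_map, Multiset.toFinset_card_of_nodup (nodup_roots hsep),
      splits_iff_card_roots.1 hs, hQ.natDegree_map]
  rw [h1]
  have h2 : (q.roots.toFinset.image (fun a => algebraMap (PowerSeries F') Ω (Y a))).card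
      = q.roots.toFinset.card := by
    apply Finset.card_image_of_injOn
    intro a ha b hb hab
    have := IsFractionRing.injective (PowerSeries F') Ω hab
    rw [← (hY a (by simpa using ha)).2, ← (hY b (by simpa using hb)).2, this]
  rw [← h2]
  refine le_trans (Finset.card_le_card ?_) (Multiset.toFinset_card_le _)
  intro x hx
  obtain ⟨a, ha, rfl⟩ := Finset.mem_image.1 hx
  rw [Multiset.mem_toFinset] at ha ⊢
  rw [mem_roots hQm, IsRoot, eval_map, eval₂_at_apply, (hY a ha).1, map_zero]

lemma exists_lift_hom {k0 K Ω : Type} [Field k0] [Field K] [Field Ω] [Algebra k0 K]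
    (f : k0[X]) [h : IsSplittingField k0 K f] (i : k0 →+* Ω)
    (hs : (f.map i).Splits) :
    ∃ j : K →+* Ω, j.comp (algebraMap k0 K) = i := by
  letI := i.toAlgebra
  have := IsSplittingField.lift K (F := Ω) f hs
  exact ⟨this.toRingHom, by ext x; simp; rfl⟩

/-- two homs agreeing on the base differ by an automorphism. -/
lemma exists_aut_of_homs {k0 K Ω : Type} [Field k0] [Field K] [Field Ω] [Algebra k0 K]
    [Normal k0 K] (j1 j2 : K →+* Ω)
    (h : j1.comp (algebraMap k0 K) = j2.comp (algebraMap k0 K)) :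
    ∃ σ : K ≃ₐ[k0] K, ∀ x, j2 x = j1 (σ x) := by
  letI := (j1.comp (algebraMap k0 K)).toAlgebra
  letI := j1.toAlgebra
  haveI : IsScalarTower k0 K Ω := IsScalarTower.of_algebraMap_eq (fun x => rfl)
  let f : K →ₐ[k0] Ω := { j2 with commutes' := fun r => (congrArg (fun g => g r) h).symm }
  refine ⟨AlgHom.restrictNormal' f K, fun x => ?_⟩
  exact (AlgHom.restrictNormal_commutes f K x).symm

variable {F'} {K : Type} [Field K] [Algebra (RatFunc F) K]

variable (F K) in
noncomputable def OK : Subring K where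
  carrier := {u | (polyMap F K).IsIntegralElem u}
  mul_mem' := fun h1 h2 => h1.mul _ h2
  one_mem' := RingHom.isIntegralElem_one _
  add_mem' := fun h1 h2 => h1.add _ h2
  zero_mem' := RingHom.isIntegralElem_zero _
  neg_mem' := fun h => h.neg _

lemma polyMap_mem_OK (p : F[X]) : polyMap F K p ∈ OK F K := RingHom.isIntegralElem_map _

lemma Lmem.mem_OK {n : ℕ} {u : K} (h : Lmem F K n u) : u ∈ OK F K := h.1

lemma map_mem_OK {u : K} (h : u ∈ OK F K) (σ : K ≃ₐ[RatFunc F] K) : σ u ∈ OK F K := by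
  obtain ⟨p, hp, hx⟩ := h
  refine ⟨p, hp, ?_⟩
  have h2 : (σ : K →+* K) (eval₂ (polyMap F K) u p) = _ := Polynomial.hom_eval₂ p _ (σ : K →+* K) u
  rw [hx, map_zero] at h2
  have h3 : (σ : K →+* K).comp (polyMap F K) = polyMap F K := by
    ext r
    · simp [polyMap]
    · simp [polyMap]
  rw [h3] at h2
  exact h2.symm

lemma exists_ring_lift {S R Ω : Type} [CommRing S] [CommRing R] [CommRing Ω] (a : R →+* Ω)
    (ha : Function.Injective a) (Φ : S →+* Ω) (hex : ∀ u, ∃ x, a x = Φ u) :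
    ∃ ψ : S →+* R, ∀ u, a (ψ u) = Φ u := by
  choose g hg using hex
  refine ⟨⟨⟨⟨g, ?_⟩, ?_⟩, ?_, ?_⟩, hg⟩
  · apply ha; rw [hg]; simp
  · intro x y; apply ha; rw [map_mul, hg, hg, hg]; simp
  · apply ha; simp [hg]
  · intro x y; apply ha; simp [hg]

lemma exists_place_aux (P : F[X][X]) {R Ω : Type} [CommRing R] [IsDomain R] [IsIntegrallyClosed R]
    [Field Ω] [Algebra R Ω] [IsFractionRing R Ω]
    [IsSplittingField (RatFunc F) K (P.map (algebraMap F[X] (RatFunc F)))]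
    (e : F[X] →+* R) (he : Function.Injective e)
    (hs : ((P.map e).map (algebraMap R Ω)).Splits) :
    ∃ (Φ : K →+* Ω) (ψ : OK F K →+* R),
      (∀ u : OK F K, algebraMap _ Ω (ψ u) = Φ u) ∧
      (∀ p : F[X], ψ ⟨polyMap F K p, polyMap_mem_OK p⟩ = e p) := by
  have hinj : Function.Injective ((algebraMap R Ω).comp e) := by
    rw [RingHom.coe_comp]
    exact (IsFractionRing.injective _ _).comp he
  let i : RatFunc F →+* Ω := IsFractionRing.lift hinj
  have hi : i.comp (algebraMap F[X] (RatFunc F)) = (algebraMap R Ω).comp e :=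
    RingHom.ext fun p => IsFractionRing.lift_algebraMap hinj p
  obtain ⟨Φ, hΦ⟩ := exists_lift_hom (K := K) (P.map (algebraMap F[X] (RatFunc F))) i (by
    rw [map_map, hi, ← map_map]; exact hs)
  have hΦp : Φ.comp (polyMap F K) = (algebraMap R Ω).comp e := by
    rw [← hi, ← hΦ]; rfl
  have hex : ∀ u : OK F K, ∃ x : R, algebraMap R Ω x = Φ u := by
    rintro ⟨u, p, hp, hx⟩
    apply (IsIntegrallyClosed.isIntegral_iff (R := R) (K := Ω)).1
    refine ⟨p.map e, hp.map _, ?_⟩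
    rw [eval₂_map, ← hΦp, ← hom_eval₂, hx, map_zero]
  obtain ⟨ψ, hψ⟩ := exists_ring_lift (algebraMap R Ω)
    (IsFractionRing.injective R Ω) (Φ.comp (OK F K).subtype) hex
  refine ⟨Φ, ψ, hψ, fun p => ?_⟩
  apply IsFractionRing.injective R Ω
  rw [hψ]
  exact congrArg (fun f => f p) hΦp

variable (F') in
lemma exists_place (P : F[X][X]) (hP : P.Monic)
    [IsSplittingField (RatFunc F) K (P.map (algebraMap F[X] (RatFunc F)))] (ζ : F)
    (hs : ((P.map (evalRingHom ζ)).map (algebraMap F F')).Splits)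
    (hsep : (P.map (evalRingHom ζ)).Separable) :
    ∃ (Φ : K →+* FractionRing (PowerSeries F')) (ψ : OK F K →+* PowerSeries F'),
      (∀ u : OK F K, algebraMap _ (FractionRing (PowerSeries F')) (ψ u) = Φ u) ∧
      (∀ p : F[X], ψ ⟨polyMap F K p, polyMap_mem_OK p⟩ = ser F' ζ p) := by
  have hcc : (PowerSeries.constantCoeff (R := F')).comp (ser F' ζ)
      = (algebraMap F F').comp (evalRingHom ζ) := by
    apply RingHom.ext
    intro p
    simpa using constantCoeff_ser F' ζ p
  have h2 : ((P.map (ser F' ζ)).map (PowerSeries.constantCoeff (R := F'))) =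
      ((P.map (evalRingHom ζ)).map (algebraMap F F')) := by
    rw [map_map, map_map, hcc]
  exact exists_place_aux P (ser F' ζ) (ser_injective F' ζ)
    (splits_ps F' (P.map (ser F' ζ)) (hP.map _) (by rwa [h2]) (by
    rw [h2]; exact hsep.map))

end place
end S9

set_option linter.unusedSimpArgs false
set_option linter.unusedSectionVars false
set_option linter.unusedVariables false
set_option linter.style.haveILetI false
namespace S9
open Polynomial

section frob
variable {F : Type} [Field F] {F' : Type} [Field F'] [Algebra F F']
  {K : Type} [Field K] [Algebra (RatFunc F) K]

noncomputable def actO (σ : K ≃ₐ[RatFunc F] K) : OK F K →+* OK F K :=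
  ((σ : K →+* K).comp (OK F K).subtype).codRestrict (OK F K) (fun u => map_mem_OK u.2 σ)

@[simp] lemma actO_coe (σ : K ≃ₐ[RatFunc F] K) (u : OK F K) : ((actO σ u : OK F K) : K) = σ u := rfl

lemma frob_aux {R Ω : Type} [CommRing R] [IsDomain R]
    [Field Ω] [Algebra R Ω] [IsFractionRing R Ω] [Normal (RatFunc F) K]
    (e : F[X] →+* R) (fr : R →+* R) (hfr : Function.Injective fr) (hfix : ∀ p, fr (e p) = e p)
    (Φ : K →+* Ω) (ψ : OK F K →+* R)
    (h1 : ∀ u : OK F K, algebraMap _ Ω (ψ u) = Φ u)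
    (h2 : ∀ p : F[X], ψ ⟨polyMap F K p, polyMap_mem_OK p⟩ = e p) :
    ∃ σ : K ≃ₐ[RatFunc F] K, ∀ u : OK F K, ψ (actO σ u) = fr (ψ u) := by
  have hinj : Function.Injective ((algebraMap R Ω).comp fr) := by
    rw [RingHom.coe_comp]
    exact (IsFractionRing.injective _ _).comp hfr
  let Fr : Ω →+* Ω := IsFractionRing.lift hinj
  have hFr : ∀ x : R, Fr (algebraMap R Ω x) = algebraMap R Ω (fr x) := fun x =>
    IsFractionRing.lift_algebraMap hinj x
  obtain ⟨σ, hσ⟩ := exists_aut_of_homs (k0 := RatFunc F) Φ (Fr.comp Φ) (by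
    apply IsLocalization.ringHom_ext (nonZeroDivisors F[X])
    apply RingHom.ext
    intro p
    have h3 := h1 ⟨polyMap F K p, polyMap_mem_OK p⟩
    rw [h2] at h3
    change Φ (polyMap F K p) = Fr (Φ (polyMap F K p))
    have h3' : algebraMap R Ω (e p) = Φ (polyMap F K p) := h3
    rw [← h3', hFr, hfix])
  refine ⟨σ, fun u => ?_⟩
  apply IsFractionRing.injective R Ω
  rw [h1, ← hFr, h1]
  exact (hσ u).symm

lemma frob_place [Fintype F] [Normal (RatFunc F) K] (ζ : F)
    (Φ : K →+* FractionRing (PowerSeries F')) (ψ : OK F K →+* PowerSeries F')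
    (h1 : ∀ u : OK F K, algebraMap _ (FractionRing (PowerSeries F')) (ψ u) = Φ u)
    (h2 : ∀ p : F[X], ψ ⟨polyMap F K p, polyMap_mem_OK p⟩ = ser F' ζ p) :
    ∃ σ : K ≃ₐ[RatFunc F] K, ∀ u : OK F K, PowerSeries.constantCoeff (ψ (actO σ u)) =
      (PowerSeries.constantCoeff (ψ u)) ^ Fintype.card F := by
  let f : F' →+* F' := (FiniteField.frobeniusAlgHom F F').toRingHom
  have hf : ∀ x, f x = x ^ Fintype.card F := fun x => rfl
  have hfF : ∀ x : F, f (algebraMap F F' x) = algebraMap F F' x := fun x =>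
    (FiniteField.frobeniusAlgHom F F').commutes x
  obtain ⟨σ, hσ⟩ := frob_aux (ser F' ζ) (PowerSeries.map f) (by
      intro x y hxy
      ext n
      have := congrArg (PowerSeries.coeff n) hxy
      rw [PowerSeries.coeff_map, PowerSeries.coeff_map] at this
      exact f.injective this) (by
      intro p
      rw [ser_eq]
      ext n
      rw [PowerSeries.coeff_map, Polynomial.coeff_coe, Polynomial.coeff_map, hfF]) Φ ψ h1 h2
  refine ⟨σ, fun u => ?_⟩
  rw [hσ, ← hf, ← PowerSeries.coeff_zero_eq_constantCoeff_apply, PowerSeries.coeff_map,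
    PowerSeries.coeff_zero_eq_constantCoeff_apply]

lemma X_pow_dvd_ser (ζ : F) (p : F[X]) (m : ℕ) :
    (PowerSeries.X : PowerSeries F') ^ m ∣ ser F' ζ p ↔ (X - C ζ) ^ m ∣ p := by
  rw [X_sub_C_pow_dvd_iff, ser_eq, PowerSeries.X_pow_dvd_iff, X_pow_dvd_iff]
  simp [taylor_apply]

variable [FiniteDimensional (RatFunc F) K] [IsGalois (RatFunc F) K]

lemma norm_order (ζ : F) (ψ : OK F K →+* PowerSeries F')
    (h2 : ∀ p : F[X], ψ ⟨polyMap F K p, polyMap_mem_OK p⟩ = ser F' ζ p)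
    (u : OK F K) (p : F[X]) (hp : polyMap F K p = ∏ σ : K ≃ₐ[RatFunc F] K, σ u)
    (c : (K ≃ₐ[RatFunc F] K) → ℕ) (hc : ∀ σ, (PowerSeries.X : PowerSeries F') ^ (c σ) ∣ ψ (actO σ u)) :
    (X - C ζ) ^ (∑ σ, c σ) ∣ p := by
  rw [← X_pow_dvd_ser (F' := F'), ← h2]
  have : (⟨polyMap F K p, polyMap_mem_OK p⟩ : OK F K) = ∏ σ : K ≃ₐ[RatFunc F] K, actO σ u := by
    apply Subtype.ext
    change polyMap F K p = _
    rw [hp]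
    push_cast
    rfl
  rw [this, map_prod, ← Finset.prod_pow_eq_pow_sum]
  exact Finset.prod_dvd_prod_of_dvd _ _ fun σ _ => hc σ

lemma norm_ne_zero {u : K} (hu : u ≠ 0) (p : F[X])
    (hp : polyMap F K p = ∏ σ : K ≃ₐ[RatFunc F] K, σ u) : p ≠ 0 := by
  rintro rfl
  rw [map_zero] at hp
  have := Finset.prod_eq_zero_iff.1 hp.symm
  obtain ⟨σ, _, h⟩ := this
  exact hu (by simpa using h)

lemma order_le (ζ : F) (ψ : OK F K →+* PowerSeries F')
    (h2 : ∀ p : F[X], ψ ⟨polyMap F K p, polyMap_mem_OK p⟩ = ser F' ζ p)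
    {n : ℕ} {u : K} (hu : Lmem F K n u) (hu0 : u ≠ 0) (m : ℕ)
    (hm : (PowerSeries.X : PowerSeries F') ^ m ∣ ψ ⟨u, hu.mem_OK⟩) :
    m ≤ Fintype.card (K ≃ₐ[RatFunc F] K) * n := by
  classical
  obtain ⟨p, hp, hx⟩ := Lmem_norm hu
  have hp0 := norm_ne_zero hu0 p hx
  have := norm_order (F' := F') ζ ψ h2 ⟨u, hu.mem_OK⟩ p hx (fun σ => if σ = 1 then m else 0) (by
    intro σ
    by_cases h : σ = 1
    · subst h
      simp only [if_true]
      exact hm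
    · simp [h])
  simp only [Finset.sum_ite_eq', Finset.mem_univ, if_true] at this
  have h3 := natDegree_le_of_dvd this hp0
  rw [natDegree_pow, natDegree_X_sub_C, mul_one] at h3
  exact h3.trans hp

end frob
end S9

set_option linter.unusedSimpArgs false
set_option linter.unusedSectionVars false
set_option linter.unusedVariables false
set_option linter.style.haveILetI false
namespace S9
open Polynomial
open scoped Pointwise

section dims
variable {F : Type} [Field F]
  {K : Type} [Field K] [Algebra (RatFunc F) K] [Algebra F K] [IsScalarTower F (RatFunc F) K]

lemma algebraMap_eq_polyMap (c : F) : algebraMap F K c = polyMap F K (C c) := by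
  rw [IsScalarTower.algebraMap_apply F (RatFunc F) K, polyMap, RingHom.comp_apply]
  congr 1

variable (F K) in
def Lsub (n : ℕ) : Submodule F K where
  carrier := {u | Lmem F K n u}
  add_mem' := fun h1 h2 => h1.add h2
  zero_mem' := Lmem_zero n
  smul_mem' := fun c u hu => by
    have h := (Lmem_poly (F := F) (K := K) (n := 0) (p := C c) (by simp)).mul hu
    rw [zero_add, ← algebraMap_eq_polyMap, ← Algebra.smul_def] at h
    exact h

lemma mem_Lsub {n : ℕ} {u : K} : u ∈ Lsub F K n ↔ Lmem F K n u := Iff.rfl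

lemma bounded_basis [FiniteDimensional (RatFunc F) K] (P : F[X][X]) (hP : P.Monic) {E : ℕ}
    (hE : ∀ i, (P.coeff i).natDegree ≤ E)
    [h : IsSplittingField (RatFunc F) K (P.map (algebraMap F[X] (RatFunc F)))] :
    ∃ b : Fin (Module.finrank (RatFunc F) K) → K, LinearIndependent (RatFunc F) b ∧
      ∀ j, Lmem F K (Module.finrank (RatFunc F) K * E) (b j) := by
  classical
  set d := Module.finrank (RatFunc F) K with hd
  set k0 := RatFunc F
  let Y : Set K := insert 1 ((P.map (algebraMap F[X] k0)).rootSet K)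
  have hY : ∀ y ∈ Y, Lmem F K E y := by
    rintro y (rfl | hy)
    · exact Lmem_one.mono (Nat.zero_le _)
    · apply Lmem_root P hP hE
      have := (mem_rootSet.1 hy).2
      rw [aeval_def, ← eval_map, map_map] at this
      exact this
  have hYj : ∀ j : ℕ, ∀ x ∈ Y ^ j, Lmem F K (j * E) x := by
    intro j
    induction j with
    | zero => intro x hx; rw [pow_zero, Set.mem_one] at hx; subst hx; simpa using Lmem_one
    | succ j ih =>
      intro x hx
      rw [pow_succ] at hx
      obtain ⟨a, ha, b, hb, rfl⟩ := Set.mem_mul.1 hx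
      rw [Nat.succ_mul]
      exact (ih a ha).mul (hY b hb)
  let W : Submodule k0 K := Submodule.span k0 Y
  have h1W : (1 : Submodule k0 K) ≤ W := by
    rw [Submodule.one_le]
    exact Submodule.subset_span (Set.mem_insert _ _)
  have hmono : ∀ j, W ^ j ≤ W ^ (j + 1) := fun j => pow_le_pow_right₀ h1W (Nat.le_succ j)
  have hstab : ∀ j, W ^ (j + 1) = W ^ j → W ^ j = ⊤ := by
    intro j hj
    have h1 : (1 : K) ∈ W ^ j := by
      rw [← Submodule.one_le]
      exact one_le_pow₀ h1W
    have hall : ∀ m, W ^ (j + m) = W ^ j := by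
      intro m
      induction m with
      | zero => rfl
      | succ m ih => rw [← add_assoc, pow_succ, ih, ← pow_succ, hj]
    let A : Subalgebra k0 K := (W ^ j).toSubalgebra h1 (by
      intro x y hx hy
      have := Submodule.mul_mem_mul hx hy
      rw [← pow_add, hall] at this
      exact this)
    have hA : A = ⊤ := by
      rw [eq_top_iff, ← h.adjoin_rootSet]
      apply Algebra.adjoin_le
      intro y hy
      have h3 : y ∈ W := Submodule.subset_span (Set.mem_insert_of_mem _ hy)
      have h4 : y ∈ W ^ j * W := by
        have := Submodule.mul_mem_mul h1 h3
        rwa [one_mul] at this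
      rw [← pow_succ, hj] at h4
      exact h4
    rw [eq_top_iff]
    intro x _
    have : x ∈ A := by rw [hA]; trivial
    exact this
  have hgrow : ∀ j, W ^ j = ⊤ ∨ j + 1 ≤ Module.finrank k0 (W ^ j : Submodule k0 K) := by
    intro j
    induction j with
    | zero =>
      right
      rw [pow_zero, zero_add, Nat.succ_le_iff]
      refine Module.finrank_pos_iff.2 ?_
      rw [Submodule.nontrivial_iff_ne_bot]
      intro h0
      have : (1 : K) ∈ (1 : Submodule k0 K) := Submodule.one_le.1 le_rfl
      rw [h0] at this
      exact one_ne_zero ((Submodule.mem_bot _).1 this)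
    | succ j ih =>
      by_cases hj : W ^ (j + 1) = W ^ j
      · left; rw [hj]; exact hstab j hj
      · rcases ih with ih | ih
        · left; rw [eq_top_iff, ← ih]; exact hmono j
        · right
          have := Submodule.finrank_lt_finrank_of_lt (lt_of_le_of_ne (hmono j) (Ne.symm hj))
          omega
  have htop : W ^ d = ⊤ := by
    rcases hgrow d with h | h
    · exact h
    · have h5 : Module.finrank k0 (W ^ d : Submodule k0 K) ≤ d := Submodule.finrank_le (W ^ d)
      omega
  rw [Submodule.span_pow] at htop
  obtain ⟨B, hB, hB2, hB3⟩ := exists_linearIndependent k0 (Y ^ d)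
  rw [htop] at hB2
  let bas : Module.Basis B k0 K := Module.Basis.mk hB3 (by rw [Subtype.range_coe, hB2])
  haveI : Fintype B := Module.Basis.fintypeIndexOfRankLtAleph0 bas (Module.rank_lt_aleph0 k0 K)
  have hcard : Fintype.card B = d := (Module.finrank_eq_card_basis bas).symm
  let e : Fin d ≃ B := (Fintype.equivFinOfCardEq hcard).symm
  refine ⟨fun j => (e j : K), hB3.comp e e.injective, fun j => hYj d _ (hB (e j).2)⟩

lemma finrank_Lsub_ge [FiniteDimensional (RatFunc F) K] {d c : ℕ} (b : Fin d → K)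
    (hb : LinearIndependent (RatFunc F) b) (hc : ∀ j, Lmem F K c (b j)) (n : ℕ)
    [FiniteDimensional F (Lsub F K n)] :
    d * (n + 1 - c) ≤ Module.finrank F (Lsub F K n) := by
  classical
  rcases lt_or_ge n c with hn | hn
  · rw [Nat.sub_eq_zero_of_le (by omega)]; simp
  set e := n + 1 - c with he
  -- family z^i b_j
  let v : Fin d × Fin e → Lsub F K n := fun x =>
    ⟨polyMap F K (X ^ (x.2 : ℕ)) * b x.1, by
      have h1 := (Lmem_poly (F := F) (K := K) (n := n - c) (p := X ^ (x.2 : ℕ)) (by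
        rw [natDegree_X_pow]; have := x.2.2; omega)).mul (hc x.1)
      rw [Nat.sub_add_cancel hn] at h1
      exact h1⟩
  have hv : LinearIndependent F v := by
    rw [Fintype.linearIndependent_iff]
    intro g hg
    have h1 : ∑ j : Fin d, (algebraMap F[X] (RatFunc F)
        (∑ i : Fin e, C (g (j, i)) * X ^ (i : ℕ))) • b j = 0 := by
      have := congrArg (fun x : Lsub F K n => (x : K)) hg
      simp only [Submodule.coe_sum, Submodule.coe_smul, Submodule.coe_zero] at this
      rw [← this, Fintype.sum_prod_type]
      refine Finset.sum_congr rfl fun j _ => ?_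
      rw [Algebra.smul_def, map_sum, map_sum, Finset.sum_mul]
      refine Finset.sum_congr rfl fun i _ => ?_
      rw [Algebra.smul_def (R := F), algebraMap_eq_polyMap (F := F)]
      simp only [v, ← mul_assoc, ← map_mul]
      rfl
    have h2 := Fintype.linearIndependent_iff.1 hb _ h1
    rintro ⟨j, i⟩
    have h3 := h2 j
    rw [map_eq_zero_iff _ (RatFunc.algebraMap_injective F)] at h3
    have h4 := congrArg (fun p => p.coeff (i : ℕ)) h3
    simp only [finsetSum_coeff, coeff_C_mul, coeff_X_pow, coeff_zero] at h4
    rw [Finset.sum_eq_single i] at h4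
    · simpa using h4
    · intro i' _ hi'
      rw [if_neg (fun h => hi' (Fin.ext h.symm)), mul_zero]
    · simp
  have := hv.fintype_card_le_finrank
  simpa using this

variable [FiniteDimensional (RatFunc F) K] [IsGalois (RatFunc F) K]

lemma ps_smul (ζ : F) (ψ : OK F K →+* PowerSeries F)
    (h2 : ∀ p : F[X], ψ ⟨polyMap F K p, polyMap_mem_OK p⟩ = ser F ζ p) (c : F) (u : OK F K)
    (h : c • (u : K) ∈ OK F K) : ψ ⟨c • (u : K), h⟩ = PowerSeries.C c * ψ u := by
  have : (⟨c • (u : K), h⟩ : OK F K) = ⟨polyMap F K (C c), polyMap_mem_OK _⟩ * u := by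
    apply Subtype.ext
    simp [Algebra.smul_def, algebraMap_eq_polyMap]
  rw [this, map_mul, h2]
  simp [ser]

lemma Lsub_upper (ζ : F) (ψ : OK F K →+* PowerSeries F)
    (h2 : ∀ p : F[X], ψ ⟨polyMap F K p, polyMap_mem_OK p⟩ = ser F ζ p) (n : ℕ) :
    FiniteDimensional F (Lsub F K n) ∧
    Module.finrank F (Lsub F K n) ≤ Fintype.card (K ≃ₐ[RatFunc F] K) * n + 1 := by
  let N := Fintype.card (K ≃ₐ[RatFunc F] K) * n + 1
  let f : Lsub F K n →ₗ[F] (Fin N → F) :=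
    { toFun := fun u i => PowerSeries.coeff (i : ℕ) (ψ ⟨u, Lmem.mem_OK (mem_Lsub.1 u.2)⟩)
      map_add' := by
        intro u v
        ext i
        rw [Pi.add_apply, ← map_add, ← map_add]
        rfl
      map_smul' := by
        intro c u
        ext i
        have := ps_smul ζ ψ h2 c ⟨u, Lmem.mem_OK (mem_Lsub.1 u.2)⟩
          (Lmem.mem_OK (mem_Lsub.1 (c • u).2))
        simp only [Submodule.coe_smul] at this ⊢
        rw [this]
        simp }
  have hf : Function.Injective f := by
    rw [injective_iff_map_eq_zero]
    intro u hu
    by_contra h0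
    have h0' : (u : K) ≠ 0 := fun h => h0 (Subtype.ext h)
    have := order_le ζ ψ h2 (mem_Lsub.1 u.2) h0' N (by
      rw [PowerSeries.X_pow_dvd_iff]
      intro m hm
      exact congrFun hu ⟨m, hm⟩)
    simp [N] at this
  refine ⟨FiniteDimensional.of_injective f hf, ?_⟩
  have := LinearMap.finrank_le_finrank_of_injective hf
  simpa using this

end dims
end S9

set_option linter.unusedSimpArgs false
set_option linter.unusedSectionVars false
set_option linter.unusedVariables false
set_option linter.style.haveILetI false
namespace S9
open Polynomial

lemma ps_nonvanish {F : Type} [Field F] {p : ℕ} [Fact p.Prime] [CharP F p] (a : ℕ) {ι : Type}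
    [Fintype ι] (r u : ι → PowerSeries F) (hu : u ≠ 0)
    (h : ∀ c : ι → F, c ≠ 0 → ¬ (PowerSeries.X : PowerSeries F) ^ (p ^ a) ∣
      ∑ j, PowerSeries.C (c j) * r j) :
    ∑ j, r j * u j ^ (p ^ a) ≠ 0 := by
  classical
  set s := p ^ a with hs
  have hs0 : s ≠ 0 := pow_ne_zero _ (Fact.out : p.Prime).ne_zero
  haveI : CharP (PowerSeries F) p := charP_of_injective_ringHom (f := PowerSeries.C (R := F)) PowerSeries.C_injective p
  obtain ⟨e, he1, he2⟩ : ∃ e : ℕ, (∀ j, (PowerSeries.X : PowerSeries F) ^ e ∣ u j) ∧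
      ¬ (∀ j, (PowerSeries.X : PowerSeries F) ^ (e + 1) ∣ u j) := by
    by_contra hcon
    push Not at hcon
    have hall : ∀ e : ℕ, ∀ j, (PowerSeries.X : PowerSeries F) ^ e ∣ u j := by
      intro e
      induction e with
      | zero => intro j; simp
      | succ e ih => exact hcon e ih
    apply hu
    ext j n
    exact PowerSeries.X_pow_dvd_iff.1 (hall (n + 1) j) n (Nat.lt_succ_self n)
  choose u' hu' using he1
  intro h0
  have h1 : ∑ j, r j * u' j ^ s = 0 := by
    have h2 : ((PowerSeries.X : PowerSeries F) ^ e) ^ s * ∑ j, r j * u' j ^ s = 0 := by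
      rw [← h0, Finset.mul_sum]
      refine Finset.sum_congr rfl fun j _ => ?_
      conv_rhs => rw [hu' j]
      ring
    exact (mul_eq_zero.1 h2).resolve_left (pow_ne_zero _ (pow_ne_zero _ PowerSeries.X_ne_zero))
  let c : ι → F := fun j => PowerSeries.constantCoeff (u' j)
  have hv : ∀ j, ∃ v, u' j = PowerSeries.C (c j) + PowerSeries.X * v := by
    intro j
    have : (PowerSeries.X : PowerSeries F) ∣ u' j - PowerSeries.C (c j) := by
      rw [PowerSeries.X_dvd_iff]; simp [c]
    obtain ⟨v, hv⟩ := this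
    exact ⟨v, by rw [← hv]; ring⟩
  choose v hv using hv
  refine h (fun j => c j ^ s) ?_ ?_
  · intro hc
    apply he2
    intro j
    have hcj : c j = 0 := by
      have := congrFun hc j
      exact pow_eq_zero_iff hs0 |>.1 this
    rw [hu' j, hv j, hcj]
    simp only [map_zero, zero_add, ← mul_assoc, ← pow_succ]
    exact dvd_mul_right _ _
  · have h3 : ∑ j, PowerSeries.C (c j ^ s) * r j =
        ∑ j, r j * u' j ^ s - PowerSeries.X ^ s * ∑ j, r j * v j ^ s := by
      rw [Finset.mul_sum, ← Finset.sum_sub_distrib]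
      refine Finset.sum_congr rfl fun j _ => ?_
      conv_rhs => rw [hv j, hs, add_pow_char_pow, mul_pow]
      rw [map_pow]
      ring
    rw [h3, h1, zero_sub, dvd_neg]
    exact dvd_mul_right _ _

section core
variable {F : Type} [Field F]
  {K : Type} [Field K] [Algebra (RatFunc F) K] [Algebra F K] [IsScalarTower F (RatFunc F) K]
  [FiniteDimensional (RatFunc F) K] [IsGalois (RatFunc F) K]

lemma core_w {p : ℕ} [Fact p.Prime] [CharP F p] (a : ℕ)
    (ψ : OK F K →+* PowerSeries F)
    (h2 : ∀ p : F[X], ψ ⟨polyMap F K p, polyMap_mem_OK p⟩ = ser F 0 p)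
    (σ : K ≃ₐ[RatFunc F] K) (l m : ℕ)
    (hl : Fintype.card (K ≃ₐ[RatFunc F] K) * l < p ^ a)
    (hd : Module.finrank F (Lsub F K (p ^ a * l + m)) <
      Module.finrank F (Lsub F K l) * Module.finrank F (Lsub F K m)) :
    ∃ (w : K) (hw : Lmem F K (l + p ^ a * m) w), w ≠ 0 ∧
      ∀ (F' : Type) [Field F'] [CharP F' p] (φ : OK F K →+* F'),
        (∀ u, φ (actO σ u) = φ u ^ (p ^ a) ^ 2) → φ ⟨w, hw.mem_OK⟩ = 0 := by
  classical
  set s := p ^ a with hs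
  haveI hfin := fun n => (Lsub_upper 0 ψ h2 n).1
  let ι := Fin (Module.finrank F (Lsub F K l))
  let r : Module.Basis ι F (Lsub F K l) := Module.finBasis F _
  have hψinj : ∀ x : OK F K, ψ x = 0 → x = 0 := by
    intro x hx
    by_contra hx0
    -- use the norm
    have hxK : (x : K) ≠ 0 := fun h => hx0 (Subtype.ext h)
    have hNO : ∏ τ : K ≃ₐ[RatFunc F] K, τ (x : K) ∈ OK F K :=
      Subring.prod_mem _ fun τ _ => map_mem_OK x.2 τ
    obtain ⟨q, hq⟩ : ∃ q : F[X], polyMap F K q = ∏ τ : K ≃ₐ[RatFunc F] K, τ (x : K) := by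
      rw [← Algebra.norm_eq_prod_automorphisms] at hNO ⊢
      obtain ⟨f, hf, hfx⟩ := hNO
      have h4 : IsIntegral F[X] (Algebra.norm (RatFunc F) (x : K)) := by
        refine ⟨f, hf, ?_⟩
        rw [polyMap, ← Polynomial.hom_eval₂] at hfx
        exact (map_eq_zero_iff _ (algebraMap (RatFunc F) K).injective).1 hfx
      obtain ⟨q, hq⟩ := (IsIntegrallyClosed.isIntegral_iff (R := F[X]) (K := RatFunc F)).1 h4
      exact ⟨q, by rw [← hq]; rfl⟩
    have hq0 := norm_ne_zero hxK q hq
    have := norm_order (F' := F) 0 ψ h2 x q hq (fun σ => if σ = 1 then q.natDegree + 1 else 0) (by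
      intro τ
      by_cases h : τ = 1
      · subst h
        have : actO (1 : K ≃ₐ[RatFunc F] K) x = x := by apply Subtype.ext; simp
        rw [this, hx]
        exact dvd_zero _
      · simp [h])
    simp only [Finset.sum_ite_eq', Finset.mem_univ, if_true] at this
    have h3 := natDegree_le_of_dvd this hq0
    rw [natDegree_pow, natDegree_X_sub_C, mul_one] at h3
    omega
  -- the linear map
  have hmem : ∀ (j : ι) (u : Lsub F K m), (r j : K) ^ s * σ (u : K) ∈ Lsub F K (s * l + m) :=
    fun j u => ((mem_Lsub.1 (r j).2).pow s).mul ((mem_Lsub.1 u.2).map σ)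
  have hσs : ∀ (c : F) (x : K), σ (c • x) = c • σ x := by
    intro c x
    rw [Algebra.smul_def, Algebra.smul_def, map_mul, IsScalarTower.algebraMap_apply F (RatFunc F) K,
      AlgEquiv.commutes]
  let f : (ι → Lsub F K m) →ₗ[F] Lsub F K (s * l + m) :=
    { toFun := fun u => ∑ j, ⟨(r j : K) ^ s * σ (u j : K), hmem j (u j)⟩
      map_add' := by
        intro u v
        rw [← Finset.sum_add_distrib]
        refine Finset.sum_congr rfl fun j _ => ?_
        apply Subtype.ext
        simp [mul_add]
      map_smul' := by
        intro c u
        rw [RingHom.id_apply, Finset.smul_sum]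
        refine Finset.sum_congr rfl fun j _ => ?_
        apply Subtype.ext
        simp [hσs] }
  obtain ⟨u, hu, hu0⟩ := Submodule.exists_mem_ne_zero_of_ne_bot
    (LinearMap.ker_ne_bot_of_finrank_lt (f := f) (by
      rw [Module.finrank_pi_fintype]
      simpa [ι] using hd))
  rw [LinearMap.mem_ker] at hu
  have hker : ∑ j, (r j : K) ^ s * σ (u j : K) = 0 := by
    have := congrArg (fun x : Lsub F K (s * l + m) => (x : K)) hu
    simpa [f] using this
  let rO : ι → OK F K := fun j => ⟨r j, (mem_Lsub.1 (r j).2).mem_OK⟩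
  let uO : ι → OK F K := fun j => ⟨u j, (mem_Lsub.1 (u j).2).mem_OK⟩
  let w : K := ∑ j, (r j : K) * (u j : K) ^ s
  have hw : Lmem F K (l + s * m) w := Lmem.sum _ _ _ fun j _ =>
    (mem_Lsub.1 (r j).2).mul ((mem_Lsub.1 (u j).2).pow s)
  have hwO : (⟨w, hw.mem_OK⟩ : OK F K) = ∑ j, rO j * uO j ^ s := by
    apply Subtype.ext
    simp [w, rO, uO]
  have hkO : ∑ j, rO j ^ s * actO σ (uO j) = 0 := by
    apply Subtype.ext
    simpa [rO, uO] using hker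
  refine ⟨w, hw, ?_, ?_⟩
  · intro hw0
    have h3 : ψ (∑ j, rO j * uO j ^ s) = 0 := by
      rw [← hwO]
      have : (⟨w, hw.mem_OK⟩ : OK F K) = 0 := Subtype.ext hw0
      rw [this, map_zero]
    rw [map_sum] at h3
    simp only [map_mul, map_pow] at h3
    refine ps_nonvanish a (fun j => ψ (rO j)) (fun j => ψ (uO j)) ?_ ?_ h3
    · intro h0
      apply hu0
      ext j
      have := hψinj _ (congrFun h0 j)
      exact congrArg (fun x : OK F K => (x : K)) this
    · intro c hc hdvd
      have hne : (∑ j, c j • r j : Lsub F K l) ≠ 0 := by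
        intro h0
        apply hc
        ext j
        exact Fintype.linearIndependent_iff.1 r.linearIndependent c h0 j
      have hne' : ((∑ j, c j • r j : Lsub F K l) : K) ≠ 0 := fun h => hne (Subtype.ext h)
      have := order_le 0 ψ h2 (mem_Lsub.1 (∑ j, c j • r j : Lsub F K l).2) hne' s (by
        have h5 : (⟨((∑ j, c j • r j : Lsub F K l) : K), (mem_Lsub.1 (∑ j, c j • r j : Lsub F K l).2).mem_OK⟩ : OK F K)
            = ∑ j, ⟨polyMap F K (C (c j)), polyMap_mem_OK _⟩ * rO j := by
          apply Subtype.ext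
          simp [rO, Algebra.smul_def, algebraMap_eq_polyMap]
        rw [h5, map_sum]
        simp only [map_mul, h2]
        convert hdvd using 4
        simp [ser])
      omega
  · intro F' _ _ φ hφ
    have h6 : φ ⟨w, hw.mem_OK⟩ ^ s = 0 := by
      rw [hwO, map_sum, hs, sum_pow_char_pow, ← map_zero φ, ← hkO, map_sum]
      refine Finset.sum_congr rfl fun j _ => ?_
      rw [map_mul, map_pow, map_mul, map_pow, hφ, mul_pow, ← pow_mul, sq]
    exact pow_eq_zero_iff (pow_ne_zero _ (Fact.out : p.Prime).ne_zero) |>.1 h6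

end core
end S9

set_option linter.unusedSimpArgs false
set_option linter.unusedSectionVars false
set_option linter.unusedVariables false
set_option linter.style.haveILetI false
namespace S9
open Polynomial

section cheb
variable {F : Type} [Field F] {F' : Type} [Field F'] [Algebra F F']
  {K : Type} [Field K] [Algebra (RatFunc F) K] 
  [FiniteDimensional (RatFunc F) K] [IsGalois (RatFunc F) K]

open Classical in
lemma sigma_count (q : ℕ) (S : Finset F) (ψ : F → (OK F K →+* PowerSeries F'))
    (h2 : ∀ ζ ∈ S, ∀ p : F[X], ψ ζ ⟨polyMap F K p, polyMap_mem_OK p⟩ = ser F' ζ p)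
    (fr : F → (K ≃ₐ[RatFunc F] K))
    (hfr : ∀ ζ ∈ S, ∀ u, PowerSeries.constantCoeff (ψ ζ (actO (fr ζ) u)) =
      (PowerSeries.constantCoeff (ψ ζ u)) ^ q)
    (σ : K ≃ₐ[RatFunc F] K) (N : ℕ) (w : K) (hw : Lmem F K N w) (hw0 : w ≠ 0)
    (hwφ : ∀ (φ : OK F K →+* F'),
        (∀ u, φ (actO σ u) = φ u ^ q) → φ ⟨w, hw.mem_OK⟩ = 0) :
    ∑ ζ ∈ S, (Finset.univ.filter (fun τ => fr ζ * τ = τ * σ)).card ≤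
      Fintype.card (K ≃ₐ[RatFunc F] K) * N := by
  obtain ⟨p, hp1, hp2⟩ := Lmem_norm hw
  have hp0 : p ≠ 0 := norm_ne_zero hw0 p hp2
  have hdiv : ∀ ζ ∈ S, (X - C ζ) ^ ((Finset.univ.filter (fun τ => fr ζ * τ = τ * σ)).card) ∣ p := by
    intro ζ hζ
    have := norm_order ζ (ψ ζ) (h2 ζ hζ) ⟨w, hw.mem_OK⟩ p hp2
      (fun τ => if fr ζ * τ = τ * σ then 1 else 0) (by
        intro τ
        split_ifs with hτ
        · rw [pow_one, PowerSeries.X_dvd_iff]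
          refine hwφ (((PowerSeries.constantCoeff (R := F')).comp (ψ ζ)).comp (actO τ)) ?_
          intro u
          have e : actO τ (actO σ u) = actO (fr ζ) (actO τ u) := by
            apply Subtype.ext
            have := congrArg (fun g : K ≃ₐ[RatFunc F] K => g u) hτ
            simpa using this.symm
          simp only [RingHom.comp_apply]
          rw [e, hfr ζ hζ]
        · simp)
    rwa [← Finset.card_filter] at this
  have hprod : ∏ ζ ∈ S, (X - C ζ) ^ ((Finset.univ.filter (fun τ => fr ζ * τ = τ * σ)).card) ∣ p := by
    apply Finset.prod_dvd_of_coprime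
    · intro a _ b _ hab
      apply IsCoprime.pow
      exact Polynomial.pairwise_coprime_X_sub_C (s := id) Function.injective_id hab
    · exact hdiv
  have := natDegree_le_of_dvd hprod hp0
  rw [natDegree_prod_of_monic _ _ (fun ζ _ => (monic_X_sub_C ζ).pow _)] at this
  simp only [natDegree_pow, natDegree_X_sub_C, mul_one] at this
  exact this.trans hp1

open Classical in
lemma cheb (q : ℕ) (S : Finset F) (ψ : F → (OK F K →+* PowerSeries F'))
    (h2 : ∀ ζ ∈ S, ∀ p : F[X], ψ ζ ⟨polyMap F K p, polyMap_mem_OK p⟩ = ser F' ζ p)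
    (fr : F → (K ≃ₐ[RatFunc F] K))
    (hfr : ∀ ζ ∈ S, ∀ u, PowerSeries.constantCoeff (ψ ζ (actO (fr ζ) u)) =
      (PowerSeries.constantCoeff (ψ ζ u)) ^ q)
    (N : ℕ) (hw : ∀ σ : K ≃ₐ[RatFunc F] K, ∃ (w : K) (hw : Lmem F K N w), w ≠ 0 ∧
      ∀ (φ : OK F K →+* F'), (∀ u, φ (actO σ u) = φ u ^ q) → φ ⟨w, hw.mem_OK⟩ = 0) :
    S.card ≤ (S.filter (fun ζ => fr ζ = 1)).card + (Fintype.card (K ≃ₐ[RatFunc F] K) - 1) * N := by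
  set d := Fintype.card (K ≃ₐ[RatFunc F] K) with hd
  have hdpos : 0 < d := Fintype.card_pos
  have e1 : ∑ σ : K ≃ₐ[RatFunc F] K, ∑ ζ ∈ S, (Finset.univ.filter (fun τ => fr ζ * τ = τ * σ)).card
      = d * S.card := by
    rw [Finset.sum_comm]
    have : ∀ ζ ∈ S, ∑ σ : K ≃ₐ[RatFunc F] K, (Finset.univ.filter (fun τ => fr ζ * τ = τ * σ)).card = d := by
      intro ζ _
      simp only [Finset.card_filter]
      rw [Finset.sum_comm]
      have : ∀ τ : K ≃ₐ[RatFunc F] K, (∑ σ, if fr ζ * τ = τ * σ then 1 else 0) = 1 := by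
        intro τ
        rw [Finset.sum_eq_single (τ⁻¹ * (fr ζ * τ))]
        · simp
        · intro b _ hb
          rw [if_neg]
          intro h
          apply hb
          rw [h]; simp
        · simp
      simp [this, hd]
    rw [Finset.sum_congr rfl this]; simp [mul_comm]
  rw [← Finset.add_sum_erase _ _ (Finset.mem_univ (1 : K ≃ₐ[RatFunc F] K))] at e1
  have e2 : ∑ ζ ∈ S, (Finset.univ.filter (fun τ : K ≃ₐ[RatFunc F] K => fr ζ * τ = τ * 1)).card =
      d * (S.filter (fun ζ => fr ζ = 1)).card := by
    have : ∀ ζ ∈ S, (Finset.univ.filter (fun τ : K ≃ₐ[RatFunc F] K => fr ζ * τ = τ * 1)).card =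
      if fr ζ = 1 then d else 0 := by
      intro ζ _
      split_ifs with h <;> simp [h, hd]
    rw [Finset.sum_congr rfl this, ← Finset.sum_filter]
    simp [mul_comm]
  rw [e2] at e1
  have e3 : ∑ σ ∈ (Finset.univ.erase (1 : K ≃ₐ[RatFunc F] K)), ∑ ζ ∈ S,
      (Finset.univ.filter (fun τ => fr ζ * τ = τ * σ)).card ≤ (d - 1) * (d * N) := by
    refine (Finset.sum_le_card_nsmul _ _ (d * N) ?_).trans ?_
    · intro σ _
      obtain ⟨w, hw, hw0, hφ⟩ := hw σ
      exact sigma_count q S ψ h2 fr hfr σ N w hw hw0 hφ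
    · rw [Finset.card_erase_of_mem (Finset.mem_univ _), smul_eq_mul, Finset.card_univ]
  have : d * S.card ≤ d * ((S.filter (fun ζ => fr ζ = 1)).card + (d - 1) * N) := by
    rw [← e1, mul_add]
    have : (d - 1) * (d * N) = d * ((d-1) * N) := by ring
    omega
  exact Nat.le_of_mul_le_mul_left this hdpos
end cheb
end S9

set_option linter.unusedSimpArgs false
set_option linter.unusedSectionVars false
set_option linter.unusedVariables false
set_option linter.style.haveILetI false
namespace S9
open Polynomial

lemma natDegree_det_le' {R : Type} [CommRing R] {n : Type} [Fintype n] [DecidableEq n] (A : Matrix n n R[X]) (E : ℕ)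
    (h : ∀ i j, (A i j).natDegree ≤ E) : A.det.natDegree ≤ Fintype.card n * E := by
  rw [Matrix.det_apply]
  apply natDegree_sum_le_of_forall_le
  intro σ _
  refine (natDegree_smul_le _ _).trans ?_
  refine (natDegree_prod_le _ _).trans ?_
  refine (Finset.sum_le_card_nsmul _ _ E (fun i _ => h _ _)).trans ?_
  simp

noncomputable def res (R : Type) [CommRing R] (P : R[X]) (M : ℕ) : R := resultant P (derivative P) M M

lemma sep_iff {R L : Type} [CommRing R] [Field L] (φ : R →+* L) (P : R[X]) (hP : P.Monic) {M : ℕ}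
    (hM : P.natDegree = M) : (P.map φ).Separable ↔ φ (res R P M) ≠ 0 := by
  have hm : (P.map φ).Monic := hP.map φ
  have hd : (P.map φ).natDegree = M := by rw [hP.natDegree_map, hM]
  have hd' : (derivative (P.map φ)).natDegree ≤ M := (natDegree_derivative_le _).trans (by omega)
  rw [res, ← resultant_map_map, ← derivative_map, Separable, ← isUnit_resultant_iff_isCoprime hm]
  have := resultant_add_right_deg (P.map φ) (derivative (P.map φ)) M _
    (M - (derivative (P.map φ)).natDegree) le_rfl
  rw [Nat.add_sub_cancel' hd'] at this
  rw [this, ← hd, coeff_natDegree, hm.leadingCoeff, one_pow, one_mul, isUnit_iff_ne_zero]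

lemma natDegree_res_le {R : Type} [CommRing R] (P : R[X][X]) {M E : ℕ}
    (hE : ∀ i, (P.coeff i).natDegree ≤ E) : (res R[X] P M).natDegree ≤ (M + M) * E := by
  rw [res, resultant]
  refine (natDegree_det_le' _ E ?_).trans (by simp)
  intro i j
  rw [sylvester, Matrix.of_apply]
  refine Fin.addCases (fun j1 => ?_) (fun j1 => ?_) j
  · rw [Fin.addCases_left]
    split_ifs
    · rw [coeff_derivative]
      refine natDegree_mul_le.trans ?_
      have := hE (↑i - ↑j1 + 1)
      have h2 : ((((↑i - ↑j1 : ℕ) : R[X]) + 1)).natDegree = 0 := by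
        rw [← Nat.cast_succ]; exact natDegree_natCast _
      omega
    · simp
  · rw [Fin.addCases_right]
    split_ifs
    · exact hE _
    · simp

open Classical in
lemma bad_bound {F : Type} [Field F] [Fintype F] (P : F[X][X]) (hP : P.Monic) {M E : ℕ} (hM : P.natDegree = M)
    (hE : ∀ i, (P.coeff i).natDegree ≤ E) (h0 : (P.map (evalRingHom (0:F))).Separable) :
    (Finset.univ.filter (fun ζ : F => ¬ (P.map (evalRingHom ζ)).Separable)).card ≤ (M + M) * E := by
  have hr0 : res F[X] P M ≠ 0 := by
    intro h
    rw [sep_iff _ P hP hM, h] at h0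
    simp at h0
  refine (Finset.card_le_card (t := (res F[X] P M).roots.toFinset) ?_).trans ?_
  · intro ζ hζ
    simp only [Finset.mem_filter, Finset.mem_univ, true_and] at hζ
    rw [sep_iff _ P hP hM, not_not] at hζ
    rw [Multiset.mem_toFinset, mem_roots hr0]
    exact hζ
  · exact (Multiset.toFinset_card_le _).trans ((card_roots' _).trans (natDegree_res_le P hE))

lemma card_gal_le {k0 K : Type} [Field k0] [Field K] [Algebra k0 K] (p : k0[X]) [IsSplittingField k0 K p]
    [Fintype (K ≃ₐ[k0] K)] {M : ℕ} (hM : p.natDegree ≤ M) : Fintype.card (K ≃ₐ[k0] K) ≤ M.factorial := by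
  classical
  have h1 : Nat.card (K ≃ₐ[k0] K) ≤ Nat.card (Equiv.Perm (p.rootSet K)) := by
    haveI : Fact ((p.map (algebraMap k0 K)).Splits) := ⟨IsSplittingField.splits K p⟩
    refine Nat.card_le_card_of_injective (fun σ => Gal.galActionHom p K ((Gal.restrict p K) σ)) ?_
    intro σ τ h
    have h' := Gal.galActionHom_injective p K h
    ext x
    have hx : x ∈ Algebra.adjoin k0 (p.rootSet K) := by
      rw [IsSplittingField.adjoin_rootSet]; trivial
    refine Algebra.adjoin_induction (p := fun x _ => σ x = τ x) ?_ ?_ ?_ ?_ hx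
    · intro y hy
      have a1 := Gal.restrict_smul σ (⟨y, hy⟩ : p.rootSet K)
      have a2 := Gal.restrict_smul τ (⟨y, hy⟩ : p.rootSet K)
      rw [← a1, ← a2, h']
    · intro r; simp
    · intro a b _ _ ha hb; simp [ha, hb]
    · intro a b _ _ ha hb; simp [ha, hb]
  rw [Nat.card_eq_fintype_card] at h1
  refine h1.trans ?_
  rw [Nat.card_eq_fintype_card, Fintype.card_perm]
  apply Nat.factorial_le
  refine le_trans ?_ hM
  rw [← Nat.card_eq_fintype_card, Nat.card_coe_set_eq, rootSet_def, Set.ncard_coe_finset]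
  exact (Multiset.toFinset_card_le _).trans ((card_roots' _).trans natDegree_map_le)

end S9

set_option linter.unusedSimpArgs false
set_option linter.unusedSectionVars false
set_option linter.unusedVariables false
set_option linter.style.haveILetI false
namespace S9
open Polynomial

section spl
variable {F : Type} [Field F] [Fintype F] {F' : Type} [Field F'] [Algebra F F']
  {K : Type} [Field K] [Algebra (RatFunc F) K] 

lemma fixed_mem_range (x : F') (h : x ^ Fintype.card F = x) : x ∈ (algebraMap F F').range := by
  have h1 : (X ^ Fintype.card F - X : F[X]).Splits := by
    rw [splits_iff_card_roots, FiniteField.roots_X_pow_card_sub_X,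
      FiniteField.X_pow_card_sub_X_natDegree_eq F Fintype.one_lt_card]
    rfl
  have := Splits.mem_range_of_isRoot h1 (FiniteField.X_pow_card_sub_X_ne_zero F Fintype.one_lt_card)
    (i := algebraMap F F') (x := x) (by simp [h])
  exact this

open Classical in
lemma split_of_frob (P : F[X][X]) (hP : P.Monic) {M : ℕ} (hM : P.natDegree = M)
    [h : IsSplittingField (RatFunc F) K (P.map (algebraMap F[X] (RatFunc F)))] (ζ : F)
    (hsep : (P.map (evalRingHom ζ)).Separable)
    (ψ : OK F K →+* PowerSeries F')
    (h2 : ∀ p : F[X], ψ ⟨polyMap F K p, polyMap_mem_OK p⟩ = ser F' ζ p)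
    (hfr : ∀ u, PowerSeries.constantCoeff (ψ u) = (PowerSeries.constantCoeff (ψ u)) ^ Fintype.card F) :
    (P.map (evalRingHom ζ)).roots.toFinset.card = M := by
  have hPK : (P.map (polyMap F K)) = (P.map (algebraMap F[X] (RatFunc F))).map (algebraMap (RatFunc F) K) := by
    rw [map_map]; rfl
  have hspl : (P.map (polyMap F K)).Splits := by
    rw [hPK]; exact h.splits'
  have hprod := hspl.eq_prod_roots_of_monic (hP.map _)
  have hmem : ∀ y ∈ (P.map (polyMap F K)).roots, y ∈ OK F K := by
    intro y hy
    rw [mem_roots (hP.map _).ne_zero] at hy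
    exact ⟨P, hP, by rw [IsRoot, eval_map] at hy; exact hy⟩
  obtain ⟨s, hs⟩ : ∃ s : Multiset (OK F K), s.map (OK F K).subtype = (P.map (polyMap F K)).roots := by
    refine ⟨(P.map (polyMap F K)).roots.pmap (fun y hy => (⟨y, hy⟩ : OK F K)) hmem, ?_⟩
    rw [Multiset.map_pmap]
    simp only [Subring.subtype_apply]
    exact (Multiset.pmap_eq_map (fun y => y ∈ OK F K) (fun a => a) _ hmem).trans (Multiset.map_id' _)
  let pO : F[X] →+* OK F K := (polyMap F K).codRestrict (OK F K) (fun p => polyMap_mem_OK p)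
  have hpO : P.map pO = (s.map (fun y => X - C y)).prod := by
    apply Polynomial.map_injective (OK F K).subtype Subtype.coe_injective
    rw [map_map, Polynomial.map_multiset_prod, Multiset.map_map]
    have e : (OK F K).subtype.comp pO = polyMap F K := by ext <;> rfl
    rw [e, hprod, ← hs, Multiset.map_map]
    simp
  let φ : OK F K →+* F' := (PowerSeries.constantCoeff (R := F')).comp ψ
  have hφ : φ.comp pO = (algebraMap F F').comp (evalRingHom ζ) := by
    apply RingHom.ext
    intro p
    have : ψ (pO p) = ser F' ζ p := h2 p
    simp only [φ, RingHom.comp_apply]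
    rw [this, constantCoeff_ser]; rfl
  have hQ : (P.map (evalRingHom ζ)).map (algebraMap F F') = (s.map (fun y => X - C (φ y))).prod := by
    rw [map_map, ← hφ, ← map_map, hpO, Polynomial.map_multiset_prod, Multiset.map_map]
    simp
  have hsplQ : (P.map (evalRingHom ζ)).Splits := by
    refine Splits.of_splits_map (algebraMap F F') ?_ ?_
    · rw [hQ]
      apply Splits.multisetProd
      intro f hf
      obtain ⟨y, _, rfl⟩ := Multiset.mem_map.1 hf
      exact Splits.X_sub_C _
    · intro a ha
      rw [mem_roots ((hP.map _).map _).ne_zero, IsRoot, hQ, eval_multiset_prod, Multiset.map_map,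
        Multiset.prod_eq_zero_iff, Multiset.mem_map] at ha
      obtain ⟨y, _, hy⟩ := ha
      have : a = φ y := by simpa [sub_eq_zero] using hy
      rw [this]
      exact fixed_mem_range _ (hfr y).symm
  rw [Multiset.toFinset_card_of_nodup (nodup_roots hsep), ← hM, splits_iff_card_roots.1 hsplQ,
    hP.natDegree_map]
end spl
end S9

set_option linter.unusedSimpArgs false
set_option linter.unusedSectionVars false
set_option linter.unusedVariables false
set_option linter.style.haveILetI false
namespace S9
open Polynomial

lemma arith1 (d s A B c : ℕ) (hd : 1 ≤ d) (hB : s * (A + c) + c + 1 < d * A * (B + 1)) :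
    d * (s * (A + c) + (c + B)) + 1 < d * (A + 1) * (d * (B + 1)) := by
  have h1 : d * (s * (A + c) + c + 1) + d ≤ d * (d * A * (B + 1)) := by
    have := Nat.mul_le_mul_left d (Nat.succ_le_of_lt hB)
    nlinarith
  have h2 : d * (B + 1) ≤ d * (d * (B + 1)) := by
    have := Nat.mul_le_mul_left (d * (B+1)) hd
    nlinarith
  nlinarith

lemma arith2 (Δ c b A s d B S T : ℕ) (hA : A = 16 * Δ * (c + 1)) (hd : 1 ≤ d) (hdΔ : d ≤ Δ)
    (hB : d * A * B ≤ s * (A + c) + c + 1)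
    (hs : 6 * (Δ * b + Δ ^ 2 * (A + c) + Δ ^ 2 * c + Δ * (c + 1)) ≤ s)
    (hS : s ^ 2 ≤ S + b) (hT : S ≤ T + (d - 1) * (A + c + s * (c + B))) :
    3 * s ^ 2 ≤ 4 * Δ * T := by
  obtain ⟨e, rfl⟩ : ∃ e, d = e + 1 := ⟨d - 1, by omega⟩
  rw [Nat.add_sub_cancel] at hT
  have hΔ : 0 < Δ := by omega
  have hApos : 0 < A := by rw [hA]; positivity
  have hs1 : 1 ≤ s := by
    have : 1 ≤ Δ * (c + 1) := Nat.mul_pos (by omega) (by omega)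
    have h1 := Nat.zero_le (Δ * b)
    have h2 := Nat.zero_le (Δ ^ 2 * (A + c))
    have h3 := Nat.zero_le (Δ ^ 2 * c)
    omega
  zify at *
  have k1 : (s:ℤ)^2 ≤ T + e * (A + c + s * (c + B)) + b := by linarith
  -- multiply by (e+1) A
  have k2 : ((e:ℤ) + 1) * A * s^2 ≤ (e+1) * A * T + (e+1)*A*(e*(A+c+s*c) + b) + e * s * (s * (A + c) + c + 1) := by
    have h1 := mul_le_mul_of_nonneg_left k1 (show (0:ℤ) ≤ (e+1)*A by positivity)
    have h2 := mul_le_mul_of_nonneg_left hB (show (0:ℤ) ≤ e * s by positivity)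
    nlinarith
  have k3 : (A:ℤ) * s^2 ≤ (e+1) * A * T + (e+1)*A*(e*(A+c+s*c) + b) + e * s^2 * c + e * s * (c+1) := by
    nlinarith
  have k4 : 16 * (e * (s:ℤ)^2 * c) ≤ A * s^2 := by
    have : 16 * (e * (c:ℤ)) ≤ A := by
      rw [hA]; nlinarith
    have := mul_le_mul_of_nonneg_right this (sq_nonneg (s:ℤ))
    linarith
  have k5 : (e:ℤ) * s * (c+1) ≤ A * s * (Δ * (c+1)) := by
    have h1 : (e:ℤ) ≤ Δ := by linarith
    have h2 : (1:ℤ) ≤ A := by exact_mod_cast hApos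
    have h3 : (e:ℤ) * (s * (c+1)) ≤ Δ * (s * (c+1)) := mul_le_mul_of_nonneg_right h1 (by positivity)
    have h4 : 1 * (Δ * (s * (c+1)) : ℤ) ≤ A * (Δ * (s * (c+1))) := mul_le_mul_of_nonneg_right h2 (by positivity)
    linarith
  have k6 : ((e:ℤ)+1)*A*(e*(A+c+s*c) + b) ≤ A * s * (Δ * b + Δ ^ 2 * (A + c) + Δ ^ 2 * c) := by
    have h1 : (e:ℤ) ≤ Δ := by linarith
    have h0 : (0:ℤ) ≤ e := by positivity
    have h2 : ((e:ℤ)+1)*b ≤ Δ * b * s := by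
      have : ((e:ℤ)+1)*b ≤ Δ * b := mul_le_mul_of_nonneg_right hdΔ (by positivity)
      have : (Δ * b : ℤ) * 1 ≤ Δ * b * s := mul_le_mul_of_nonneg_left hs1 (by positivity)
      linarith
    have h3 : ((e:ℤ)+1)*e ≤ Δ^2 := by nlinarith
    have h4 : ((e:ℤ)+1)*e*(A+c) ≤ Δ^2*(A+c)*s := by
      have : ((e:ℤ)+1)*e*(A+c) ≤ Δ^2*(A+c) := mul_le_mul_of_nonneg_right h3 (by positivity)
      have : (Δ^2*(A+c) : ℤ) * 1 ≤ Δ^2*(A+c) * s := mul_le_mul_of_nonneg_left hs1 (by positivity)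
      linarith
    have h5 : ((e:ℤ)+1)*e*(s*c) ≤ Δ^2*(s*c) := mul_le_mul_of_nonneg_right h3 (by positivity)
    have := mul_le_mul_of_nonneg_left (add_le_add (add_le_add h2 h4) h5) (show (0:ℤ) ≤ A by positivity)
    clear * - this
    linear_combination this
  have k7 : 6 * (A * s * (Δ * b + Δ ^ 2 * (A + c) + Δ ^ 2 * c + Δ * (c+1))) ≤ (A:ℤ) * s^2 := by
    have := mul_le_mul_of_nonneg_left hs (show (0:ℤ) ≤ A * s by positivity)
    clear * - this
    linear_combination this
  have k8 : (A:ℤ) * (3 * s^2) ≤ A * (4 * (e+1) * T) := by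
    have : (0:ℤ) ≤ A * s^2 := by positivity
    have k3' := k3.trans (by linarith [k4, k5, k6] : _ ≤ ((e:ℤ)+1) * A * T + A * s * (Δ * b + Δ ^ 2 * (A + c) + Δ ^ 2 * c) + e * s^2 * c + A * s * (Δ * (c+1)))
    clear k1 k2 k3 k5 k6 hs hS hT hB
    linarith
  have k9 : (3 * s^2:ℤ) ≤ (4 * (e+1) * T) := le_of_mul_le_mul_left k8 (by exact_mod_cast hApos)
  have : (4 * (e+1) * T : ℤ) ≤ 4 * Δ * T := by
    apply mul_le_mul_of_nonneg_right _ (by positivity); linarith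
  linarith

open Classical in
theorem key_lemma (M E : ℕ) (hM0 : 0 < M) : ∃ Q0 : ℕ, ∀ (F : Type) [Field F] [Fintype F] (p a : ℕ)
    [Fact p.Prime] [CharP F p] (hcard : Fintype.card F = (p ^ a) ^ 2) (hQ : Q0 ≤ p ^ a)
    (P : F[X][X]) (hP : P.Monic) (hM : P.natDegree = M) (hE : ∀ i, (P.coeff i).natDegree ≤ E)
    (h0 : (P.map (evalRingHom (0:F))).roots.toFinset.card = M),
    3 * Fintype.card F ≤ 4 * M.factorial * (Finset.univ.filter (fun ζ : F =>
      (P.map (evalRingHom ζ)).roots.toFinset.card = M)).card := by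
  set Δ := M.factorial with hΔ
  set c := Δ * E with hc
  set b := (M + M) * E with hb
  set A := 16 * Δ * (c + 1) with hA
  refine ⟨6 * (Δ * b + Δ ^ 2 * (A + c) + Δ ^ 2 * c + Δ * (c + 1)) + Δ * (A + c) + 1, ?_⟩
  intro F _ _ p a _ _ hcard hQ P hP hM hE h0
  set s := p ^ a with hs
  have hd0 : (P.map (evalRingHom (0:F))).natDegree = M := by rw [hP.natDegree_map, hM]
  have hcr : Multiset.card (P.map (evalRingHom (0:F))).roots = M :=
    le_antisymm ((card_roots' _).trans hd0.le) (h0 ▸ Multiset.toFinset_card_le _)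
  have hspl0 : (P.map (evalRingHom (0:F))).Splits := by
    rw [splits_iff_card_roots, hcr, hd0]
  have hsep0 : (P.map (evalRingHom (0:F))).Separable := by
    rw [← nodup_roots_iff_of_splits (hP.map _).ne_zero hspl0]
    rw [← Multiset.toFinset_card_eq_card_iff_nodup, h0, hcr]
  have hres : res F[X] P M ≠ 0 := by
    intro h
    rw [sep_iff _ P hP hM, h] at hsep0
    simp at hsep0
  have hsepK : (P.map (algebraMap F[X] (RatFunc F))).Separable := by
    rw [sep_iff _ P hP hM]
    intro h
    exact hres (IsFractionRing.injective F[X] (RatFunc F) (by rw [h, map_zero]))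
  obtain ⟨K, _, _, _⟩ : ∃ (K : Type) (_ : Field K) (_ : Algebra (RatFunc F) K),
      IsSplittingField (RatFunc F) K (P.map (algebraMap F[X] (RatFunc F))) :=
    ⟨(P.map (algebraMap F[X] (RatFunc F))).SplittingField, inferInstance, inferInstance, inferInstance⟩
  haveI : FiniteDimensional (RatFunc F) K := IsSplittingField.finiteDimensional K (P.map (algebraMap F[X] (RatFunc F)))
  letI : Algebra F K := ((algebraMap (RatFunc F) K).comp (algebraMap F (RatFunc F))).toAlgebra
  haveI : IsScalarTower F (RatFunc F) K := IsScalarTower.of_algebraMap_eq (fun x => rfl)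
  haveI : IsGalois (RatFunc F) K := IsGalois.of_separable_splitting_field hsepK
  set d := Fintype.card (K ≃ₐ[RatFunc F] K) with hd
  have hdΔ : d ≤ Δ := card_gal_le (P.map (algebraMap F[X] (RatFunc F))) (by
    rw [hP.natDegree_map, hM])
  have hdpos : 1 ≤ d := Fintype.card_pos
  have hdf : Module.finrank (RatFunc F) K = d := by
    rw [← IsGalois.card_aut_eq_finrank, Nat.card_eq_fintype_card]
  -- place at zero
  obtain ⟨Φ0, ψ0, -, h20⟩ := exists_place (K := K) F P hP 0 (by
    rw [Algebra.algebraMap_self, map_id]; exact hspl0) hsep0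
  obtain ⟨bb, hb1, hb2⟩ := bounded_basis (K := K) P hP hE
  have hb3 : ∀ j, Lmem F K c (bb j) := fun j => (hb2 j).mono (Nat.mul_le_mul_right _ (hdf.le.trans hdΔ))
  have hfd : ∀ n, FiniteDimensional F (Lsub F K n) := fun n => (Lsub_upper 0 ψ0 h20 n).1
  have hup : ∀ n, Module.finrank F (Lsub F K n) ≤ d * n + 1 := fun n => (Lsub_upper 0 ψ0 h20 n).2
  have hlow : ∀ n, d * (n + 1 - c) ≤ Module.finrank F (Lsub F K n) := by
    intro n
    haveI := hfd n
    have := finrank_Lsub_ge bb hb1 hb3 n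
    rwa [hdf] at this
  have hΔpos : 0 < Δ := Nat.factorial_pos _
  have hApos : 0 < A := by positivity
  set B := (s * (A + c) + c + 1) / (d * A) with hB
  have hB1 : d * A * B ≤ s * (A + c) + c + 1 := Nat.mul_div_le _ _
  have hB2 : s * (A + c) + c + 1 < d * A * (B + 1) := by
    have := Nat.lt_mul_div_succ (s * (A + c) + c + 1) (show 0 < d * A by positivity)
    exact this
  have hcore := fun σ => core_w (K := K) (p := p) a ψ0 h20 σ (A + c) (c + B) (by
      have : d * (A + c) ≤ Δ * (A + c) := Nat.mul_le_mul_right _ hdΔ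
      rw [← hs, ← hd]; omega) (by
      refine lt_of_le_of_lt (hup _) (lt_of_lt_of_le ?_ (Nat.mul_le_mul (hlow _) (hlow _)))
      rw [show A + c + 1 - c = A + 1 by omega, show c + B + 1 - c = B + 1 by rw [add_assoc, Nat.add_sub_cancel_left]]
      exact arith1 d s A B c hdpos hB2)
  -- the good set
  set S := Finset.univ.filter (fun ζ : F => (P.map (evalRingHom ζ)).Separable) with hS
  have hplace : ∀ ζ ∈ S, ∃ (ψ : OK F K →+* PowerSeries (AlgebraicClosure F)) (σ : K ≃ₐ[RatFunc F] K),
      (∀ p : F[X], ψ ⟨polyMap F K p, polyMap_mem_OK p⟩ = ser (AlgebraicClosure F) ζ p) ∧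
      (∀ u : OK F K, PowerSeries.constantCoeff (ψ (actO σ u)) =
      (PowerSeries.constantCoeff (ψ u)) ^ Fintype.card F) := by
    intro ζ hζ
    obtain ⟨Φ, ψ, g1, g2⟩ := exists_place (K := K) (AlgebraicClosure F) P hP ζ
      (IsAlgClosed.splits _) (by simpa [hS] using hζ)
    obtain ⟨σ, hσ⟩ := frob_place ζ Φ ψ g1 g2
    exact ⟨ψ, σ, g2, hσ⟩
  have hplace' : ∀ ζ : F, ∃ (ψ : OK F K →+* PowerSeries (AlgebraicClosure F)) (σ : K ≃ₐ[RatFunc F] K), ζ ∈ S → 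
      (∀ p : F[X], ψ ⟨polyMap F K p, polyMap_mem_OK p⟩ = ser (AlgebraicClosure F) ζ p) ∧
      (∀ u : OK F K, PowerSeries.constantCoeff (ψ (actO σ u)) =
      (PowerSeries.constantCoeff (ψ u)) ^ Fintype.card F) := by
    have h0S : (0:F) ∈ S := by simp [hS, hsep0]
    intro ζ
    by_cases hζ : ζ ∈ S
    · obtain ⟨ψ, σ, h⟩ := hplace ζ hζ
      exact ⟨ψ, σ, fun _ => h⟩
    · obtain ⟨ψ, σ, h⟩ := hplace 0 h0S
      exact ⟨ψ, σ, fun h => absurd h hζ⟩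
  choose ψ fr hψ using hplace'
  haveI : CharP (AlgebraicClosure F) p := charP_of_injective_algebraMap (algebraMap F _).injective p
  have hcheb := cheb (Fintype.card F) S ψ (fun ζ h => (hψ ζ h).1) fr (fun ζ h => (hψ ζ h).2)
    (A + c + s * (c + B)) (by
      intro σ
      obtain ⟨w, hw, hw0, hφ⟩ := hcore σ
      refine ⟨w, hw, hw0, fun φ h => hφ _ φ ?_⟩
      rw [← hcard]; exact h)
  have hsub : (S.filter (fun ζ => fr ζ = 1)).card ≤ (Finset.univ.filter (fun ζ : F =>
      (P.map (evalRingHom ζ)).roots.toFinset.card = M)).card := by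
    apply Finset.card_le_card
    intro ζ hζ
    rw [Finset.mem_filter] at hζ
    rw [Finset.mem_filter]
    refine ⟨Finset.mem_univ _, ?_⟩
    refine split_of_frob (K := K) P hP hM ζ (by simpa [hS] using hζ.1) (ψ ζ) (hψ ζ hζ.1).1 ?_
    intro u
    rw [← (hψ ζ hζ.1).2 u, hζ.2]
    rfl
  have hSb : Fintype.card F ≤ S.card + b := by
    have h1 := bad_bound P hP hM hE hsep0
    have h2 : S.card + (Finset.univ.filter (fun ζ : F => ¬ (P.map (evalRingHom ζ)).Separable)).card = Fintype.card F := by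
      rw [hS, ← Finset.card_univ]
      convert Finset.card_filter_add_card_filter_not (s := (Finset.univ : Finset F)) (fun ζ : F => (P.map (evalRingHom ζ)).Separable)
    linarith
  have := arith2 Δ c b A s d B S.card _ hA hdpos hdΔ hB1 (by omega) (by rw [← hcard]; exact hSb) (hcheb.trans (Nat.add_le_add_right hsub _))
  rw [hcard]
  exact this
end S9

set_option linter.unusedSimpArgs false
set_option linter.unusedSectionVars false
set_option linter.unusedVariables false
set_option linter.style.haveILetI false
namespace S9
section red
open MvPolynomial

variable {k : ℕ} {A : Type} [CommRing A]

variable (k A) in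
noncomputable def Ldeg (n : ℕ) : Submodule A (MvPolynomial (Fin k) A) :=
  restrictSupport A {m | m.degree < n}

lemma mem_Ldeg {n : ℕ} {p : MvPolynomial (Fin k) A} : p ∈ Ldeg k A n ↔ ∀ m ∈ p.support, m.degree < n := by
  rw [Ldeg, mem_restrictSupport_iff]
  rfl

lemma Ldeg_mono {n m : ℕ} (h : n ≤ m) : Ldeg k A n ≤ Ldeg k A m := by
  intro p hp
  rw [mem_Ldeg] at *
  intro m hm
  exact (hp m hm).trans_le h

lemma Ldeg_zero {p : MvPolynomial (Fin k) A} (h : p ∈ Ldeg k A 0) : p = 0 := by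
  rw [mem_Ldeg] at h
  rw [← support_eq_empty, Finset.eq_empty_iff_forall_notMem]
  intro m hm
  exact absurd (h m hm) (by omega)

lemma exists_mem_Ldeg (p : MvPolynomial (Fin k) A) : ∃ n, p ∈ Ldeg k A n := by
  refine ⟨p.support.sup (fun m => m.degree) + 1, ?_⟩
  rw [mem_Ldeg]
  intro m hm
  exact Nat.lt_succ_of_le (Finset.le_sup (f := fun m => Finsupp.degree m) hm)

lemma mem_Ldeg_of_totalDegree {n : ℕ} {p : MvPolynomial (Fin k) A} (h : p.totalDegree < n) : p ∈ Ldeg k A n := by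
  rw [mem_Ldeg]
  intro m hm
  exact lt_of_le_of_lt (le_totalDegree hm) h

lemma monomial_mem_Ldeg (m : Fin k →₀ ℕ) (a : A) : monomial m a ∈ Ldeg k A (m.degree + 1) := by
  rw [mem_Ldeg]
  intro m' hm'
  have := support_monomial_subset hm'
  rw [Finset.mem_singleton] at this
  rw [this]; omega

lemma Ldeg_mul {n m : ℕ} {p q : MvPolynomial (Fin k) A} (hp : p ∈ Ldeg k A n) (hq : q ∈ Ldeg k A (m + 1)) :
    p * q ∈ Ldeg k A (n + m) := by
  classical
  rw [mem_Ldeg] at *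
  intro β hβ
  obtain ⟨a, ha, b, hb, rfl⟩ := Finset.mem_add.1 (support_mul p q hβ)
  have := hp a ha
  have := hq b hb
  rw [map_add]; omega

/-- same leading form in degree n -/
def Lead (n : ℕ) (p q : MvPolynomial (Fin k) A) : Prop := q ∈ Ldeg k A (n + 1) ∧ p - q ∈ Ldeg k A n

lemma Lead.left {n : ℕ} {p q : MvPolynomial (Fin k) A} (h : Lead n p q) : p ∈ Ldeg k A (n + 1) := by
  have := Submodule.add_mem _ (Ldeg_mono (Nat.le_succ n) h.2) h.1
  simpa using this

lemma Lead.mul {n m : ℕ} {p q p' q' : MvPolynomial (Fin k) A} (h : Lead n p q) (h' : Lead m p' q') :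
    Lead (n + m) (p * p') (q * q') := by
  refine ⟨?_, ?_⟩
  · have := Ldeg_mul h.1 h'.1
    rwa [show n + 1 + m = n + m + 1 by ring] at this
  · have e : p * p' - q * q' = (p - q) * q' + (p' - q') * p := by ring
    rw [e]
    refine Submodule.add_mem _ (Ldeg_mul h.2 h'.1) ?_
    rw [add_comm]
    exact Ldeg_mul h'.2 h.left

lemma Lead.refl_monomial (m : Fin k →₀ ℕ) (a : A) : Lead m.degree (monomial m a) (monomial m a) :=
  ⟨monomial_mem_Ldeg m a, by simp⟩

lemma Lead.one : Lead 0 (1 : MvPolynomial (Fin k) A) 1 := by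
  have := Lead.refl_monomial (A := A) (0 : Fin k →₀ ℕ) 1
  simpa using this

lemma Lead.pow {n : ℕ} {p q : MvPolynomial (Fin k) A} (h : Lead n p q) (a : ℕ) : Lead (a * n) (p ^ a) (q ^ a) := by
  induction a with
  | zero => simpa using Lead.one
  | succ a ih => rw [pow_succ, pow_succ, Nat.succ_mul]; exact ih.mul h

lemma Lead.prod {ι : Type} (s : Finset ι) (n : ι → ℕ) (p q : ι → MvPolynomial (Fin k) A)
    (h : ∀ i ∈ s, Lead (n i) (p i) (q i)) : Lead (∑ i ∈ s, n i) (∏ i ∈ s, p i) (∏ i ∈ s, q i) := by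
  classical
  induction s using Finset.induction_on with
  | empty => simpa using Lead.one
  | insert a s ha ih =>
    rw [Finset.sum_insert ha, Finset.prod_insert ha, Finset.prod_insert ha]
    exact (h a (Finset.mem_insert_self _ _)).mul (ih fun i hi => h i (Finset.mem_insert_of_mem hi))

noncomputable def fpoly (D : ℕ) (g : Fin k → MvPolynomial (Fin k) A) (i : Fin k) : MvPolynomial (Fin k) A :=
  X i ^ D + g i

noncomputable def fideal (D : ℕ) (g : Fin k → MvPolynomial (Fin k) A) : Ideal (MvPolynomial (Fin k) A) :=
  Ideal.span (Set.range (fpoly D g))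

lemma fpoly_mem (D : ℕ) (g : Fin k → MvPolynomial (Fin k) A) (i : Fin k) : fpoly D g i ∈ fideal D g :=
  Ideal.subset_span ⟨i, rfl⟩

/-- remainder part of exponent -/
noncomputable def emod (D : ℕ) (β : Fin k →₀ ℕ) : Fin k →₀ ℕ := Finsupp.equivFunOnFinite.symm (fun i => β i % D)

noncomputable def Tmon (D : ℕ) (g : Fin k → MvPolynomial (Fin k) A) (β : Fin k →₀ ℕ) : MvPolynomial (Fin k) A :=
  monomial (emod D β) 1 * ∏ i, fpoly D g i ^ (β i / D)

noncomputable def Top (D : ℕ) (g : Fin k → MvPolynomial (Fin k) A) :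
    MvPolynomial (Fin k) A →ₗ[A] MvPolynomial (Fin k) A :=
  (basisMonomials (Fin k) A).constr A (Tmon D g)

lemma Top_monomial (D : ℕ) (g : Fin k → MvPolynomial (Fin k) A) (β : Fin k →₀ ℕ) :
    Top D g (monomial β 1) = Tmon D g β := by
  have := (basisMonomials (Fin k) A).constr_basis A (Tmon D g) β
  rwa [coe_basisMonomials] at this

variable {D : ℕ} {g : Fin k → MvPolynomial (Fin k) A}

lemma Lead_fpoly (hg : ∀ i, (g i).totalDegree < D) (i : Fin k) : Lead D (fpoly D g i) (X i ^ D) := by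
  refine ⟨?_, ?_⟩
  · rw [X_pow_eq_monomial]
    have := monomial_mem_Ldeg (Finsupp.single i D) (1 : A)
    simpa using this
  · simpa [fpoly] using mem_Ldeg_of_totalDegree (hg i)

lemma emod_decomp (β : Fin k →₀ ℕ) :
    (monomial (emod D β) 1 * ∏ i, (X i ^ D) ^ (β i / D) : MvPolynomial (Fin k) A) = monomial β 1 := by
  rw [monomial_eq, monomial_eq]
  simp only [map_one, one_mul]
  rw [Finsupp.prod_fintype _ _ (by simp), Finsupp.prod_fintype _ _ (by simp), ← Finset.prod_mul_distrib]
  refine Finset.prod_congr rfl fun i _ => ?_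
  rw [← pow_mul, ← pow_add]
  congr 1
  simp only [emod, Finsupp.equivFunOnFinite_symm_apply_apply]
  exact Nat.mod_add_div _ _

lemma Lead_Tmon (hg : ∀ i, (g i).totalDegree < D) (β : Fin k →₀ ℕ) :
    Lead β.degree (Tmon D g β) (monomial β 1) := by
  have h := (Lead.refl_monomial (emod D β) (1:A)).mul (Lead.prod Finset.univ (fun i => β i / D * D)
    (fun i => fpoly D g i ^ (β i / D)) (fun i => (X i ^ D) ^ (β i / D))
    (fun i _ => (Lead_fpoly hg i).pow _))
  rw [emod_decomp] at h
  have e : β.degree = Finsupp.degree (emod D β) + ∑ i, β i / D * D := by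
    rw [Finsupp.degree_eq_sum, Finsupp.degree_eq_sum, ← Finset.sum_add_distrib]
    refine Finset.sum_congr rfl fun i _ => ?_
    simp only [emod, Finsupp.equivFunOnFinite_symm_apply_apply]
    rw [mul_comm]; exact (Nat.mod_add_div _ _).symm
  rw [e]; exact h

lemma Top_sub_mem (hg : ∀ i, (g i).totalDegree < D) {n : ℕ} {p : MvPolynomial (Fin k) A}
    (hp : p ∈ Ldeg k A (n + 1)) : Top D g p - p ∈ Ldeg k A n := by
  rw [mem_Ldeg] at hp
  have e : Top D g p - p = ∑ m ∈ p.support, coeff m p • (Tmon D g m - monomial m 1) := by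
    conv_lhs => rw [p.as_sum]
    rw [map_sum, ← Finset.sum_sub_distrib]
    refine Finset.sum_congr rfl fun m _ => ?_
    have : monomial m (coeff m p) = coeff m p • monomial m (1:A) := by rw [smul_monomial]; simp
    rw [this, map_smul, Top_monomial, smul_sub]
  rw [e]
  refine Submodule.sum_mem _ fun m hm => Submodule.smul_mem _ _ ?_
  exact Ldeg_mono (by have := hp m hm; omega) (Lead_Tmon hg m).2

lemma Top_injective (hg : ∀ i, (g i).totalDegree < D) : Function.Injective (Top D g) := by
  rw [injective_iff_map_eq_zero]
  intro p hp
  obtain ⟨n, hn⟩ := exists_mem_Ldeg p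
  induction n with
  | zero => exact Ldeg_zero hn
  | succ n ih =>
    apply ih
    have := Top_sub_mem hg hn
    rw [hp, zero_sub] at this
    simpa using Submodule.neg_mem _ this

lemma Top_surjective (hg : ∀ i, (g i).totalDegree < D) : Function.Surjective (Top D g) := by
  intro p
  obtain ⟨n, hn⟩ := exists_mem_Ldeg p
  induction n generalizing p with
  | zero => exact ⟨0, by rw [Ldeg_zero hn, map_zero]⟩
  | succ n ih =>
    obtain ⟨r, hr⟩ := ih _ (Top_sub_mem hg hn)
    exact ⟨p - r, by rw [map_sub, hr]; ring⟩

/-- support in non-reduced exponents -/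
noncomputable def NonRed (k : ℕ) (A : Type) [CommRing A] (D : ℕ) : Submodule A (MvPolynomial (Fin k) A) :=
  restrictSupport A {m | ∃ i, D ≤ m i}

noncomputable def Redd (k : ℕ) (A : Type) [CommRing A] (D : ℕ) : Submodule A (MvPolynomial (Fin k) A) :=
  restrictSupport A {m | ∀ i, m i < D}

lemma fpoly_mul_Tmon (hD : 0 < D) (i : Fin k) (β : Fin k →₀ ℕ) :
    fpoly D g i * Tmon D g β = Tmon D g (β + Finsupp.single i D) := by
  classical
  have e1 : emod D (β + Finsupp.single i D) = emod D β := by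
    ext j
    simp only [emod, Finsupp.equivFunOnFinite_symm_apply_apply, Finsupp.add_apply]
    by_cases h : i = j
    · subst h; simp
    · simp [Finsupp.single_apply, h]
  rw [Tmon, Tmon, e1, mul_left_comm]
  congr 1
  rw [← Finset.mul_prod_erase _ _ (Finset.mem_univ i), ← Finset.mul_prod_erase _ _ (Finset.mem_univ i),
    ← mul_assoc, ← pow_succ']
  congr 1
  · congr 1
    simp [Nat.add_div_right _ hD]
  · refine Finset.prod_congr rfl fun j hj => ?_
    have : i ≠ j := fun h => (Finset.mem_erase.1 hj).1 h.symm
    simp [Finsupp.single_apply, this]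

lemma fideal_le (hD : 0 < D) (hg : ∀ i, (g i).totalDegree < D) (p : MvPolynomial (Fin k) A) (hp : p ∈ fideal D g) :
    ∃ r ∈ NonRed k A D, Top D g r = p := by
  have key : ∀ i (q : MvPolynomial (Fin k) A), ∃ r ∈ NonRed k A D, Top D g r = fpoly D g i * q := by
    intro i q
    obtain ⟨q', rfl⟩ := Top_surjective hg q
    refine ⟨q' * monomial (Finsupp.single i D) 1, ?_, ?_⟩
    · rw [NonRed, mem_restrictSupport_iff]
      intro m hm
      classical
      obtain ⟨a, ha, b, hb, rfl⟩ := Finset.mem_add.1 (support_mul _ _ hm)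
      have := support_monomial_subset hb
      rw [Finset.mem_singleton] at this
      exact ⟨i, by simp [this]⟩
    · induction q' using MvPolynomial.induction_on' with
      | monomial m a =>
        have h1 : (monomial m a : MvPolynomial (Fin k) A) = a • monomial m 1 := by rw [smul_monomial]; simp
        rw [h1, smul_mul_assoc, map_smul, map_smul, monomial_mul, mul_one, Top_monomial, Top_monomial,
          mul_smul_comm, fpoly_mul_Tmon hD]
      | add p q hp hq => rw [add_mul, map_add, map_add, hp, hq, mul_add]
  rw [fideal] at hp
  induction hp using Submodule.span_induction with
  | mem x hx =>
    obtain ⟨i, rfl⟩ := hx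
    simpa using key i 1
  | zero => exact ⟨0, Submodule.zero_mem _, map_zero _⟩
  | add x y _ _ hx hy =>
    obtain ⟨r, hr, rfl⟩ := hx
    obtain ⟨r', hr', rfl⟩ := hy
    exact ⟨r + r', Submodule.add_mem _ hr hr', map_add _ _ _⟩
  | smul a x _ hx =>
    -- multiplication by arbitrary elements
    obtain ⟨r, hr, rfl⟩ := hx
    have hT : ∀ r ∈ NonRed k A D, ∃ r' ∈ NonRed k A D, Top D g r' = a * Top D g r := by
      intro r hr
      rw [NonRed, mem_restrictSupport_iff] at hr
      rw [r.as_sum, map_sum, Finset.mul_sum]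
      have : ∀ m ∈ r.support, ∃ r' ∈ NonRed k A D, Top D g r' = a * Top D g (monomial m (coeff m r)) := by
        intro m hm
        obtain ⟨i, hi⟩ := hr hm
        have h1 : (monomial m (coeff m r) : MvPolynomial (Fin k) A) = coeff m r • monomial m 1 := by rw [smul_monomial]; simp
        have h2 : m = (m - Finsupp.single i D) + Finsupp.single i D := by
          rw [tsub_add_cancel_of_le]
          simpa using hi
        rw [h1, map_smul, Top_monomial, h2, ← fpoly_mul_Tmon hD]
        obtain ⟨r', hr', e⟩ := key i (coeff m r • (a * Tmon D g (m - Finsupp.single i D)))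
        refine ⟨r', hr', ?_⟩
        rw [e, ← h2]
        simp only [mul_smul_comm]
        congr 1; ring
      choose! φ h1 h2 using this
      refine ⟨∑ m ∈ r.support, φ m, Submodule.sum_mem _ h1, ?_⟩
      rw [map_sum]
      exact Finset.sum_congr rfl h2
    exact hT r hr

lemma Top_red (p : MvPolynomial (Fin k) A) (hp : p ∈ Redd k A D) : Top D g p = p := by
  rw [Redd, mem_restrictSupport_iff] at hp
  conv_lhs => rw [p.as_sum]
  conv_rhs => rw [p.as_sum]
  rw [map_sum]
  refine Finset.sum_congr rfl fun m hm => ?_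
  have h1 : (monomial m (coeff m p) : MvPolynomial (Fin k) A) = coeff m p • monomial m 1 := by rw [smul_monomial]; simp
  rw [h1, map_smul, Top_monomial, Tmon]
  congr 1
  have h2 : ∀ i, m i < D := hp hm
  have e1 : emod D m = m := by
    ext j
    simp [emod, Nat.mod_eq_of_lt (h2 j)]
  simp [e1, Nat.div_eq_of_lt (h2 _)]

/-- Freeness: a reduced polynomial in the ideal is zero. -/
lemma red_inter (hD : 0 < D) (hg : ∀ i, (g i).totalDegree < D) (p : MvPolynomial (Fin k) A)
    (hp : p ∈ Redd k A D) (hI : p ∈ fideal D g) : p = 0 := by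
  obtain ⟨r, hr, e⟩ := fideal_le hD hg p hI
  rw [← Top_red (g := g) p hp] at e
  have := Top_injective hg e
  subst this
  rw [NonRed, mem_restrictSupport_iff] at hr
  rw [Redd, mem_restrictSupport_iff] at hp
  rw [← support_eq_empty, Finset.eq_empty_iff_forall_notMem]
  intro m hm
  obtain ⟨i, hi⟩ := hr hm
  have := hp hm i
  omega

end red
end S9

set_option linter.unusedSimpArgs false
set_option linter.unusedSectionVars false
set_option linter.unusedVariables false
set_option linter.style.haveILetI false
namespace S9
section red2
open MvPolynomial

variable {k : ℕ} {A : Type} [CommRing A]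

noncomputable def emb {D : ℕ} (e : Fin k → Fin D) : Fin k →₀ ℕ := Finsupp.equivFunOnFinite.symm (fun i => (e i : ℕ))

lemma emb_injective {D : ℕ} : Function.Injective (emb (k := k) (D := D)) := by
  intro a b h
  ext i
  have := congrArg (fun f : Fin k →₀ ℕ => f i) h
  simpa [emb] using this

lemma exists_emb {D : ℕ} (β : Fin k →₀ ℕ) (h : ∀ i, β i < D) : ∃ e : Fin k → Fin D, emb e = β :=
  ⟨fun i => ⟨β i, h i⟩, by ext i; simp [emb]⟩

lemma C0 {D : ℕ} (W : ℕ → AddSubgroup A) (hWm : Monotone W) (hW1 : (1:A) ∈ W 0)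
    (hWmul : ∀ n, ∀ a ∈ W 1, ∀ b ∈ W n, a * b ∈ W (n + 1))
    (g : Fin k → MvPolynomial (Fin k) A) (hg : ∀ i, (g i).totalDegree < D)
    (hgW : ∀ i m, coeff m (g i) ∈ W 1) : ∀ (n : ℕ) (β : Fin k →₀ ℕ), β.degree = n →
      ∃ c : (Fin k → Fin D) → A, (∀ e, c e ∈ W n) ∧
        (monomial β 1 : MvPolynomial (Fin k) A) - ∑ e, monomial (emb e) (c e) ∈ fideal D g := by
  classical
  intro n
  induction n using Nat.strong_induction_on with
  | _ n ih =>
  intro β hβ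
  by_cases hred : ∀ i, β i < D
  · obtain ⟨e, rfl⟩ := exists_emb β hred
    refine ⟨Pi.single e 1, ?_, ?_⟩
    · intro e'
      by_cases h : e' = e
      · subst h; simpa using hWm (Nat.zero_le n) hW1
      · simp [Pi.single_apply, h, (W n).zero_mem]
    · rw [Finset.sum_eq_single e]
      · simp
      · intro b _ hb; simp [Pi.single_apply, hb]
      · simp
  · push Not at hred
    obtain ⟨i, hi⟩ := hred
    set γ := β - Finsupp.single i D with hγ
    have h2 : β = γ + Finsupp.single i D := by
      rw [hγ, tsub_add_cancel_of_le]
      simpa using hi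
    have hdeg : γ.degree + D = n := by
      rw [← hβ, h2, map_add]; simp
    have : ∀ m ∈ (g i).support, ∃ c : (Fin k → Fin D) → A, (∀ e, c e ∈ W (n - 1)) ∧
        (monomial (γ + m) 1 : MvPolynomial (Fin k) A) - ∑ e, monomial (emb e) (c e) ∈ fideal D g := by
      intro m hm
      have hm' : m.degree < D := lt_of_le_of_lt (le_totalDegree hm) (hg i)
      have hlt : (γ + m).degree < n := by rw [map_add]; omega
      obtain ⟨c, h1, h3⟩ := ih _ hlt _ rfl
      exact ⟨c, fun e => hWm (by omega) (h1 e), h3⟩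
    choose! c h1 h3 using this
    have hn : n - 1 + 1 = n := by have := hg i; omega
    refine ⟨fun e => - ∑ m ∈ (g i).support, coeff m (g i) * c m e, ?_, ?_⟩
    · intro e
      refine (W n).neg_mem ((W n).sum_mem fun m hm => ?_)
      rw [← hn]
      exact hWmul _ _ (hgW i m) _ (h1 m hm e)
    · have e1 : (monomial β 1 : MvPolynomial (Fin k) A) = monomial γ 1 * fpoly D g i
          - ∑ m ∈ (g i).support, C (coeff m (g i)) * monomial (γ + m) 1 := by
        have : monomial γ 1 * g i = ∑ m ∈ (g i).support, C (coeff m (g i)) * monomial (γ + m) 1 := by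
          conv_lhs => rw [(g i).as_sum]
          rw [Finset.mul_sum]
          refine Finset.sum_congr rfl fun m _ => ?_
          rw [monomial_mul, C_mul_monomial]; simp
        rw [← this, fpoly, mul_add, X_pow_eq_monomial, monomial_mul, ← h2]
        simp
      have e2 : ∑ e : Fin k → Fin D, monomial (emb e) (- ∑ m ∈ (g i).support, coeff m (g i) * c m e)
          = - ∑ m ∈ (g i).support, C (coeff m (g i)) * ∑ e : Fin k → Fin D, monomial (emb e) (c m e) := by
        simp only [map_neg, map_sum, Finset.mul_sum, C_mul_monomial, Finset.sum_neg_distrib]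
        rw [Finset.sum_comm]
      rw [e1, e2]
      have e3 : monomial γ 1 * fpoly D g i
          - ∑ m ∈ (g i).support, C (coeff m (g i)) * monomial (γ + m) 1 -
          - ∑ m ∈ (g i).support, C (coeff m (g i)) * ∑ e : Fin k → Fin D, monomial (emb e) (c m e)
          = monomial γ 1 * fpoly D g i - ∑ m ∈ (g i).support, C (coeff m (g i)) *
            (monomial (γ + m) 1 - ∑ e : Fin k → Fin D, monomial (emb e) (c m e)) := by
        simp only [mul_sub, Finset.sum_sub_distrib]
        ring
      rw [e3]
      refine Ideal.sub_mem _ (Ideal.mul_mem_left _ _ (fpoly_mem D g i)) (Ideal.sum_mem _ fun m hm => ?_)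
      exact Ideal.mul_mem_left _ _ (h3 m hm)

section field
variable {F : Type} [Field F] {D : ℕ} (g : Fin k → MvPolynomial (Fin k) F)

lemma mons_span (hg : ∀ i, (g i).totalDegree < D) :
    ⊤ ≤ Submodule.span F (Set.range (fun e : Fin k → Fin D =>
      Ideal.Quotient.mk (fideal D g) (monomial (emb e) 1))) := by
  intro x _
  obtain ⟨p, rfl⟩ := Ideal.Quotient.mk_surjective x
  rw [p.as_sum, map_sum]
  refine Submodule.sum_mem _ fun m _ => ?_
  have h1 : (monomial m (coeff m p) : MvPolynomial (Fin k) F) = coeff m p • monomial m 1 := by rw [smul_monomial]; simp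
  rw [h1]
  have h2 : Ideal.Quotient.mk (fideal D g) (coeff m p • monomial m 1) =
    coeff m p • Ideal.Quotient.mk (fideal D g) (monomial m 1) := rfl
  rw [h2]
  refine Submodule.smul_mem _ _ ?_
  obtain ⟨c, -, hc⟩ := C0 (A := F) (D := D) (fun _ => ⊤) (fun _ _ _ => le_rfl) trivial
    (fun _ _ _ _ _ => trivial) g hg (fun _ _ => trivial) _ m rfl
  rw [← Ideal.Quotient.eq_zero_iff_mem, map_sub, sub_eq_zero] at hc
  rw [hc, map_sum]
  refine Submodule.sum_mem _ fun e _ => ?_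
  have h1 : (monomial (emb e) (c e) : MvPolynomial (Fin k) F) = c e • monomial (emb e) 1 := by rw [smul_monomial]; simp
  rw [h1]
  have h2 : Ideal.Quotient.mk (fideal D g) (c e • monomial (emb e) 1) =
    c e • Ideal.Quotient.mk (fideal D g) (monomial (emb e) 1) := rfl
  rw [h2]
  exact Submodule.smul_mem _ _ (Submodule.subset_span (Set.mem_range_self e))

lemma mons_indep (hD : 0 < D) (hg : ∀ i, (g i).totalDegree < D) :
    LinearIndependent F (fun e : Fin k → Fin D =>
      Ideal.Quotient.mk (fideal D g) (monomial (emb e) 1)) := by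
  classical
  rw [Fintype.linearIndependent_iff]
  intro c hc e
  have hr : (∑ e : Fin k → Fin D, monomial (emb e) (c e) : MvPolynomial (Fin k) F) ∈ fideal D g := by
    rw [← Ideal.Quotient.eq_zero_iff_mem, map_sum, ← hc]
    refine Finset.sum_congr rfl fun e _ => ?_
    have h1 : (monomial (emb e) (c e) : MvPolynomial (Fin k) F) = c e • monomial (emb e) 1 := by rw [smul_monomial]; simp
    rw [h1]; rfl
  have h0 := red_inter hD hg _ (Submodule.sum_mem _ fun e _ => by
    rw [Redd, monomial_mem_restrictSupport]
    left
    intro i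
    simp [emb]) hr
  have := congrArg (coeff (emb e)) h0
  rw [coeff_sum, Finset.sum_eq_single e] at this
  · simpa using this
  · intro b _ hb
    rw [coeff_monomial, if_neg]
    intro h; exact hb (emb_injective h)
  · simp

noncomputable def monBasis (hD : 0 < D) (hg : ∀ i, (g i).totalDegree < D) :
    Module.Basis (Fin k → Fin D) F (MvPolynomial (Fin k) F ⧸ fideal D g) :=
  Module.Basis.mk (mons_indep g hD hg) (mons_span g hg)

lemma monBasis_apply (hD : 0 < D) (hg : ∀ i, (g i).totalDegree < D) (e : Fin k → Fin D) :
    monBasis g hD hg e = Ideal.Quotient.mk (fideal D g) (monomial (emb e) 1) := by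
  simp [monBasis]

/-- zeros -/
def zeros (D : ℕ) (g : Fin k → MvPolynomial (Fin k) F) : Set (Fin k → F) :=
  {x | ∀ i, x i ^ D + eval x (g i) = 0}

lemma mem_zeros_iff (x : Fin k → F) : x ∈ zeros D g ↔ ∀ p ∈ fideal D g, eval x p = 0 := by
  constructor
  · intro h p hp
    have : fideal D g ≤ RingHom.ker (eval x) := by
      rw [fideal, Ideal.span_le]
      rintro _ ⟨i, rfl⟩
      have := h i
      simpa [fpoly, RingHom.mem_ker] using this
    exact this hp
  · intro h i
    simpa [fpoly] using h _ (fpoly_mem D g i)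

noncomputable def evq (x : zeros D g) : MvPolynomial (Fin k) F ⧸ fideal D g →ₐ[F] F :=
  Ideal.Quotient.liftₐ _ (aeval (x : Fin k → F)) (fun p hp => by
    have := (mem_zeros_iff g _).1 x.2 p hp
    rw [← coe_aeval_eq_eval] at this
    exact this)

lemma evq_mk (x : zeros D g) (p : MvPolynomial (Fin k) F) : evq g x (Ideal.Quotient.mk _ p) = eval (x : Fin k → F) p := by
  rw [← coe_aeval_eq_eval]
  rfl

/-- interpolation -/
lemma exists_interp {F : Type} [Field F] (s : Finset (Fin k → F)) (x : Fin k → F) :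
    ∃ p : MvPolynomial (Fin k) F, eval x p = 1 ∧ ∀ y ∈ s, y ≠ x → eval y p = 0 := by
  classical
  have h : ∀ y, y ≠ x → ∃ p : MvPolynomial (Fin k) F, eval x p = 1 ∧ eval y p = 0 := by
    intro y hy
    obtain ⟨i, hi⟩ := Function.ne_iff.1 hy
    have : x i - y i ≠ 0 := sub_ne_zero.2 (Ne.symm hi)
    exact ⟨C (x i - y i)⁻¹ * (X i - C (y i)), by simp [this], by simp⟩
  choose! q hq1 hq2 using h
  refine ⟨∏ y ∈ s.erase x, q y, ?_, ?_⟩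
  · rw [map_prod]
    exact Finset.prod_eq_one fun y hy => hq1 y (Finset.mem_erase.1 hy).1
  · intro y hy hyx
    rw [map_prod]
    exact Finset.prod_eq_zero (Finset.mem_erase.2 ⟨hyx, hy⟩) (hq2 y hyx)

lemma card_zeros_le [Finite F] (hg : ∀ i, (g i).totalDegree < D) : Nat.card (zeros D g) ≤ D ^ k := by
  classical
  haveI := Fintype.ofFinite F
  haveI : Fintype (zeros D g) := Fintype.ofFinite _
  let ev : (MvPolynomial (Fin k) F ⧸ fideal D g) →ₗ[F] (zeros D g → F) :=
    LinearMap.pi (fun x => (evq g x).toLinearMap)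
  have hs : Function.Surjective ev := by
    intro c
    choose P hP1 hP2 using fun x : zeros D g => exists_interp (Finset.univ : Finset (Fin k → F)) (x : Fin k → F)
    refine ⟨∑ x, c x • Ideal.Quotient.mk _ (P x), ?_⟩
    ext y
    simp only [ev, LinearMap.pi_apply, map_sum, map_smul, AlgHom.toLinearMap_apply, evq_mk]
    rw [Finset.sum_eq_single y]
    · simp [hP1]
    · intro b _ hb
      rw [hP2 b y (Finset.mem_univ _) (fun h => hb (Subtype.ext h.symm))]; simp
    · simp
  have hsp := mons_span g hg
  haveI : Module.Finite F (MvPolynomial (Fin k) F ⧸ fideal D g) :=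
    ⟨⟨Finset.univ.image (fun e : Fin k → Fin D => Ideal.Quotient.mk (fideal D g) (monomial (emb e) 1)), by
      rw [Finset.coe_image, Finset.coe_univ, Set.image_univ]; exact top_le_iff.1 hsp⟩⟩
  have h1 := LinearMap.finrank_le_finrank_of_surjective hs
  have h2 := finrank_range_le_card (R := F) (fun e : Fin k → Fin D => Ideal.Quotient.mk (fideal D g) (monomial (emb e) 1))
  rw [Set.finrank, top_le_iff.1 hsp, finrank_top] at h2
  rw [Module.finrank_fintype_fun_eq_card] at h1
  rw [Nat.card_eq_fintype_card]
  refine h1.trans (h2.trans ?_)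
  simp
end field
end red2
end S9

set_option linter.unusedSimpArgs false
set_option linter.unusedSectionVars false
set_option linter.unusedVariables false
set_option linter.style.haveILetI false
namespace S9
section spl
open MvPolynomial

variable {k : ℕ} {F : Type} [Field F] {D : ℕ} (g : Fin k → MvPolynomial (Fin k) F)

noncomputable def thp (τ : Fin k → F) : MvPolynomial (Fin k) F := ∑ i, C (τ i) * X i

noncomputable def thT (D : ℕ) (g : Fin k → MvPolynomial (Fin k) F) (τ : Fin k → F) : Module.End F (MvPolynomial (Fin k) F ⧸ fideal D g) :=
  LinearMap.mulLeft F (Ideal.Quotient.mk (fideal D g) (thp τ))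

lemma eval_thp (τ : Fin k → F) (x : Fin k → F) : eval x (thp τ) = ∑ i, τ i * x i := by
  simp [thp]

lemma thT_natDegree [Module.Finite F (MvPolynomial (Fin k) F ⧸ fideal D g)] (hD : 0 < D) (hg : ∀ i, (g i).totalDegree < D) (τ : Fin k → F) :
    (thT D g τ).charpoly.natDegree = D ^ k := by
  rw [LinearMap.charpoly_natDegree, Module.finrank_eq_card_basis (monBasis g hD hg)]
  simp

lemma roots_of_zeros [Finite F] [Module.Finite F (MvPolynomial (Fin k) F ⧸ fideal D g)] [DecidableEq F] (τ : Fin k → F)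
    (hinj : ∀ x ∈ zeros D g, ∀ y ∈ zeros D g, ∑ i, τ i * x i = ∑ i, τ i * y i → x = y) :
    Nat.card (zeros D g) ≤ (thT D g τ).charpoly.roots.toFinset.card := by
  classical
  haveI := Fintype.ofFinite F
  haveI : Fintype (zeros D g) := Fintype.ofFinite _
  rw [Nat.card_eq_fintype_card, ← Finset.card_univ]
  refine Finset.card_le_card_of_injOn (fun x => ∑ i, τ i * x.1 i) ?_ ?_
  · intro x _
    rw [Finset.mem_coe, Multiset.mem_toFinset, Polynomial.mem_roots (LinearMap.charpoly_monic _).ne_zero]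
    have h1 := LinearMap.aeval_self_charpoly (thT D g τ)
    have h2 : Polynomial.aeval (thT D g τ) (thT D g τ).charpoly =
       Algebra.lmul F _ (Polynomial.aeval (Ideal.Quotient.mk (fideal D g) (thp τ)) (thT D g τ).charpoly) := by
      rw [← Polynomial.aeval_algHom_apply]; rfl
    rw [h1] at h2
    have h3 := congrArg (fun f => f 1) h2.symm
    simp only [Algebra.coe_lmul_eq_mul, LinearMap.mul_apply', mul_one, LinearMap.zero_apply] at h3
    have h4 := congrArg (evq g x) h3
    rw [← Polynomial.aeval_algHom_apply, evq_mk, eval_thp, map_zero] at h4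
    simpa [Polynomial.IsRoot.def] using h4
  · intro x _ y _ h
    exact Subtype.ext (hinj _ x.2 _ y.2 h)

lemma zeros_of_roots [Finite F] [DecidableEq F] [Module.Finite F (MvPolynomial (Fin k) F ⧸ fideal D g)] (hD : 0 < D) (hg : ∀ i, (g i).totalDegree < D) (τ : Fin k → F)
    (h : (thT D g τ).charpoly.roots.toFinset.card = D ^ k) : D ^ k ≤ Nat.card (zeros D g) := by
  classical
  haveI := Fintype.ofFinite F
  haveI : Fintype (zeros D g) := Fintype.ofFinite _
  set P := (thT D g τ).charpoly with hP
  have hP0 : P ≠ 0 := (LinearMap.charpoly_monic _).ne_zero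
  have hnd : P.roots.Nodup := by
    rw [← Multiset.toFinset_card_eq_card_iff_nodup]
    refine le_antisymm (Multiset.toFinset_card_le _) ?_
    rw [h, ← thT_natDegree g hD hg τ]
    exact Polynomial.card_roots' _
  have key : ∀ ρ ∈ P.roots.toFinset, ∃ x : zeros D g, ∑ i, τ i * x.1 i = ρ := by
    intro ρ hρ
    rw [Multiset.mem_toFinset] at hρ
    have hroot := (Polynomial.mem_roots hP0).1 hρ
    have hev : (thT D g τ).HasEigenvalue ρ := (Module.End.hasEigenvalue_iff_isRoot_charpoly _ _).2 hroot
    have hmul : P.rootMultiplicity ρ ≤ 1 := by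
      rw [← Polynomial.count_roots]; exact Multiset.nodup_iff_count_le_one.1 hnd ρ
    have hfr : Module.finrank F ((thT D g τ).eigenspace ρ) ≤ 1 := (LinearMap.finrank_eigenspace_le _ _).trans hmul
    obtain ⟨v, hv, hv0⟩ := hev.exists_hasEigenvector
    have hv' : Ideal.Quotient.mk (fideal D g) (thp τ) * v = ρ • v := Module.End.mem_eigenspace_iff.1 hv
    have hmem : ∀ i, Ideal.Quotient.mk (fideal D g) (X i) * v ∈ (thT D g τ).eigenspace ρ := by
      intro i
      rw [Module.End.mem_eigenspace_iff]
      change Ideal.Quotient.mk (fideal D g) (thp τ) * (Ideal.Quotient.mk (fideal D g) (X i) * v) = _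
      rw [mul_left_comm, hv', mul_smul_comm]
    have hex : ∀ i, ∃ c : F, Ideal.Quotient.mk (fideal D g) (X i) * v = c • v := by
      intro i
      have := (finrank_le_one_iff (K := F)).1 hfr
      obtain ⟨w, hw⟩ := this
      obtain ⟨a, ha⟩ := hw ⟨v, hv⟩
      obtain ⟨b, hb⟩ := hw ⟨_, hmem i⟩
      have ha' : a • w.1 = v := congrArg Subtype.val ha
      have hb' : b • w.1 = Ideal.Quotient.mk (fideal D g) (X i) * v := congrArg Subtype.val hb
      have ha0 : a ≠ 0 := by rintro rfl; apply hv0; rw [← ha']; simp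
      refine ⟨b * a⁻¹, ?_⟩
      rw [← hb', ← ha', smul_smul, mul_assoc, inv_mul_cancel₀ ha0, mul_one]
    choose p hp using hex
    have hall : ∀ h : MvPolynomial (Fin k) F, Ideal.Quotient.mk (fideal D g) h * v = eval p h • v := by
      intro h
      induction h using MvPolynomial.induction_on with
      | C a =>
        obtain ⟨w, rfl⟩ := Ideal.Quotient.mk_surjective v
        have : Ideal.Quotient.mk (fideal D g) (a • w) = a • Ideal.Quotient.mk (fideal D g) w := rfl
        rw [eval_C, ← map_mul, ← this, smul_eq_C_mul]
      | add a b ha hb => rw [map_add, add_mul, ha, hb, map_add, add_smul]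
      | mul_X a i ha => rw [map_mul, mul_assoc, hp, mul_smul_comm, ha, smul_smul, map_mul, eval_X, mul_comm]
    refine ⟨⟨p, (mem_zeros_iff g p).2 ?_⟩, ?_⟩
    · intro h hh
      have := hall h
      rw [Ideal.Quotient.eq_zero_iff_mem.2 hh, zero_mul] at this
      exact (smul_eq_zero.1 this.symm).resolve_right hv0
    · have := hall (thp τ)
      rw [hv', eval_thp] at this
      exact (smul_left_injective F hv0 this).symm
  choose f hf using fun ρ : P.roots.toFinset => key ρ.1 ρ.2
  rw [← h, Nat.card_eq_fintype_card, ← Fintype.card_coe]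
  refine Fintype.card_le_of_injective f ?_
  intro a b hab
  exact Subtype.ext (by rw [← hf a, ← hf b, hab])

lemma finquot (g : Fin k → MvPolynomial (Fin k) F) (hD : 0 < D) (hg : ∀ i, (g i).totalDegree < D) :
   Module.Finite F (MvPolynomial (Fin k) F ⧸ fideal D g) := Module.Finite.of_basis (monBasis g hD hg)

end spl
end S9

set_option linter.unusedSimpArgs false
set_option linter.unusedSectionVars false
set_option linter.unusedVariables false
set_option linter.style.haveILetI false
namespace S9
section fam
open MvPolynomial

variable {k : ℕ} {F : Type} [Field F] {D : ℕ}

/-- coefficient degree bound -/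
def CB (n : ℕ) (p : Polynomial (Polynomial F)) : Prop := ∀ i, (p.coeff i).natDegree ≤ n

lemma CB_mul {m n : ℕ} {p q : Polynomial (Polynomial F)} (hp : CB m p) (hq : CB n q) : CB (m + n) (p * q) := by
  intro i
  rw [Polynomial.coeff_mul]
  refine Polynomial.natDegree_sum_le_of_forall_le _ _ fun x _ => ?_
  exact Polynomial.natDegree_mul_le.trans (add_le_add (hp _) (hq _))

lemma CB_prod {ι : Type} (s : Finset ι) (f : ι → Polynomial (Polynomial F)) {n : ℕ} (h : ∀ i, CB n (f i)) :
    CB (s.card * n) (∏ i ∈ s, f i) := by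
  classical
  induction s using Finset.induction_on with
  | empty =>
    intro i
    simp only [Finset.prod_empty, Polynomial.coeff_one]
    split_ifs <;> simp
  | insert a s ha ih =>
    rw [Finset.prod_insert ha, Finset.card_insert_of_notMem ha, add_mul, one_mul, add_comm]
    exact CB_mul (h a) ih

lemma CB_charpoly {ι : Type} [Fintype ι] [DecidableEq ι] (N : Matrix ι ι (Polynomial F)) {n : ℕ} (h : ∀ i j, (N i j).natDegree ≤ n) :
    CB (Fintype.card ι * n) N.charpoly := by
  rw [Matrix.charpoly, Matrix.det_apply]
  intro i
  rw [Polynomial.finsetSum_coeff]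
  refine Polynomial.natDegree_sum_le_of_forall_le _ _ fun σ _ => ?_
  have h1 : ∀ i j, CB n (N.charmatrix i j) := by
    intro a b m
    by_cases hab : a = b
    · subst hab
      rw [Matrix.charmatrix_apply_eq, Polynomial.coeff_sub, Polynomial.coeff_X, Polynomial.coeff_C]
      refine (Polynomial.natDegree_sub_le _ _).trans (max_le ?_ ?_)
      · split_ifs <;> simp
      · split_ifs
        · exact h _ _
        · simp
    · rw [Matrix.charmatrix_apply_ne _ _ _ hab, Polynomial.coeff_neg, Polynomial.natDegree_neg, Polynomial.coeff_C]
      split_ifs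
      · exact h _ _
      · simp
  have h2 := CB_prod Finset.univ (fun i => N.charmatrix (σ i) i) (fun i => h1 _ _)
  have h3 : (Equiv.Perm.sign σ • ∏ i, N.charmatrix (σ i) i).coeff i = Equiv.Perm.sign σ • (∏ i, N.charmatrix (σ i) i).coeff i := by
    rw [Polynomial.coeff_smul]
  rw [h3]
  rcases Int.units_eq_one_or (Equiv.Perm.sign σ) with h4 | h4
  · rw [h4, one_smul]; exact h2 i
  · rw [h4, Units.neg_smul, one_smul, Polynomial.natDegree_neg]; exact h2 i

noncomputable def gA (g0 v : Fin k → MvPolynomial (Fin k) F) (i : Fin k) : MvPolynomial (Fin k) (Polynomial F) :=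
  map Polynomial.C (g0 i) + C Polynomial.X * map Polynomial.C (v i)

noncomputable def gz (g0 v : Fin k → MvPolynomial (Fin k) F) (ζ : F) (i : Fin k) : MvPolynomial (Fin k) F :=
  g0 i + C ζ * v i

variable (g0 v : Fin k → MvPolynomial (Fin k) F)

lemma map_gA (ζ : F) (i : Fin k) : map (Polynomial.evalRingHom ζ) (gA g0 v i) = gz g0 v ζ i := by
  have : (Polynomial.evalRingHom ζ).comp Polynomial.C = RingHom.id F := by ext; simp
  simp [gA, gz, map_map, this, MvPolynomial.map_id]

lemma tdeg_map {A B : Type} [CommRing A] [CommRing B] (f : A →+* B) (p : MvPolynomial (Fin k) A) :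
    (map f p).totalDegree ≤ p.totalDegree :=
  Finset.sup_mono (support_map_subset _ _)

lemma gA_totalDegree {n : ℕ} (h0 : ∀ i, (g0 i).totalDegree < n) (hv : ∀ i, (v i).totalDegree < n) (i : Fin k) :
    (gA g0 v i).totalDegree < n := by
  refine (totalDegree_add _ _).trans_lt (max_lt ((tdeg_map _ _).trans_lt (h0 i)) ?_)
  refine (totalDegree_mul _ _).trans_lt ?_
  rw [totalDegree_C, zero_add]
  exact (tdeg_map _ _).trans_lt (hv i)

lemma gz_totalDegree {n : ℕ} (h0 : ∀ i, (g0 i).totalDegree < n) (hv : ∀ i, (v i).totalDegree < n) (ζ : F) (i : Fin k) :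
    (gz g0 v ζ i).totalDegree < n := by
  refine (totalDegree_add _ _).trans_lt (max_lt (h0 i) ?_)
  refine (totalDegree_mul _ _).trans_lt ?_
  rw [totalDegree_C, zero_add]
  exact (hv i)

lemma gA_coeff (i : Fin k) (m) : (coeff m (gA g0 v i)).natDegree ≤ 1 := by
  rw [gA, coeff_add, coeff_C_mul, coeff_map, coeff_map]
  refine (Polynomial.natDegree_add_le _ _).trans (max_le (by simp) ?_)
  refine Polynomial.natDegree_mul_le.trans ?_
  simp [Polynomial.natDegree_X]

lemma map_fideal (ζ : F) (p : MvPolynomial (Fin k) (Polynomial F)) (hp : p ∈ fideal D (gA g0 v)) :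
    map (Polynomial.evalRingHom ζ) p ∈ fideal D (gz g0 v ζ) := by
  have : fideal D (gA g0 v) ≤ (fideal D (gz g0 v ζ)).comap (map (Polynomial.evalRingHom ζ)) := by
    rw [fideal, Ideal.span_le]
    rintro _ ⟨i, rfl⟩
    have h := fpoly_mem D (gz g0 v ζ) i
    simpa [fpoly, map_gA] using h
  exact this hp

noncomputable def Wf (F : Type) [Field F] (n : ℕ) : AddSubgroup (Polynomial F) := (Polynomial.degreeLE F n).toAddSubgroup

lemma mem_Wf {n : ℕ} {p : Polynomial F} : p ∈ Wf F n ↔ p.natDegree ≤ n := by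
  rw [Polynomial.natDegree_le_iff_degree_le]
  exact Polynomial.mem_degreeLE

lemma emb_degree (e : Fin k → Fin D) : (emb e).degree ≤ k * (D - 1) := by
  rw [Finsupp.degree_eq_sum]
  calc ∑ i, emb e i ≤ ∑ i : Fin k, (D - 1) := Finset.sum_le_sum fun i _ => by
        simp [emb]; omega
    _ = _ := by simp

lemma exists_mat (h0 : ∀ i, (g0 i).totalDegree < D) (hv : ∀ i, (v i).totalDegree < D) (τ : Fin k → F) :
    ∃ N : Matrix (Fin k → Fin D) (Fin k → Fin D) (Polynomial F), (∀ e' e, (N e' e).natDegree ≤ k * D + 1) ∧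
      ∀ e, (∑ i, C (Polynomial.C (τ i)) * X i) * monomial (emb e) 1 - ∑ e', monomial (emb e') (N e' e) ∈ fideal D (gA g0 v) := by
  have := fun (i : Fin k) (e : Fin k → Fin D) => C0 (D := D) (Wf F) (fun a b hab p hp => mem_Wf.2 ((mem_Wf.1 hp).trans hab))
    (mem_Wf.2 (by simp)) (fun n a ha b hb => by
      rw [mem_Wf] at *; exact Polynomial.natDegree_mul_le.trans (by omega)) (gA g0 v) (gA_totalDegree g0 v h0 hv)
      (fun i m => mem_Wf.2 (gA_coeff g0 v i m)) _ (emb e + Finsupp.single i 1) rfl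
  choose c hc1 hc2 using this
  refine ⟨fun e' e => ∑ i, Polynomial.C (τ i) * c i e e', ?_, ?_⟩
  · intro e' e
    refine Polynomial.natDegree_sum_le_of_forall_le _ _ fun i _ => ?_
    refine Polynomial.natDegree_mul_le.trans ?_
    rw [Polynomial.natDegree_C, zero_add]
    refine (mem_Wf.1 (hc1 i e e')).trans ?_
    rw [map_add]
    have h1 := emb_degree e
    have h2 : k * (D - 1) ≤ k * D := Nat.mul_le_mul_left _ (Nat.sub_le _ _)
    simp
    omega
  · intro e
    have : (∑ i, C (Polynomial.C (τ i)) * X i) * monomial (emb e) 1 - ∑ e', monomial (emb e') (∑ i, Polynomial.C (τ i) * c i e e')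
       = ∑ i, C (Polynomial.C (τ i)) * (monomial (emb e + Finsupp.single i 1) 1 - ∑ e', monomial (emb e') (c i e e')) := by
      simp only [mul_sub, Finset.sum_sub_distrib, Finset.sum_mul, Finset.mul_sum, map_sum, C_mul_monomial]
      rw [Finset.sum_comm (s := Finset.univ (α := Fin k → Fin D))]
      congr 1
      refine Finset.sum_congr rfl fun i _ => ?_
      rw [mul_assoc, X, monomial_mul, C_mul_monomial, add_comm]
      simp
    rw [this]
    exact Ideal.sum_mem _ fun i _ => Ideal.mul_mem_left _ _ (hc2 i e)

lemma exists_fam (hD : 0 < D) (h0 : ∀ i, (g0 i).totalDegree < D) (hv : ∀ i, (v i).totalDegree < D) (τ : Fin k → F) :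
    ∃ P : Polynomial (Polynomial F), P.Monic ∧ P.natDegree = D ^ k ∧ CB (D ^ k * (k * D + 1)) P ∧
      ∀ ζ, ∀ [Module.Finite F (MvPolynomial (Fin k) F ⧸ fideal D (gz g0 v ζ))],
       P.map (Polynomial.evalRingHom ζ) = (thT D (gz g0 v ζ) τ).charpoly := by
  classical
  obtain ⟨N, hN1, hN2⟩ := exists_mat g0 v h0 hv τ
  refine ⟨N.charpoly, N.charpoly_monic, ?_, ?_, ?_⟩
  · rw [Matrix.charpoly_natDegree_eq_dim]; simp
  · have := CB_charpoly N hN1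
    simpa using this
  · intro ζ _
    have hg := gz_totalDegree g0 v h0 hv ζ
    rw [← LinearMap.charpoly_toMatrix _ (monBasis (gz g0 v ζ) hD hg), ← Matrix.charpoly_map]
    congr 1
    ext e' e
    rw [LinearMap.toMatrix_apply]
    have h1 := map_fideal g0 v ζ _ (hN2 e)
    rw [← Ideal.Quotient.eq_zero_iff_mem, map_sub, map_sub, sub_eq_zero] at h1
    have h2 : thT D (gz g0 v ζ) τ (monBasis (gz g0 v ζ) hD hg e) =
       ∑ e', ((N e' e).eval ζ) • monBasis (gz g0 v ζ) hD hg e' := by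
      have h3 : thT D (gz g0 v ζ) τ (monBasis (gz g0 v ζ) hD hg e) = Ideal.Quotient.mk _ (thp τ) * monBasis (gz g0 v ζ) hD hg e := rfl
      rw [h3, monBasis_apply, ← map_mul]
      have h4 : thp τ * monomial (emb e) 1 = map (Polynomial.evalRingHom ζ) ((∑ i, C (Polynomial.C (τ i)) * X i) * monomial (emb e) 1) := by
        simp [thp]
      rw [h4, h1, map_sum, map_sum]
      refine Finset.sum_congr rfl fun e' _ => ?_
      have h5 : (monomial (emb e') ((N e' e).eval ζ) : MvPolynomial (Fin k) F) = (N e' e).eval ζ • monomial (emb e') 1 := by rw [smul_monomial]; simp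
      rw [monBasis_apply, map_monomial, Polynomial.coe_evalRingHom, h5]; rfl
    rw [h2, map_sum, Finsupp.finsetSum_apply, Finset.sum_eq_single e']
    · simp
    · intro b _ hb; simp [Finsupp.single_apply, hb]
    · simp

end fam
end S9

set_option linter.unusedSimpArgs false
set_option linter.unusedSectionVars false
set_option linter.unusedVariables false
set_option linter.style.haveILetI false
namespace S9
section cnt
open MvPolynomial

lemma exists_tau {k : ℕ} {F : Type} [Field F] [Fintype F] (s : Finset (Fin k → F)) (h : s.card ^ 2 * k < Fintype.card F) :
    ∃ τ : Fin k → F, ∀ x ∈ s, ∀ y ∈ s, ∑ i, τ i * x i = ∑ i, τ i * y i → x = y := by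
  classical
  let P : (Fin k → F) × (Fin k → F) → Polynomial F := fun w => ∑ i : Fin k, Polynomial.monomial (i : ℕ) (w.1 i - w.2 i)
  have hP0 : ∀ w ∈ s.offDiag, P w ≠ 0 := by
    intro w hw h
    rw [Finset.mem_offDiag] at hw
    apply hw.2.2
    ext i
    have := congrArg (fun p => p.coeff (i : ℕ)) h
    simp only [P, Polynomial.finsetSum_coeff, Polynomial.coeff_monomial, Polynomial.coeff_zero] at this
    rw [Finset.sum_eq_single i] at this
    · simpa [sub_eq_zero] using this
    · intro b _ hb
      rw [if_neg]
      intro h; exact hb (Fin.ext h)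
    · simp
  have hdeg : (∏ w ∈ s.offDiag, P w).natDegree < Fintype.card F := by
    refine lt_of_le_of_lt ?_ h
    refine (Polynomial.natDegree_prod_le _ _).trans ?_
    refine (Finset.sum_le_card_nsmul _ _ k ?_).trans ?_
    · intro w _
      refine Polynomial.natDegree_sum_le_of_forall_le _ _ fun i _ => ?_
      exact (Polynomial.natDegree_monomial_le _).trans i.2.le
    · rw [smul_eq_mul, Finset.offDiag_card, sq]
      exact Nat.mul_le_mul_right _ (Nat.sub_le _ _)
  obtain ⟨τ, hτ⟩ := Polynomial.exists_eval_ne_zero_of_natDegree_lt_card (∏ w ∈ s.offDiag, P w) (Finset.prod_ne_zero_iff.2 hP0)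
    (by rw [Cardinal.mk_fintype]; exact_mod_cast hdeg)
  refine ⟨fun i => τ ^ (i : ℕ), fun x hx y hy hxy => ?_⟩
  by_contra hne
  rw [Polynomial.eval_prod, Finset.prod_ne_zero_iff] at hτ
  apply hτ (x, y) (Finset.mem_offDiag.2 ⟨hx, hy, hne⟩)
  simp only [P, Polynomial.eval_finsetSum, Polynomial.eval_monomial, sub_mul, Finset.sum_sub_distrib]
  rw [sub_eq_zero]
  simpa [mul_comm] using hxy

abbrev VV (k : ℕ) (F : Type) [Field F] (t : ℕ) : Type := restrictTotalDegree (Fin k) F t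

instance finVV (k : ℕ) (F : Type) [Field F] [Finite F] (t : ℕ) : Finite (VV k F t) := by
  have hf : Module.Finite F (restrictTotalDegree (Fin k) F t) := by
    have : Finite {m : Fin k →₀ ℕ | m.degree ≤ t} := by
      apply Set.Finite.to_subtype
      exact Finsupp.finite_of_degree_le t
    exact Module.Finite.of_basis (basisRestrictSupport F {m : Fin k →₀ ℕ | m.degree ≤ t})
  exact Module.finite_of_finite F

def gv {k : ℕ} {F : Type} [Field F] {t : ℕ} (g : Fin k → VV k F t) : Fin k → MvPolynomial (Fin k) F := fun i => (g i).1

def Split {k : ℕ} {F : Type} [Field F] {t : ℕ} (D : ℕ) (g : Fin k → VV k F t) : Prop := Nat.card (zeros D (gv g)) = D ^ k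

lemma gv_deg {k : ℕ} {F : Type} [Field F] {t D : ℕ} (htD : t < D) (g : Fin k → VV k F t) (i : Fin k) : (gv g i).totalDegree < D :=
  ((mem_restrictTotalDegree _ _ _).1 (g i).2).trans_lt htD

open Classical in
lemma line_count (k D t : ℕ) (htD : t < D) : ∃ Q1 : ℕ, ∀ (F : Type) [Field F] [Fintype F] (p a : ℕ) [Fact p.Prime]
    [CharP F p] (hcard : Fintype.card F = (p^a)^2) (hQ : Q1 ≤ p^a) (g0 v : Fin k → VV k F t)
    (h0 : Split D g0), 3 * Fintype.card F ≤ 4 * (D ^ k).factorial * 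
      (Finset.univ.filter (fun ζ : F => Split D (g0 + ζ • v))).card := by
  have hD : 0 < D := by omega
  obtain ⟨Q0, hQ0⟩ := key_lemma (D ^ k) (D ^ k * (k * D + 1)) (by positivity)
  refine ⟨max Q0 ((D ^ k) ^ 2 * k + 1), ?_⟩
  intro F _ _ p a _ _ hcard hQ g0 v h0
  have hgz : ∀ ζ : F, gv (g0 + ζ • v) = gz (gv g0) (gv v) ζ := by
    intro ζ; funext i
    simp [gv, gz, smul_eq_C_mul]
  have hzf : (zeros D (gv g0)).Finite := Set.toFinite _
  have hzc : hzf.toFinset.card = D ^ k := by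
    rw [← h0, Nat.card_coe_set_eq, Set.ncard_eq_toFinset_card _ hzf]
  obtain ⟨τ, hτ⟩ := exists_tau hzf.toFinset (by
    rw [hzc, hcard]
    have h1 := (le_max_right _ _).trans hQ
    have h2 : p ^ a ≤ (p ^ a) ^ 2 := Nat.le_self_pow (by norm_num) _
    omega)
  obtain ⟨P, hP1, hP2, hP3, hP4⟩ := exists_fam (gv g0) (gv v) hD (gv_deg htD g0) (gv_deg htD v) τ
  have hfin : ∀ ζ, Module.Finite F (MvPolynomial (Fin k) F ⧸ fideal D (gz (gv g0) (gv v) ζ)) := fun ζ =>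
    finquot _ hD (gz_totalDegree _ _ (gv_deg htD g0) (gv_deg htD v) ζ)
  have e0 : gz (gv g0) (gv v) 0 = gv g0 := by funext i; simp [gz]
  have := hQ0 F p a hcard ((le_max_left _ _).trans hQ) P hP1 hP2 hP3 (by
    haveI := hfin 0
    rw [hP4 0]
    refine le_antisymm ?_ ?_
    · refine (Multiset.toFinset_card_le _).trans ((Polynomial.card_roots' _).trans ?_)
      rw [thT_natDegree _ hD (gz_totalDegree _ _ (gv_deg htD g0) (gv_deg htD v) 0)]
    · refine le_trans ?_ (roots_of_zeros _ τ ?_)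
      · rw [e0]; exact h0.ge
      · rw [e0]; intro x hx y hy
        exact hτ x (by simpa using hx) y (by simpa using hy))
  refine this.trans (Nat.mul_le_mul_left _ (Finset.card_le_card ?_))
  intro ζ hζ
  rw [Finset.mem_filter] at hζ ⊢
  refine ⟨hζ.1, ?_⟩
  haveI := hfin ζ
  have h2 := hζ.2
  rw [hP4 ζ] at h2
  rw [Split, hgz]
  have hdd := gz_totalDegree _ _ (gv_deg htD g0) (gv_deg htD v) ζ
  exact le_antisymm (card_zeros_le _ hdd) (zeros_of_roots _ hD hdd τ h2)

theorem split_count (k D t : ℕ) (htD : t < D) : ∃ Q1 : ℕ, ∀ (F : Type) [Field F] [Fintype F] (p a : ℕ) [Fact p.Prime]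
    [CharP F p] (hcard : Fintype.card F = (p^a)^2) (hQ : Q1 ≤ p^a) (hD : Nat.card {y : F // y ^ D = 1} = D),
     Nat.card (Fin k → VV k F t) ≤ 2 * (D ^ k).factorial * Nat.card {g : Fin k → VV k F t // Split D g} := by
  classical
  obtain ⟨Q1, h⟩ := line_count k D t htD
  refine ⟨max Q1 (4 * (D ^ k).factorial), ?_⟩
  intro F _ _ p a _ _ hcard hQ hD
  haveI := Fintype.ofFinite (VV k F t)
  let g0 : Fin k → VV k F t := fun i => ⟨C (-1), by rw [mem_restrictTotalDegree, totalDegree_C]; exact Nat.zero_le _⟩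
  have h0 : Split D g0 := by
    rw [Split]
    have e : zeros D (gv g0) ≃ (Fin k → {y : F // y ^ D = 1}) :=
      { toFun := fun x i => ⟨x.1 i, by have := x.2 i; simpa [gv, g0, ← sub_eq_add_neg, sub_eq_zero] using this⟩
        invFun := fun y => ⟨fun i => (y i).1, fun i => by simp [gv, g0, (y i).2]⟩
        left_inv := fun x => rfl
        right_inv := fun y => rfl }
    rw [Nat.card_congr e, Nat.card_fun, hD]; simp
  have h1 := fun v => h F p a hcard ((le_max_left _ _).trans hQ) g0 v h0
  set q := Fintype.card F with hq
  set N := Fintype.card (Fin k → VV k F t) with hN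
  set S := (Finset.univ.filter (fun g : Fin k → VV k F t => Split D g)).card with hS
  have hqM : 4 * (D ^ k).factorial ≤ q := by
    rw [hcard]; exact ((le_max_right _ _).trans hQ).trans (Nat.le_self_pow (by norm_num) _)
  rw [Nat.card_eq_fintype_card, Nat.card_eq_fintype_card, Fintype.card_subtype]
  change N ≤ _ * S
  have hsum : N * (3 * q) ≤ 4 * (D ^ k).factorial * ∑ v : Fin k → VV k F t, (Finset.univ.filter (fun ζ : F => Split D (g0 + ζ • v))).card := by
    rw [Finset.mul_sum, ← smul_eq_mul]
    exact Finset.card_nsmul_le_sum _ _ _ (fun v _ => h1 v)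
  have hswap : ∑ v : Fin k → VV k F t, (Finset.univ.filter (fun ζ : F => Split D (g0 + ζ • v))).card
     = ∑ ζ : F, (Finset.univ.filter (fun v : Fin k → VV k F t => Split D (g0 + ζ • v))).card := by
    simp only [Finset.card_filter]
    rw [Finset.sum_comm]
  have hb : ∀ ζ : F, ζ ≠ 0 → (Finset.univ.filter (fun v : Fin k → VV k F t => Split D (g0 + ζ • v))).card = S := by
    intro ζ hζ
    rw [hS]
    refine Finset.card_bij (fun v _ => g0 + ζ • v) ?_ ?_ ?_
    · intro v hv; simpa using hv
    · intro v _ w _ hvw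
      exact smul_right_injective _ hζ (add_left_cancel hvw)
    · intro g hg
      refine ⟨ζ⁻¹ • (g - g0), ?_, ?_⟩
      · simp only [Finset.mem_filter, Finset.mem_univ, true_and, smul_smul, mul_inv_cancel₀ hζ, one_smul, add_sub_cancel] at hg ⊢
        exact hg
      · simp only [smul_smul, mul_inv_cancel₀ hζ, one_smul, add_sub_cancel]
  have hle : ∑ ζ : F, (Finset.univ.filter (fun v : Fin k → VV k F t => Split D (g0 + ζ • v))).card ≤ N + q * S := by
    rw [← Finset.add_sum_erase _ _ (Finset.mem_univ (0 : F))]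
    refine add_le_add (Finset.card_le_univ _) ?_
    rw [Finset.sum_congr rfl (fun ζ hζ => hb ζ (Finset.mem_erase.1 hζ).1), Finset.sum_const, smul_eq_mul]
    exact Nat.mul_le_mul_right _ (Finset.card_le_univ _)
  rw [hswap] at hsum
  have h3 : N * (3 * q) ≤ 4 * (D ^ k).factorial * (N + q * S) := hsum.trans (Nat.mul_le_mul_left _ hle)
  have h4 : 4 * (D ^ k).factorial * N ≤ q * N := Nat.mul_le_mul_right _ hqM
  have hq0 : 0 < q := Fintype.card_pos
  have h5 : q * (2 * N) ≤ q * (4 * (D ^ k).factorial * S) := by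
    generalize (D ^ k).factorial = m at *
    nlinarith
  have h6 := Nat.le_of_mul_le_mul_left h5 hq0
  generalize (D ^ k).factorial = m at *
  nlinarith

end cnt
end S9

set_option linter.unusedSimpArgs false
set_option linter.unusedSectionVars false
set_option linter.unusedVariables false
set_option linter.style.haveILetI false
namespace S9
section hts
open MvPolynomial

/-- coordinates in `I` are independent modulo `P` -/
def Indep {k : ℕ} {F : Type} [Field F] (P : Ideal (MvPolynomial (Fin k) F)) (I : Finset (Fin k)) : Prop :=
  ∀ f ∈ P, (∀ m ∈ f.support, ∀ i, i ∉ I → m i = 0) → f = 0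

lemma exists_indep {F : Type} [Field F] : ∀ (k : ℕ) (P : Ideal (MvPolynomial (Fin k) F)), P.IsPrime →
    ∃ I : Finset (Fin k), Indep P I ∧ (k : ℕ∞) ≤ I.card + P.height := by
  classical
  intro k
  induction k with
  | zero =>
    intro P hP
    refine ⟨∅, ?_, by simp⟩
    intro f hf _
    by_contra h0
    apply hP.ne_top
    rw [Ideal.eq_top_iff_one]
    have h1 := eq_C_of_isEmpty f
    have hc : coeff 0 f ≠ 0 := by
      intro h; rw [h, C_0] at h1; exact h0 h1
    have := P.mul_mem_left (C (coeff 0 f)⁻¹) hf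
    rw [h1, ← C_mul, coeff_C, if_pos rfl, inv_mul_cancel₀ hc, C_1] at this
    exact this
  | succ n ih =>
    intro P hP
    let e := (finSuccEquiv F n).toRingEquiv
    set P' : Ideal (Polynomial (MvPolynomial (Fin n) F)) := P.map e with hP'
    have hprime : P'.IsPrime := Ideal.map_isPrime_of_equiv e
    have hht : P'.height = P.height := e.height_map P
    set p := P'.comap (Polynomial.C) with hp
    have hpp : p.IsPrime := Ideal.IsPrime.comap _
    have hmem : ∀ f, f ∈ P ↔ finSuccEquiv F n f ∈ P' := by
      intro f
      constructor
      · intro h; exact Ideal.mem_map_of_mem e h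
      · intro h
        rw [hP', Ideal.mem_map_of_equiv] at h
        obtain ⟨x, hx, hxe⟩ := h
        have : x = f := e.injective hxe
        rwa [← this]
    obtain ⟨I, hI, hIc⟩ := ih p hpp
    haveI h1 : (p.map Polynomial.C).IsPrime := Ideal.isPrime_map_C_of_isPrime
    have hlo : (p.map Polynomial.C).LiesOver p := ⟨by
      ext x
      change x ∈ p ↔ Polynomial.C x ∈ p.map Polynomial.C
      constructor
      · exact fun h => Ideal.mem_map_of_mem _ h
      · intro h
        have := (Ideal.mem_map_C_iff.1 h) 0
        simpa using this⟩
    have hheq : p.height ≤ (p.map Polynomial.C).height := by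
      rw [Ideal.height_eq_height_add_of_liesOver_of_hasGoingDown p (p.map Polynomial.C)]
      exact le_self_add
    have hle : p.map Polynomial.C ≤ P' := Ideal.map_comap_le
    by_cases heq : p.map Polynomial.C = P'
    · refine ⟨Finset.cons 0 (I.map (Fin.succEmb n)) (by simp [Fin.succ_ne_zero]), ?_, ?_⟩
      · intro f hf hs
        apply (finSuccEquiv F n).injective
        rw [map_zero]
        ext1 j
        rw [Polynomial.coeff_zero]
        have hf' := (hmem f).1 hf
        rw [← heq, Ideal.mem_map_C_iff] at hf'
        refine hI _ (hf' j) ?_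
        intro m hm i hi
        have := hs _ (mem_support_coeff_finSuccEquiv.1 hm) i.succ (by simp [hi, Fin.succ_ne_zero])
        simpa using this
      · rw [Finset.card_cons, Finset.card_map, ← hht]
        push_cast
        have h2 : p.height ≤ P'.height := hheq.trans (Ideal.height_mono hle)
        calc (n:ℕ∞) + 1 ≤ I.card + p.height + 1 := by gcongr
          _ ≤ I.card + P'.height + 1 := by gcongr
          _ = _ := by ring
    · have hlt : p.map Polynomial.C < P' := lt_of_le_of_ne hle heq
      refine ⟨I.map (Fin.succEmb n), ?_, ?_⟩
      · intro f hf hs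
        have hf' := (hmem f).1 hf
        have h3 : ∀ m ∈ f.support, m 0 = 0 := fun m hm => hs m hm 0 (by simp [Fin.succ_ne_zero])
        have h4 : finSuccEquiv F n f = Polynomial.C ((finSuccEquiv F n f).coeff 0) := by
          ext1 j
          rw [Polynomial.coeff_C]
          split_ifs with hj
          · rw [hj]
          · ext m
            rw [finSuccEquiv_coeff_coeff, coeff_zero]
            by_contra h
            have := h3 _ (mem_support_iff.2 h)
            simp at this; exact hj this
        apply (finSuccEquiv F n).injective
        rw [map_zero, h4]
        have h5 : (finSuccEquiv F n f).coeff 0 ∈ p := by rw [hp, Ideal.mem_comap, ← h4]; exact hf'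
        rw [hI _ h5, map_zero]
        intro m hm i hi
        have := hs _ (mem_support_coeff_finSuccEquiv.1 hm) i.succ (by simp [hi])
        simpa using this
      · rw [Finset.card_map, ← hht]
        have h2 := Ideal.height_add_one_le_of_lt_of_isPrime hlt
        push_cast
        calc (n:ℕ∞) + 1 ≤ I.card + p.height + 1 := by gcongr
          _ ≤ I.card + ((p.map Polynomial.C).height + 1) := by rw [add_assoc]; gcongr
          _ ≤ _ := by gcongr
end hts
end S9

set_option linter.unusedSimpArgs false
set_option linter.unusedSectionVars false
set_option linter.unusedVariables false
set_option linter.style.haveILetI false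
namespace S9
section hil
open MvPolynomial

variable {k : ℕ} {F : Type} [Field F]

def BB (e u : ℕ) : ℕ := Nat.multichoose (e + 1) u

lemma BB_succ (e v : ℕ) : BB (e + 1) (v + 1) = BB e (v + 1) + BB (e + 1) v := by
  rw [BB, BB, BB, Nat.multichoose_succ_succ]

lemma BB_mono_right (e : ℕ) : Monotone (BB e) := by
  refine monotone_nat_of_le_succ fun u => ?_
  rw [BB, BB, Nat.multichoose_succ_succ]; omega

lemma BB_mono_left (u : ℕ) : Monotone (fun e => BB e u) := by
  refine monotone_nat_of_le_succ fun e => ?_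
  cases u with
  | zero => simp [BB]
  | succ v => rw [BB_succ]; omega

lemma BB_step (e v d : ℕ) (hd : 0 < d) : BB (e + 1) v ≤ (if d ≤ v then BB (e + 1) (v - d) else 0) + d * BB e v := by
  induction v generalizing d with
  | zero =>
    rw [if_neg (by omega)]
    have : BB (e+1) 0 = 1 := by simp [BB]
    have h2 : BB e 0 = 1 := by simp [BB]
    rw [this, h2]; omega
  | succ v ih =>
    rw [BB_succ]
    obtain ⟨d', rfl⟩ : ∃ d', d = d' + 1 := ⟨d - 1, by omega⟩
    rcases Nat.eq_zero_or_pos d' with h | h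
    · subst h
      simp; omega
    · have h1 := ih d' h
      have h2 : BB e v ≤ BB e (v + 1) := BB_mono_right e (Nat.le_succ v)
      have h3 : d' * BB e v ≤ d' * BB e (v + 1) := Nat.mul_le_mul_left _ h2
      have h4 : v + 1 - (d' + 1) = v - d' := by omega
      rw [h4]
      by_cases h5 : d' ≤ v
      · rw [if_pos (by omega)]; rw [if_pos h5] at h1; rw [add_mul, one_mul]; omega
      · rw [if_neg (by omega)]; rw [if_neg h5] at h1; rw [add_mul, one_mul]; omega

lemma BB_le (e u : ℕ) : BB e u ≤ (u + e) ^ e := by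
  rw [BB, Nat.multichoose_eq]
  have : e + 1 + u - 1 = u + e := by omega
  rw [this]
  have h : (u + e).choose u = (u + e).choose e := by
    rw [Nat.choose_symm_of_eq_add rfl]
  rw [h]
  exact Nat.choose_le_pow _ _

lemma BB_final (e s P c : ℕ) (h : ∀ u, s * BB e u ≤ P * BB e (u + c)) : s ≤ P := by
  by_contra hlt
  push Not at hlt
  have h0 : ∀ n : ℕ, (P + 1) ^ n ≤ P ^ n * BB e (n * c) := by
    intro n
    induction n with
    | zero => simp [BB]
    | succ n ih =>
      calc (P + 1) ^ (n + 1) = (P + 1) * (P + 1) ^ n := by ring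
        _ ≤ (P + 1) * (P ^ n * BB e (n * c)) := Nat.mul_le_mul_left _ ih
        _ = P ^ n * ((P + 1) * BB e (n * c)) := by ring
        _ ≤ P ^ n * (s * BB e (n * c)) := by gcongr; omega
        _ ≤ P ^ n * (P * BB e (n * c + c)) := Nat.mul_le_mul_left _ (h _)
        _ = P ^ (n + 1) * BB e ((n + 1) * c) := by rw [add_mul, one_mul]; ring
  have hP : 0 < P := by
    rcases Nat.eq_zero_or_pos P with h | h
    · subst h; have := h0 1; simp at this
    · exact h
  set r : ℝ := P / (P + 1) with hr
  have hr0 : 0 ≤ r := by positivity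
  have hr1 : r < 1 := by rw [hr, div_lt_one (by positivity)]; linarith
  have ht := tendsto_pow_const_mul_const_pow_of_abs_lt_one e (r := r) (by rw [abs_of_nonneg hr0]; exact hr1)
  have h1 : ∀ n : ℕ, 1 ≤ n → (1 : ℝ) ≤ ((c + e : ℕ) : ℝ) ^ e * ((n : ℝ) ^ e * r ^ n) := by
    intro n hn
    have h2 : (P + 1) ^ n ≤ P ^ n * (n * (c + e)) ^ e := by
      refine (h0 n).trans (Nat.mul_le_mul_left _ ((BB_le _ _).trans ?_))
      refine Nat.pow_le_pow_left ?_ _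
      rw [mul_add]; nlinarith
    have h3 : ((P : ℝ) + 1) ^ n ≤ P ^ n * (n * ((c + e : ℕ) : ℝ)) ^ e := by exact_mod_cast h2
    rw [hr, div_pow]
    have h4 : ((c + e : ℕ) : ℝ) ^ e * ((n : ℝ) ^ e * (P ^ n / ((P:ℝ) + 1) ^ n)) = P ^ n * (n * ((c + e : ℕ) : ℝ)) ^ e / ((P:ℝ) + 1) ^ n := by
      rw [mul_pow]; ring
    rw [h4, le_div_iff₀ (by positivity), one_mul]
    exact h3
  have h5 := ht.const_mul (((c + e : ℕ) : ℝ) ^ e)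
  rw [mul_zero] at h5
  have h6 := ge_of_tendsto h5 (Filter.eventually_atTop.2 ⟨1, h1⟩)
  linarith

def mons (I : Finset (Fin k)) (u : ℕ) : Finset (Fin k →₀ ℕ) := (Finset.range (u + 1)).biUnion (fun n => Finset.finsuppAntidiag I n)

lemma card_mons (I : Finset (Fin k)) (u : ℕ) : (mons I u).card = BB I.card u := by
  rw [mons, Finset.card_biUnion]
  · simp only [Finset.card_finsuppAntidiag_nat_eq_multichoose]
    rw [BB, Nat.sum_range_multichoose, Nat.multichoose_eq]
    have : I.card + 1 + u - 1 = u + I.card := by omega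
    rw [this, Nat.choose_symm_of_eq_add rfl]
  · intro a _ b _ hab
    rw [Function.onFun, Finset.disjoint_left]
    intro x hx hx'
    rw [Finset.mem_finsuppAntidiag] at hx hx'
    exact hab (hx.1.symm.trans hx'.1)

lemma mem_mons (I : Finset (Fin k)) (u : ℕ) (m : Fin k →₀ ℕ) : m ∈ mons I u ↔ m.degree ≤ u ∧ ∀ i ∉ I, m i = 0 := by
  have h0 : m.support ⊆ I ↔ ∀ i ∉ I, m i = 0 := by
    constructor
    · intro h i hi; by_contra hm; exact hi (h (Finsupp.mem_support_iff.2 hm))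
    · intro h i hi; by_contra hm; exact Finsupp.mem_support_iff.1 hi (h i hm)
  simp only [mons, Finset.mem_biUnion, Finset.mem_range, Finset.mem_finsuppAntidiag, ← h0]
  constructor
  · rintro ⟨n, hn, h1, h2⟩
    refine ⟨?_, h2⟩
    rw [Finsupp.degree_apply, Finset.sum_subset h2 (fun i _ hi => Finsupp.notMem_support_iff.1 hi), h1]; omega
  · rintro ⟨h1, h2⟩
    refine ⟨m.degree, by omega, ?_, h2⟩
    rw [Finsupp.degree_apply, Finset.sum_subset h2 (fun i _ hi => Finsupp.notMem_support_iff.1 hi)]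

noncomputable abbrev LL (F : Type) [Field F] (k u : ℕ) : Submodule F (MvPolynomial (Fin k) F) := restrictTotalDegree (Fin k) F u

lemma LL_eq (u : ℕ) : LL F k u = restrictSupport F (mons (Finset.univ : Finset (Fin k)) u : Set (Fin k →₀ ℕ)) := by
  unfold LL restrictTotalDegree
  congr 1
  ext m
  simp [mem_mons, Finsupp.degree_apply, Finsupp.sum]

instance finPS (s : Finset (Fin k →₀ ℕ)) : Module.Finite F (restrictSupport F (s : Set (Fin k →₀ ℕ))) :=
  Module.Finite.of_basis (basisRestrictSupport F _)

lemma finrank_PS (s : Finset (Fin k →₀ ℕ)) : Module.finrank F (restrictSupport F (s : Set (Fin k →₀ ℕ))) = s.card := by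
  rw [Module.finrank_eq_card_basis (basisRestrictSupport F _)]
  simp

instance finLL (u : ℕ) : Module.Finite F (LL F k u) := by
  rw [LL_eq]; infer_instance

lemma finrank_LL (u : ℕ) : Module.finrank F (LL F k u) = BB k u := by
  rw [LL_eq, finrank_PS, card_mons]; simp

noncomputable def Hs (J : Ideal (MvPolynomial (Fin k) F)) (u : ℕ) : Submodule F (MvPolynomial (Fin k) F ⧸ J) :=
  (LL F k u).map (Ideal.Quotient.mkₐ F J).toLinearMap

instance finHs (J : Ideal (MvPolynomial (Fin k) F)) (u : ℕ) : Module.Finite F (Hs J u) := by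
  unfold Hs; infer_instance

noncomputable def HH (J : Ideal (MvPolynomial (Fin k) F)) (u : ℕ) : ℕ := Module.finrank F (Hs J u)

lemma HH_le (J : Ideal (MvPolynomial (Fin k) F)) (u : ℕ) : HH J u ≤ BB k u := by
  rw [← finrank_LL (F := F)]
  exact Submodule.finrank_map_le _ _

lemma HH_step {J J' : Ideal (MvPolynomial (Fin k) F)} (hJ : J ≤ J') {w : MvPolynomial (Fin k) F} (hw : w ∈ J')
    (hnz : ∀ p, w * p ∈ J → p ∈ J) {d : ℕ} (hd : w.totalDegree ≤ d) (u : ℕ) :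
    HH J' (u + d) + HH J u ≤ HH J (u + d) := by
  let π : (MvPolynomial (Fin k) F ⧸ J) →ₗ[F] (MvPolynomial (Fin k) F ⧸ J') := (Ideal.Quotient.factorₐ F hJ).toLinearMap
  let φ : Hs J (u + d) →ₗ[F] (MvPolynomial (Fin k) F ⧸ J') := π.domRestrict (Hs J (u + d))
  have hrange : LinearMap.range φ = Hs J' (u + d) := by
    rw [LinearMap.range_domRestrict, Hs, Hs, ← Submodule.map_comp]
    rfl
  have hker : HH J u ≤ Module.finrank F (LinearMap.ker φ) := by
    let ψ : Hs J u →ₗ[F] (MvPolynomial (Fin k) F ⧸ J) := (LinearMap.mulLeft F (Ideal.Quotient.mk J w)).domRestrict (Hs J u)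
    have hmem : ∀ x, ψ x ∈ Hs J (u + d) := by
      rintro ⟨_, ⟨p, hp, rfl⟩⟩
      refine ⟨w * p, ?_, ?_⟩
      · rw [SetLike.mem_coe, mem_restrictTotalDegree] at hp ⊢
        exact (totalDegree_mul _ _).trans (by omega)
      · change Ideal.Quotient.mk J (w * p) = Ideal.Quotient.mk J w * Ideal.Quotient.mk J p
        rw [map_mul]
    let ψ' : Hs J u →ₗ[F] LinearMap.ker φ := LinearMap.codRestrict _ (ψ.codRestrict _ hmem) (by
      rintro ⟨_, ⟨p, hp, rfl⟩⟩
      rw [LinearMap.mem_ker]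
      change π (Ideal.Quotient.mk J w * Ideal.Quotient.mk J p) = 0
      rw [← map_mul]
      change Ideal.Quotient.mk J' (w * p) = 0
      rw [Ideal.Quotient.eq_zero_iff_mem]
      exact J'.mul_mem_right _ hw)
    refine LinearMap.finrank_le_finrank_of_injective (f := ψ') ?_
    refine (injective_iff_map_eq_zero ψ').2 ?_
    rintro ⟨_, ⟨p, hp, rfl⟩⟩ h
    have h1 : Ideal.Quotient.mk J (w * p) = 0 := by
      rw [map_mul]
      exact congrArg (fun z => ((z : LinearMap.ker φ).1 : Hs J (u + d)).1) h
    rw [Ideal.Quotient.eq_zero_iff_mem] at h1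
    apply Subtype.ext
    exact Ideal.Quotient.eq_zero_iff_mem.2 (hnz p h1)
  have := LinearMap.finrank_range_add_finrank_ker φ
  rw [hrange] at this
  change _ = HH J (u + d) at this
  rw [← this]
  exact add_le_add_right hker _

lemma HH_mono {J J' : Ideal (MvPolynomial (Fin k) F)} (hJ : J ≤ J') (u : ℕ) : HH J' u ≤ HH J u := by
  let π : (MvPolynomial (Fin k) F ⧸ J) →ₗ[F] (MvPolynomial (Fin k) F ⧸ J') := (Ideal.Quotient.factorₐ F hJ).toLinearMap
  have : Hs J' u = (Hs J u).map π := by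
    rw [Hs, Hs, ← Submodule.map_comp]
    rfl
  rw [HH, this]
  exact Submodule.finrank_map_le _ _

/-- growth -/
def Gr (J : Ideal (MvPolynomial (Fin k) F)) (e s P : ℕ) : Prop := ∃ c, ∀ u, s * BB e u ≤ P * HH J (u + c)

lemma Gr_step {J J' : Ideal (MvPolynomial (Fin k) F)} (hJ : J ≤ J') {w : MvPolynomial (Fin k) F} (hw : w ∈ J')
    (hnz : ∀ p, w * p ∈ J → p ∈ J) {d : ℕ} (hd0 : 0 < d) (hd : w.totalDegree ≤ d) {e s P : ℕ} (h : Gr J' e s P) :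
    Gr J (e + 1) s (P * d) := by
  obtain ⟨c, hc⟩ := h
  refine ⟨c, fun v => ?_⟩
  induction v using Nat.strong_induction_on with
  | _ v ih =>
  have h1 := BB_step e v d hd0
  by_cases hv : d ≤ v
  · rw [if_pos hv] at h1
    have h2 := ih (v - d) (by omega)
    have h3 := HH_step hJ hw hnz hd (v - d + c)
    have h4 : v - d + c + d = v + c := by omega
    rw [h4] at h3
    calc s * BB (e + 1) v ≤ s * (BB (e + 1) (v - d) + d * BB e v) := Nat.mul_le_mul_left _ h1
      _ = s * BB (e + 1) (v - d) + d * (s * BB e v) := by ring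
      _ ≤ P * d * HH J (v - d + c) + d * (P * HH J' (v + c)) := add_le_add h2 (Nat.mul_le_mul_left _ (hc v))
      _ = P * d * (HH J' (v + c) + HH J (v - d + c)) := by ring
      _ ≤ _ := by gcongr
  · rw [if_neg hv, zero_add] at h1
    calc s * BB (e + 1) v ≤ s * (d * BB e v) := Nat.mul_le_mul_left _ h1
      _ = d * (s * BB e v) := by ring
      _ ≤ d * (P * HH J' (v + c)) := Nat.mul_le_mul_left _ (hc v)
      _ = P * d * HH J' (v + c) := by ring
      _ ≤ _ := by gcongr; exact HH_mono hJ _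

lemma Gr_final {J : Ideal (MvPolynomial (Fin k) F)} {s P : ℕ} (h : Gr J k s P) : s ≤ P := by
  obtain ⟨c, hc⟩ := h
  exact BB_final k s P c fun u => (hc u).trans (Nat.mul_le_mul_left _ (HH_le _ _))

end hil
end S9

set_option linter.unusedSimpArgs false
set_option linter.unusedSectionVars false
set_option linter.unusedVariables false
set_option linter.style.haveILetI false
namespace S9
section bez
open MvPolynomial

variable {k : ℕ} {F : Type} [Field F]

lemma Gr_primes (J : Ideal (MvPolynomial (Fin k) F)) (s : Finset (Ideal (MvPolynomial (Fin k) F)))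
    (hpr : ∀ p ∈ s, p.IsPrime) (hJ : ∀ p ∈ s, J ≤ p) (hinc : ∀ p ∈ s, ∀ q ∈ s, p ≠ q → ¬ q ≤ p) (e : ℕ)
    (hI : ∀ p ∈ s, ∃ I : Finset (Fin k), Indep p I ∧ e ≤ I.card) : Gr J e s.card 1 := by
  classical
  have hh : ∀ p ∈ s, ∃ h, h ∉ p ∧ ∀ q ∈ s, q ≠ p → h ∈ q := by
    intro p hp
    have : ∀ q ∈ s.erase p, ∃ a, a ∈ q ∧ a ∉ p := by
      intro q hq
      rw [Finset.mem_erase] at hq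
      exact Set.not_subset.1 (hinc p hp q hq.2 hq.1.symm)
    choose! a ha1 ha2 using this
    haveI := hpr p hp
    refine ⟨∏ q ∈ s.erase p, a q, ?_, ?_⟩
    · intro h
      obtain ⟨q, hq, hq'⟩ := (Ideal.IsPrime.prod_mem_iff).1 h
      exact ha2 q hq hq'
    · intro q hq hqp
      have hq' : q ∈ s.erase p := Finset.mem_erase.2 ⟨hqp, hq⟩
      exact Ideal.mem_of_dvd _ (Finset.dvd_prod_of_mem a hq') (ha1 q hq')
  choose! h hh1 hh2 using hh
  choose! I hI1 hI2 using hI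
  refine ⟨s.sup (fun p => (h p).totalDegree), fun u => ?_⟩
  set c := s.sup (fun p => (h p).totalDegree) with hc
  rw [one_mul]
  let PS : s → Submodule F (MvPolynomial (Fin k) F) := fun p => restrictSupport F (mons (I p.1) u : Set (Fin k →₀ ℕ))
  let Φ0 : ((p : s) → PS p) →ₗ[F] MvPolynomial (Fin k) F :=
    ∑ p : s, (LinearMap.mulLeft F (h p.1)).comp ((PS p).subtype.comp (LinearMap.proj p))
  have hΦ0 : ∀ f, Φ0 f = ∑ p : s, h p.1 * (f p).1 := by
    intro f; simp [Φ0]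
  have hmem : ∀ f, ((Ideal.Quotient.mkₐ F J).toLinearMap.comp Φ0) f ∈ Hs J (u + c) := by
    intro f
    refine ⟨Φ0 f, ?_, rfl⟩
    rw [hΦ0]
    refine Submodule.sum_mem _ fun p _ => ?_
    rw [mem_restrictTotalDegree]
    refine (totalDegree_mul _ _).trans ?_
    have h1 : (h p.1).totalDegree ≤ c := Finset.le_sup (f := fun p => (h p).totalDegree) p.2
    have h2 : (f p).1.totalDegree ≤ u := by
      refine Finset.sup_le fun m hm => ?_
      have := ((mem_restrictSupport_iff F).1 (f p).2) hm
      rw [Finset.mem_coe, mem_mons] at this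
      exact this.1
    omega
  let Φ : ((p : s) → PS p) →ₗ[F] Hs J (u + c) := LinearMap.codRestrict _ _ hmem
  have hinj : Function.Injective Φ := by
    refine (injective_iff_map_eq_zero Φ).2 ?_
    intro f hf
    have h1 : Ideal.Quotient.mk J (Φ0 f) = 0 := congrArg Subtype.val hf
    rw [Ideal.Quotient.eq_zero_iff_mem, hΦ0] at h1
    funext p
    apply Subtype.ext
    have h2 := hJ p.1 p.2 h1
    rw [← Finset.add_sum_erase _ _ (Finset.mem_univ p)] at h2
    have h3 : ∑ q ∈ Finset.univ.erase p, h q.1 * (f q).1 ∈ p.1 := by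
      refine Ideal.sum_mem _ fun q hq => Ideal.mul_mem_right _ _ (hh2 q.1 q.2 p.1 p.2 ?_)
      intro hpq
      exact (Finset.mem_erase.1 hq).1 (Subtype.ext hpq.symm)
    have h4 := (Ideal.add_mem_iff_left _ h3).1 h2
    have h5 := ((hpr p.1 p.2).mem_or_mem h4).resolve_left (hh1 p.1 p.2)
    refine hI1 p.1 p.2 _ h5 ?_
    intro m hm
    have := ((mem_restrictSupport_iff F).1 (f p).2) hm
    rw [Finset.mem_coe, mem_mons] at this
    exact this.2
  have h6 := LinearMap.finrank_le_finrank_of_injective hinj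
  refine le_trans ?_ h6
  rw [Module.finrank_pi_fintype]
  have h7 : s.card = (Finset.univ : Finset s).card := by simp
  rw [h7, ← smul_eq_mul]
  refine Finset.card_nsmul_le_sum _ _ _ fun p _ => ?_
  rw [finrank_PS, card_mons]
  exact BB_mono_left u (hI2 p.1 p.2)

noncomputable def II (w : ℕ → MvPolynomial (Fin k) F) (r : ℕ) : Ideal (MvPolynomial (Fin k) F) := Ideal.span (w '' (Finset.range r : Set ℕ))

lemma II_mono (w : ℕ → MvPolynomial (Fin k) F) : Monotone (II w) := by
  intro a b hab
  apply Ideal.span_mono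
  apply Set.image_mono
  exact_mod_cast Finset.range_mono hab

/-- good -/
def Good (w : ℕ → MvPolynomial (Fin k) F) (i : ℕ) : Prop := ∀ p ∈ (II w i).minimalPrimes, w i ∉ p

lemma good_nz {w : ℕ → MvPolynomial (Fin k) F} {i : ℕ} (h : Good w i) (p) (hp : w i * p ∈ (II w i).radical) : p ∈ (II w i).radical := by
  rw [← Ideal.sInf_minimalPrimes, Submodule.mem_sInf] at hp ⊢
  intro P hP
  have : Ideal.IsPrime P := hP.1.1
  exact (this.mem_or_mem (hp P hP)).resolve_left (h P hP)

lemma Gr_chain {w : ℕ → MvPolynomial (Fin k) F} {d : ℕ → ℕ} (hd0 : ∀ i, 0 < d i) (hd : ∀ i, (w i).totalDegree ≤ d i) :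
    ∀ (r : ℕ), (∀ i < r, Good w i) → ∀ {e s P : ℕ}, Gr (II w r).radical e s P →
      Gr (II w 0).radical (e + r) s (P * ∏ i ∈ Finset.range r, d i) := by
  intro r
  induction r with
  | zero => intro _ e s P h; simpa using h
  | succ r ih =>
    intro hg e s P h
    have h1 := Gr_step (J := (II w r).radical) (Ideal.radical_mono (II_mono w (Nat.le_succ r))) (w := w r)
      (Ideal.le_radical (Ideal.subset_span ⟨r, by simp, rfl⟩)) (good_nz (hg r (by omega))) (hd0 r) (hd r) h
    have h2 := ih (fun i hi => hg i (by omega)) h1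
    rw [Finset.prod_range_succ, mul_comm _ (d r), ← mul_assoc]
    have : e + 1 + r = e + (r + 1) := by omega
    rwa [this] at h2

lemma exists_min {w : ℕ → MvPolynomial (Fin k) F} (r : ℕ) {p} (hp : p ∈ (II w r).minimalPrimes) :
    ∃ I : Finset (Fin k), Indep p I ∧ k - r ≤ I.card := by
  obtain ⟨I, hI1, hI2⟩ := exists_indep k p hp.1.1
  refine ⟨I, hI1, ?_⟩
  have h1 := Ideal.height_le_card_of_mem_minimalPrimes_span ((Finset.range r).finite_toSet.image w) hp
  have h2 : (w '' (Finset.range r : Set ℕ)).ncard ≤ r := by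
    refine (Set.ncard_image_le (Finset.range r).finite_toSet).trans ?_
    rw [Set.ncard_coe_finset]; simp
  have h3 : (k : ℕ∞) ≤ ((I.card + r : ℕ) : ℕ∞) := by
    push_cast
    refine hI2.trans ?_
    gcongr
    exact h1.trans (by exact_mod_cast h2)
  have h4 : k ≤ I.card + r := by exact_mod_cast h3
  omega

lemma zeros_card {w : ℕ → MvPolynomial (Fin k) F} {d : ℕ → ℕ} (hd0 : ∀ i, 0 < d i) (hd : ∀ i, (w i).totalDegree ≤ d i)
    (hg : ∀ i < k, Good w i) (Z : Finset (Fin k → F)) (hZ : ∀ x ∈ Z, ∀ i < k, eval x (w i) = 0) :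
    Z.card ≤ ∏ i ∈ Finset.range k, d i := by
  classical
  let K : (Fin k → F) → Ideal (MvPolynomial (Fin k) F) := fun x => RingHom.ker (eval x)
  have hK : ∀ x y, K x ≤ K y → x = y := by
    intro x y h
    funext i
    have h1 : (X i - C (x i) : MvPolynomial (Fin k) F) ∈ K x := by simp [K, RingHom.mem_ker]
    have h2 := h h1
    have h3 : y i - x i = 0 := by simpa [K, RingHom.mem_ker] using h2
    exact (sub_eq_zero.1 h3).symm
  have hcard : (Z.image K).card = Z.card := Finset.card_image_of_injective _ (fun x y h => hK x y h.le)
  have h1 : Gr (II w k).radical 0 (Z.image K).card 1 := by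
    refine Gr_primes _ _ ?_ ?_ ?_ _ ?_
    · intro p hp
      obtain ⟨x, hx, rfl⟩ := Finset.mem_image.1 hp
      exact RingHom.ker_isPrime _
    · intro p hp
      obtain ⟨x, hx, rfl⟩ := Finset.mem_image.1 hp
      have hprime : (K x).IsPrime := RingHom.ker_isPrime _
      rw [hprime.radical_le_iff, II, Ideal.span_le]
      rintro _ ⟨i, hi, rfl⟩
      exact hZ x hx i (by simpa using hi)
    · intro p hp q hq hne hle
      obtain ⟨x, hx, rfl⟩ := Finset.mem_image.1 hp
      obtain ⟨y, hy, rfl⟩ := Finset.mem_image.1 hq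
      exact hne (by rw [hK _ _ hle])
    · intro p hp
      obtain ⟨x, hx, rfl⟩ := Finset.mem_image.1 hp
      refine ⟨∅, ?_, Nat.zero_le _⟩
      intro f hf hs
      have h2 : f = C (coeff 0 f) := by
        ext m
        rw [coeff_C]
        split_ifs with hm
        · rw [← hm]
        · by_contra h
          apply hm
          ext i
          exact (hs m (mem_support_iff.2 h) i (by simp)).symm
      rw [h2] at hf ⊢
      have h3 : coeff 0 f = 0 := by simpa [K, RingHom.mem_ker] using hf
      rw [h3, C_0]
  have h2 := Gr_chain hd0 hd k hg h1
  rw [one_mul, zero_add] at h2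
  rw [← hcard]
  exact Gr_final h2

lemma minPrimes_card {w : ℕ → MvPolynomial (Fin k) F} {d : ℕ → ℕ} (hd0 : ∀ i, 0 < d i) (hd : ∀ i, (w i).totalDegree ≤ d i)
    {r : ℕ} (hr : r ≤ k) (hg : ∀ i < r, Good w i) (s : Finset (Ideal (MvPolynomial (Fin k) F)))
    (hs : ∀ p ∈ s, p ∈ (II w r).minimalPrimes) : s.card ≤ ∏ i ∈ Finset.range r, d i := by
  have h1 : Gr (II w r).radical (k - r) s.card 1 := by
    refine Gr_primes _ s (fun p hp => (hs p hp).1.1) (fun p hp => ?_) (fun p hp q hq hne hle => ?_) _ (fun p hp => ?_)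
    · exact (Ideal.IsPrime.radical_le_iff (hs p hp).1.1).2 (hs p hp).1.2
    · exact hne (le_antisymm ((hs p hp).2 (hs q hq).1 hle) hle)
    · have hh := exists_min r (hs p hp)
      exact hh
  have h2 := Gr_chain hd0 hd r hg h1
  rw [one_mul, Nat.sub_add_cancel hr] at h2
  exact Gr_final h2
end bez
end S9

set_option linter.unusedSimpArgs false
set_option linter.unusedSectionVars false
set_option linter.unusedVariables false
set_option linter.style.haveILetI false
namespace S9
section prob
open MvPolynomial

lemma prob_prime {k t : ℕ} {F : Type} [Field F] [Fintype F] (P : Ideal (MvPolynomial (Fin k) F)) (I : Finset (Fin k))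
    (hI : Indep P I) (j : Fin k) (hj : j ∈ I) (h : MvPolynomial (Fin k) F) :
    Fintype.card F ^ (t + 1) * Nat.card {g : VV k F t // h + g.1 ∈ P} ≤ Nat.card (VV k F t) := by
  classical
  let U : (Fin (t+1) → F) → MvPolynomial (Fin k) F := fun c => ∑ l : Fin (t+1), monomial (Finsupp.single j (l : ℕ)) (c l)
  have hU : ∀ c, U c ∈ restrictTotalDegree (Fin k) F t := by
    intro c
    refine Submodule.sum_mem _ fun l _ => ?_
    rw [mem_restrictTotalDegree]
    refine (totalDegree_monomial_le _ _).trans ?_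
    rw [Finsupp.sum_single_index rfl]
    have := l.2
    simp only [id]
    omega
  have hcoef : ∀ c (l : Fin (t+1)), coeff (Finsupp.single j (l:ℕ)) (U c) = c l := by
    intro c l
    simp only [U, coeff_sum, coeff_monomial]
    rw [Finset.sum_eq_single l]
    · simp
    · intro b _ hb
      rw [if_neg]
      intro hh
      exact hb (Fin.ext (Finsupp.single_injective j hh))
    · simp
  have hUsupp : ∀ c, ∀ m ∈ (U c).support, ∀ i, i ∉ I → m i = 0 := by
    intro c m hm i hi
    have := support_sum hm
    rw [Finset.mem_biUnion] at this
    obtain ⟨l, _, hl⟩ := this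
    have := support_monomial_subset hl
    rw [Finset.mem_singleton] at this
    rw [this, Finsupp.single_apply, if_neg]
    rintro rfl; exact hi hj
  have hsub : ∀ c c', U c - U c' = U (c - c') := by
    intro c c'
    simp only [U, ← Finset.sum_sub_distrib, Pi.sub_apply, map_sub]
  have key : Function.Injective (fun z : (Fin (t+1) → F) × {g : VV k F t // h + g.1 ∈ P} =>
      (⟨z.2.1.1 + U z.1, Submodule.add_mem _ z.2.1.2 (hU z.1)⟩ : VV k F t)) := by
    rintro ⟨c, g⟩ ⟨c', g'⟩ heq
    have h1 : g.1.1 + U c = g'.1.1 + U c' := congrArg Subtype.val heq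
    have h2 : U (c' - c) = (h + g.1.1) - (h + g'.1.1) := by
      rw [← hsub]; linear_combination -h1
    have h3 : U (c' - c) ∈ P := by rw [h2]; exact Ideal.sub_mem _ g.2 g'.2
    have h4 := hI _ h3 (hUsupp _)
    have h5 : c = c' := by
      funext l
      have := hcoef (c' - c) l
      rw [h4, coeff_zero, Pi.sub_apply] at this
      exact (sub_eq_zero.1 this.symm).symm
    subst h5
    have h6 : g.1.1 = g'.1.1 := add_right_cancel h1
    rw [Subtype.ext (Subtype.ext h6)]
  have h7 := Nat.card_le_card_of_injective _ key
  rw [Nat.card_prod] at h7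
  simpa using h7

lemma Good_congr {k : ℕ} {F : Type} [Field F] {w w' : ℕ → MvPolynomial (Fin k) F} {r : ℕ} (h : ∀ i ≤ r, w i = w' i) :
    Good w r ↔ Good w' r := by
  have : II w r = II w' r := by
    unfold II
    congr 1
    apply Set.image_congr
    intro i hi
    exact h i (by simp at hi; omega)
  unfold Good
  rw [this, h r le_rfl]

lemma count_update {T V : Type} [Finite T] [Finite V] [DecidableEq T] (S : Set (T → V)) (v : T) (c κ : ℕ)
    (h : ∀ G, c * Nat.card {g // Function.update G v g ∈ S} ≤ κ) :
    c * Nat.card S * Nat.card V ≤ κ * Nat.card (T → V) := by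
  classical
  haveI := Fintype.ofFinite T
  haveI := Fintype.ofFinite V
  have e : (Σ G : T → V, {g // Function.update G v g ∈ S}) ≃ S × V :=
    { toFun := fun z => (⟨Function.update z.1 v z.2.1, z.2.2⟩, z.1 v)
      invFun := fun z => ⟨Function.update z.1.1 v z.2, ⟨z.1.1 v, by simp⟩⟩
      left_inv := by
        rintro ⟨G, g, hg⟩
        have h1 : Function.update (Function.update G v g) v (G v) = G := by simp
        refine Sigma.ext h1 ?_
        simp only [Function.update_self]
        congr 1
        · simp
        · simp
      right_inv := by
        rintro ⟨⟨G, hG⟩, g⟩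
        simp }
  have h1 := Nat.card_congr e
  rw [Nat.card_sigma, Nat.card_prod] at h1
  rw [mul_assoc, ← h1, Finset.mul_sum]
  refine (Finset.sum_le_sum fun G _ => h G).trans ?_
  simp [mul_comm, Nat.card_eq_fintype_card]

lemma bad_step {k t : ℕ} {F T : Type} [Field F] [Fintype F] [Finite T] [DecidableEq T]
    (v : ℕ → T) (h : (T → VV k F t) → ℕ → MvPolynomial (Fin k) F) (r : ℕ) (hr : r < k)
    (hv : ∀ i < r, v i ≠ v r)
    (hdep : ∀ G g, ∀ i ≤ r, h (Function.update G (v r) g) i = h G i)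
    (d : ℕ → ℕ) (hd0 : ∀ i, 0 < d i) (hd : ∀ G i, (h G i + (G (v i)).1).totalDegree ≤ d i)
    (M : ℕ) (hM : ∏ i ∈ Finset.range r, d i ≤ M) :
    Fintype.card F ^ (t+1) * Nat.card {G : T → VV k F t // (∀ i < r, Good (fun i => h G i + (G (v i)).1) i) ∧
       ¬ Good (fun i => h G i + (G (v i)).1) r} ≤ M * Nat.card (T → VV k F t) := by
  classical
  let S : Set (T → VV k F t) := {G | (∀ i < r, Good (fun i => h G i + (G (v i)).1) i) ∧
       ¬ Good (fun i => h G i + (G (v i)).1) r}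
  have hpos : 0 < Nat.card (VV k F t) := Nat.card_pos
  refine Nat.le_of_mul_le_mul_right ?_ hpos
  have := count_update S (v r) (Fintype.card F ^ (t+1)) (M * Nat.card (VV k F t)) ?_
  · refine le_trans this (le_of_eq (by ring))
  intro G
  set w : ℕ → MvPolynomial (Fin k) F := fun i => h G i + (G (v i)).1 with hw
  have hww : ∀ g, ∀ i < r, (fun i => h (Function.update G (v r) g) i + ((Function.update G (v r) g) (v i)).1) i = w i := by
    intro g i hi
    simp only [hw]
    rw [hdep G g i hi.le, Function.update_of_ne (hv i hi)]
  have hII : ∀ g, II (fun i => h (Function.update G (v r) g) i + ((Function.update G (v r) g) (v i)).1) r = II w r := by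
    intro g
    unfold II
    congr 1
    apply Set.image_congr
    intro i hi
    exact hww g i (by simpa using hi)
  by_cases hgood : ∀ i < r, Good w i
  swap
  · have : IsEmpty {g // Function.update G (v r) g ∈ S} := by
      constructor
      rintro ⟨g, hg⟩
      apply hgood
      intro i hi
      refine (Good_congr ?_).1 (hg.1 i hi)
      intro l hl
      exact hww g l (by omega)
    simp
  have hfin := Ideal.finite_minimalPrimes_of_isNoetherianRing (MvPolynomial (Fin k) F) (II w r)
  have hs : ∀ p ∈ hfin.toFinset, p ∈ (II w r).minimalPrimes := fun p hp => by simpa using hp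
  have hcard := minPrimes_card hd0 (hd G) hr.le hgood hfin.toFinset hs
  haveI : Fintype (VV k F t) := Fintype.ofFinite _
  have hle : Nat.card {g // Function.update G (v r) g ∈ S} ≤ ∑ p ∈ hfin.toFinset, Nat.card {g : VV k F t // h G r + g.1 ∈ p} := by
    have hsub : (Finset.univ.filter fun g => Function.update G (v r) g ∈ S) ⊆
        hfin.toFinset.biUnion fun p => Finset.univ.filter fun g : VV k F t => h G r + g.1 ∈ p := by
      intro g hg
      rw [Finset.mem_filter] at hg
      have h1 := hg.2.2
      unfold Good at h1
      push Not at h1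
      obtain ⟨p, hp, hp'⟩ := h1
      rw [hII g] at hp
      rw [hdep G g r le_rfl, Function.update_self] at hp'
      rw [Finset.mem_biUnion]
      exact ⟨p, by simpa using hp, by simpa using hp'⟩
    have h2 := (Finset.card_le_card hsub).trans Finset.card_biUnion_le
    simpa only [Nat.card_eq_fintype_card, Fintype.card_subtype] using h2
  calc Fintype.card F ^ (t+1) * Nat.card {g // Function.update G (v r) g ∈ S}
      ≤ Fintype.card F ^ (t+1) * ∑ p ∈ hfin.toFinset, Nat.card {g : VV k F t // h G r + g.1 ∈ p} := Nat.mul_le_mul_left _ hle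
    _ = ∑ p ∈ hfin.toFinset, Fintype.card F ^ (t+1) * Nat.card {g : VV k F t // h G r + g.1 ∈ p} := by rw [Finset.mul_sum]
    _ ≤ ∑ p ∈ hfin.toFinset, Nat.card (VV k F t) := by
        refine Finset.sum_le_sum fun p hp => ?_
        obtain ⟨I, hI, hIc⟩ := exists_min r (hs p hp)
        have : 0 < I.card := by omega
        obtain ⟨j, hj⟩ := Finset.card_pos.1 this
        exact prob_prime p I hI j hj _
    _ = hfin.toFinset.card * Nat.card (VV k F t) := by simp
    _ ≤ M * Nat.card (VV k F t) := Nat.mul_le_mul_right _ (hcard.trans hM)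

lemma bad_count {k t : ℕ} {F T : Type} [Field F] [Fintype F] [Finite T] [DecidableEq T]
    (v : ℕ → T) (h : (T → VV k F t) → ℕ → MvPolynomial (Fin k) F)
    (hv : ∀ r < k, ∀ i < r, v i ≠ v r)
    (hdep : ∀ r < k, ∀ G g, ∀ i ≤ r, h (Function.update G (v r) g) i = h G i)
    (d : ℕ → ℕ) (hd0 : ∀ i, 0 < d i) (hd : ∀ G i, (h G i + (G (v i)).1).totalDegree ≤ d i)
    (M : ℕ) (hM : ∀ r < k, ∏ i ∈ Finset.range r, d i ≤ M) :
    Fintype.card F ^ (t+1) * Nat.card {G : T → VV k F t // ¬ ∀ i < k, Good (fun i => h G i + (G (v i)).1) i}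
       ≤ k * M * Nat.card (T → VV k F t) := by
  classical
  haveI : Fintype (T → VV k F t) := Fintype.ofFinite _
  let B : ℕ → (T → VV k F t) → Prop := fun r G => (∀ i < r, Good (fun i => h G i + (G (v i)).1) i) ∧
       ¬ Good (fun i => h G i + (G (v i)).1) r
  have hsub : (Finset.univ.filter fun G : T → VV k F t => ¬ ∀ i < k, Good (fun i => h G i + (G (v i)).1) i) ⊆
     (Finset.range k).biUnion fun r => Finset.univ.filter fun G => B r G := by
    intro G hG
    rw [Finset.mem_filter] at hG
    have h1 := hG.2
    push Not at h1
    rw [Finset.mem_biUnion]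
    refine ⟨Nat.find h1, Finset.mem_range.2 (Nat.find_spec h1).1, ?_⟩
    rw [Finset.mem_filter]
    refine ⟨Finset.mem_univ _, ?_, (Nat.find_spec h1).2⟩
    intro i hi
    have h2 := Nat.find_min h1 hi
    have h3 := (Nat.find_spec h1).1
    by_contra h4
    exact h2 ⟨hi.trans h3, h4⟩
  have h2 := (Finset.card_le_card hsub).trans Finset.card_biUnion_le
  have h3 : Nat.card {G : T → VV k F t // ¬ ∀ i < k, Good (fun i => h G i + (G (v i)).1) i} ≤ ∑ r ∈ Finset.range k, Nat.card {G // B r G} := by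
    simpa only [Nat.card_eq_fintype_card, Fintype.card_subtype] using h2
  refine (Nat.mul_le_mul_left _ h3).trans ?_
  rw [Finset.mul_sum]
  refine (Finset.sum_le_sum fun r hr => bad_step v h r (Finset.mem_range.1 hr) (hv r (Finset.mem_range.1 hr))
    (hdep r (Finset.mem_range.1 hr)) d hd0 hd M (hM r (Finset.mem_range.1 hr))).trans ?_
  simp [mul_assoc]
end prob
end S9

set_option linter.unusedSimpArgs false
set_option linter.unusedSectionVars false
set_option linter.unusedVariables false
set_option linter.style.haveILetI false
namespace S9
section xbad
open MvPolynomial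

lemma X_bad {k t D lam : ℕ} {F N : Type} [Field F] [Fintype F] [Finite N] [DecidableEq N] (hk : 0 < k)
    (ht : 0 < t) (htD : t < D) (hl : D = lam * t) (X : Finset (Fin k × N)) (hX : X.card = k)
    (hmiss : ∃ i : Fin k, ∀ a ∈ X, a.1 ≠ i) :
    Fintype.card F ^ (t+1) * Nat.card {G : Fin k × N → VV k F t //
      ¬ (Nat.card {x : Fin k → F // ∀ a ∈ X, x a.1 ^ D + eval x (G a).1 = 0} * lam ≤ D^k)} ≤
      k * D^k * Nat.card (Fin k × N → VV k F t) := by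
  classical
  have e : Fin k ≃ X := (Finset.equivFinOfCardEq hX).symm
  let v : ℕ → Fin k × N := fun i => if h : i < k then (e ⟨i, h⟩).1 else (e ⟨0, hk⟩).1
  have hvlt : ∀ i (h : i < k), v i = (e ⟨i, h⟩).1 := fun i h => by simp [v, h]
  have hvinj : ∀ i < k, ∀ j < k, v i = v j → i = j := by
    intro i hi j hj h
    rw [hvlt i hi, hvlt j hj] at h
    have := e.injective (Subtype.ext h)
    exact Fin.mk.inj_iff.1 this
  have hvX : ∀ i, v i ∈ X := by
    intro i
    by_cases h : i < k
    · rw [hvlt i h]; exact (e _).2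
    · simp only [v, h, dif_neg, not_false_eq_true]; exact (e _).2
  let Pr : ℕ → Prop := fun r => ∃ r', r' < r ∧ (v r').1 = (v r).1
  let prev : ℕ → ℕ := fun r => if c : Pr r then c.choose else 0
  have hprev : ∀ r, Pr r → prev r < r ∧ (v (prev r)).1 = (v r).1 := by
    intro r c
    simp only [prev, dif_pos c]
    exact c.choose_spec
  let h : (Fin k × N → VV k F t) → ℕ → MvPolynomial (Fin k) F := fun G r =>
    if Pr r then -(G (v (prev r))).1 else MvPolynomial.X (v r).1 ^ D
  let d : ℕ → ℕ := fun r => if Pr r then t else D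
  have hd0 : ∀ i, 0 < d i := by
    intro i; simp only [d]; split_ifs <;> omega
  have hdD : ∀ i, d i ≤ D := by
    intro i; simp only [d]; split_ifs <;> omega
  have hVdeg : ∀ g : VV k F t, g.1.totalDegree ≤ t := fun g => (mem_restrictTotalDegree _ _ _).1 g.2
  have hd : ∀ G i, (h G i + (G (v i)).1).totalDegree ≤ d i := by
    intro G i
    refine (totalDegree_add _ _).trans ?_
    simp only [h, d]
    split_ifs with hc
    · rw [totalDegree_neg]
      exact max_le (hVdeg _) (hVdeg _)
    · refine max_le ?_ ((hVdeg _).trans htD.le)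
      rw [totalDegree_X_pow]
  have hprodle : ∀ r, ∏ i ∈ Finset.range r, d i ≤ D^r := by
    intro r
    refine (Finset.prod_le_prod' fun i _ => hdD i).trans ?_
    simp
  have hpig : ∃ r < k, Pr r := by
    obtain ⟨i0, hi0⟩ := hmiss
    by_contra hcon
    push Not at hcon
    have hinj : Set.InjOn (fun i => (v i).1) (Finset.range k) := by
      intro i hi j hj hij
      simp only [Finset.coe_range, Set.mem_Iio] at hi hj
      rcases lt_trichotomy i j with hlt | heq | hgt
      · exact absurd ⟨i, hlt, hij⟩ (hcon j hj)
      · exact heq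
      · exact absurd ⟨j, hgt, hij.symm⟩ (hcon i hi)
    have h1 := Finset.card_image_of_injOn hinj
    rw [Finset.card_range] at h1
    have h2 : (Finset.range k).image (fun i => (v i).1) = Finset.univ := by
      rw [← Finset.card_eq_iff_eq_univ, h1, Fintype.card_fin]
    have h3 : i0 ∈ (Finset.range k).image (fun i => (v i).1) := by rw [h2]; simp
    obtain ⟨i, hi, hi'⟩ := Finset.mem_image.1 h3
    exact hi0 _ (hvX i) hi'
  have hprod : (∏ i ∈ Finset.range k, d i) * lam ≤ D^k := by
    obtain ⟨r, hr, hPr⟩ := hpig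
    rw [← Finset.mul_prod_erase _ _ (Finset.mem_range.2 hr)]
    have h1 : d r = t := by simp only [d, if_pos hPr]
    have h2 : ∏ i ∈ (Finset.range k).erase r, d i ≤ D^(k-1) := by
      refine (Finset.prod_le_prod' fun i _ => hdD i).trans ?_
      rw [Finset.prod_const, Finset.card_erase_of_mem (Finset.mem_range.2 hr), Finset.card_range]
    calc d r * (∏ i ∈ (Finset.range k).erase r, d i) * lam ≤ t * D^(k-1) * lam := by
          rw [h1]; exact Nat.mul_le_mul_right _ (Nat.mul_le_mul_left _ h2)
      _ = D^(k-1) * (lam * t) := by ring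
      _ = D^(k-1) * D := by rw [← hl]
      _ = D^k := by rw [← pow_succ]; congr 1; omega
  have key := bad_count v h ?_ ?_ d hd0 hd (D^k) ?_
  · refine le_trans (Nat.mul_le_mul_left _ ?_) key
    have himp : ∀ G : Fin k × N → VV k F t, ¬ (Nat.card {x : Fin k → F // ∀ a ∈ X, x a.1 ^ D + eval x (G a).1 = 0} * lam ≤ D^k) →
        ¬ ∀ i < k, Good (fun i => h G i + (G (v i)).1) i := ?_
    · exact Nat.card_le_card_of_injective (Subtype.map id himp) (Subtype.map_injective _ Function.injective_id)
    · intro G hG hgood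
      apply hG
      have hz := zeros_card hd0 (hd G) hgood
        (Finset.univ.filter fun x : Fin k → F => ∀ a ∈ X, x a.1 ^ D + eval x (G a).1 = 0) ?_
      · refine le_trans (Nat.mul_le_mul_right _ ?_) hprod
        rw [Nat.card_eq_fintype_card, Fintype.card_subtype]
        exact hz
      · intro x hx i hi
        have hx' := (Finset.mem_filter.1 hx).2
        simp only [h]
        split_ifs with hc
        · have h1 := hx' _ (hvX i)
          have h2 := hx' _ (hvX (prev i))
          rw [(hprev i hc).2] at h2
          rw [map_add, map_neg]
          linear_combination h1 - h2
        · have h1 := hx' _ (hvX i)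
          simpa using h1
  · intro r hr i hi heq
    have := hvinj i (by omega) r hr heq
    omega
  · intro r hr G g i hi
    simp only [h]
    split_ifs with hc
    · rw [Function.update_of_ne]
      intro heq
      have h1 := (hprev i hc).1
      have := hvinj _ (by omega) r hr heq
      omega
    · rfl
  · intro r hr
    exact (hprodle r).trans (Nat.pow_le_pow_right (by omega) hr.le)

lemma count_extend {T V J : Type} [Finite T] [Finite V] [Finite J] (u : J → T) (hu : Function.Injective u) (S : (J → V) → Prop) :
    Nat.card {G : T → V // S (fun j => G (u j))} * Nat.card (J → V) = Nat.card {g // S g} * Nat.card (T → V) := by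
  classical
  have hx : ∀ (g : J → V) (G : T → V), (fun j => Function.extend u g G (u j)) = g := by
    intro g G; funext j; rw [hu.extend_apply]
  have hx2 : ∀ (g : J → V) (G : T → V), Function.extend u (fun j => G (u j)) (Function.extend u g G) = G := by
    intro g G
    funext a
    by_cases ha : ∃ j, u j = a
    · obtain ⟨j, rfl⟩ := ha
      rw [hu.extend_apply]
    · rw [Function.extend_apply' _ _ _ ha, Function.extend_apply' _ _ _ ha]
  rw [← Nat.card_prod, ← Nat.card_prod]
  refine Nat.card_congr
    { toFun := fun z => (⟨fun j => z.1.1 (u j), z.1.2⟩, Function.extend u z.2 z.1.1)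
      invFun := fun z => (⟨Function.extend u z.1.1 z.2, by rw [hx]; exact z.1.2⟩, fun j => z.2 (u j))
      left_inv := ?_
      right_inv := ?_ }
  · rintro ⟨⟨G, hG⟩, g⟩
    simp only [Prod.mk.injEq, Subtype.mk.injEq]
    exact ⟨hx2 g G, hx g G⟩
  · rintro ⟨⟨g, hg⟩, G⟩
    simp only [Prod.mk.injEq, Subtype.mk.injEq]
    exact ⟨hx g G, hx2 g G⟩
end xbad
end S9

set_option linter.unusedSimpArgs false
set_option linter.unusedSectionVars false
set_option linter.unusedVariables false
set_option linter.style.haveILetI false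
namespace S9
section avg
open MvPolynomial

lemma avg {Om : Type} [Fintype Om] [Nonempty Om] (Bad : Om → Prop) (s : Om → ℕ) (m c : ℕ) (hm : 0 < m)
    (hs : ∀ G, s G ≤ m) (h1 : m * Fintype.card Om ≤ 2 * c * ∑ G, s G) (h2 : 4 * c * Nat.card {G // Bad G} ≤ Fintype.card Om) :
    ∃ G, ¬ Bad G ∧ m ≤ 4 * c * s G := by
  classical
  by_contra hcon
  push Not at hcon
  have h3 : ∀ G, 4 * c * s G + 1 ≤ m + (if Bad G then 4 * c * m else 0) := by
    intro G
    split_ifs with hB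
    · have := Nat.mul_le_mul_left (4*c) (hs G)
      omega
    · have := hcon G hB
      omega
  have h4 := Finset.sum_le_sum (s := Finset.univ) fun G _ => h3 G
  rw [Finset.sum_add_distrib, Finset.sum_add_distrib, ← Finset.mul_sum, ← Finset.sum_filter] at h4
  simp only [Finset.sum_const, Finset.card_univ, smul_eq_mul, mul_one] at h4
  rw [Nat.card_eq_fintype_card, Fintype.card_subtype] at h2
  have h5 : 0 < Fintype.card Om := Fintype.card_pos
  have h6 := Nat.mul_le_mul_right m h2
  nlinarith

lemma good_exists {k t D lam : ℕ} {F N : Type} [Field F] [Fintype F] [Fintype N] [DecidableEq N] [Nonempty N] (hk : 0 < k)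
    (ht : 0 < t) (htD : t < D) (hl : D = lam * t)
    (hsplit : Nat.card (Fin k → VV k F t) ≤ 2*(D^k).factorial * Nat.card {g : Fin k → VV k F t // Split D g})
    (hbig : 4 * (D^k).factorial * ((k * Fintype.card N)^k * (k * D^k)) ≤ Fintype.card F ^ (t+1)) :
    ∃ G : Fin k × N → VV k F t,
      (∀ X : Finset (Fin k × N), X.card = k → (∃ i : Fin k, ∀ a ∈ X, a.1 ≠ i) →
        Nat.card {x : Fin k → F // ∀ a ∈ X, x a.1 ^ D + eval x (G a).1 = 0} * lam ≤ D^k) ∧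
      Fintype.card N ^ k ≤ 4 * (D^k).factorial * Nat.card {a : Fin k → N // Split D (fun i => G (i, a i))} := by
  classical
  haveI : Fintype (VV k F t) := Fintype.ofFinite _
  let Bd : Finset (Fin k × N) → (Fin k × N → VV k F t) → Prop := fun X G =>
    ¬ (Nat.card {x : Fin k → F // ∀ a ∈ X, x a.1 ^ D + eval x (G a).1 = 0} * lam ≤ D^k)
  let Xs : Finset (Finset (Fin k × N)) := (Finset.powersetCard k Finset.univ).filter fun X => ∃ i : Fin k, ∀ a ∈ X, a.1 ≠ i
  let Bad : (Fin k × N → VV k F t) → Prop := fun G => ∃ X ∈ Xs, Bd X G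
  have hXs : Xs.card ≤ (k * Fintype.card N)^k := by
    refine (Finset.card_filter_le _ _).trans ?_
    rw [Finset.card_powersetCard]
    refine (Nat.choose_le_pow _ _).trans ?_
    simp
  have hF : 0 < Fintype.card F := Fintype.card_pos
  have hbad : 4 * (D^k).factorial * Nat.card {G // Bad G} ≤ Fintype.card (Fin k × N → VV k F t) := by
    have hsub : (Finset.univ.filter fun G => Bad G) ⊆ Xs.biUnion fun X => Finset.univ.filter fun G => Bd X G := by
      intro G hG
      obtain ⟨X, hX, hX'⟩ := (Finset.mem_filter.1 hG).2
      rw [Finset.mem_biUnion]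
      exact ⟨X, hX, Finset.mem_filter.2 ⟨Finset.mem_univ _, hX'⟩⟩
    have h2 := (Finset.card_le_card hsub).trans Finset.card_biUnion_le
    have h3 : Nat.card {G // Bad G} ≤ ∑ X ∈ Xs, Nat.card {G // Bd X G} := by
      simpa only [Nat.card_eq_fintype_card, Fintype.card_subtype] using h2
    have h4 : Fintype.card F ^ (t+1) * Nat.card {G // Bad G} ≤ (k * Fintype.card N)^k * (k * D^k) * Fintype.card (Fin k × N → VV k F t) := by
      refine (Nat.mul_le_mul_left _ h3).trans ?_
      rw [Finset.mul_sum]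
      refine (Finset.sum_le_sum (g := fun _ => k * D^k * Nat.card (Fin k × N → VV k F t)) fun X hX => ?_).trans ?_
      · obtain ⟨h5, h6⟩ := Finset.mem_filter.1 hX
        exact X_bad hk ht htD hl X (Finset.mem_powersetCard.1 h5).2 h6
      · rw [Finset.sum_const, smul_eq_mul, Nat.card_eq_fintype_card, ← mul_assoc]
        exact Nat.mul_le_mul_right _ (Nat.mul_le_mul_right _ hXs)
    have h5 : 0 < Fintype.card F ^ (t+1) := pow_pos hF _
    refine Nat.le_of_mul_le_mul_left ?_ h5
    calc Fintype.card F ^ (t+1) * (4 * (D^k).factorial * Nat.card {G // Bad G})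
        = 4 * (D^k).factorial * (Fintype.card F ^ (t+1) * Nat.card {G // Bad G}) := by ring
      _ ≤ 4 * (D^k).factorial * ((k * Fintype.card N)^k * (k * D^k) * Fintype.card (Fin k × N → VV k F t)) := Nat.mul_le_mul_left _ h4
      _ = 4 * (D^k).factorial * ((k * Fintype.card N)^k * (k * D^k)) * Fintype.card (Fin k × N → VV k F t) := by ring
      _ ≤ _ := Nat.mul_le_mul_right _ hbig
  have hone : ∀ a : Fin k → N, Fintype.card (Fin k × N → VV k F t) ≤
      2 * (D^k).factorial * Nat.card {G : Fin k × N → VV k F t // Split D (fun i => G (i, a i))} := by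
    intro a
    have h1 := count_extend (V := VV k F t) (fun i : Fin k => (i, a i)) (fun i j h => congrArg Prod.fst h) (Split D)
    have hpos : 0 < Nat.card (Fin k → VV k F t) := Nat.card_pos
    refine Nat.le_of_mul_le_mul_right ?_ hpos
    rw [mul_assoc, h1, ← mul_assoc, mul_comm, ← Nat.card_eq_fintype_card]
    exact Nat.mul_le_mul_right _ hsplit
  have hsum : ∑ G : Fin k × N → VV k F t, Nat.card {a : Fin k → N // Split D (fun i => G (i, a i))} =
      ∑ a : Fin k → N, Nat.card {G : Fin k × N → VV k F t // Split D (fun i => G (i, a i))} := by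
    simp only [Nat.card_eq_fintype_card, Fintype.card_subtype, Finset.card_filter]
    rw [Finset.sum_comm]
  have hA1 : ∀ G : Fin k × N → VV k F t, Nat.card {a : Fin k → N // Split D (fun i => G (i, a i))} ≤ Fintype.card N ^ k := by
    intro G
    refine (Finite.card_subtype_le _).trans ?_
    simp
  have hA2 : Fintype.card N ^ k * Fintype.card (Fin k × N → VV k F t) ≤ 2 * (D^k).factorial *
      ∑ G : Fin k × N → VV k F t, Nat.card {a : Fin k → N // Split D (fun i => G (i, a i))} := by
    rw [hsum, Finset.mul_sum]
    refine le_trans ?_ (Finset.sum_le_sum fun a _ => hone a)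
    simp
  obtain ⟨G, hG1, hG2⟩ := avg Bad (fun G => Nat.card {a : Fin k → N // Split D (fun i => G (i, a i))}) (Fintype.card N ^ k)
    (D^k).factorial (pow_pos Fintype.card_pos _) hA1 hA2 hbad
  refine ⟨G, ?_, hG2⟩
  intro X hX hmiss
  by_contra hcon
  exact hG1 ⟨X, Finset.mem_filter.2 ⟨Finset.mem_powersetCard.2 ⟨Finset.subset_univ _, hX⟩, hmiss⟩, hcon⟩
end avg
end S9

set_option linter.unusedSimpArgs false
set_option linter.unusedSectionVars false
set_option linter.unusedVariables false
set_option linter.style.haveILetI false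
namespace S9
section fin
open MvPolynomial

lemma roots_card {F : Type} [Field F] [Fintype F] (D : ℕ) (hD : 0 < D) (h : D ∣ Fintype.card F - 1) :
    Nat.card {y : F // y^D = 1} = D := by
  classical
  obtain ⟨m, hm⟩ := h
  obtain ⟨g, hg⟩ := IsCyclic.exists_ofOrder_eq_natCard (α := Fˣ)
  have h1 : Nat.card Fˣ = D * m := by
    rw [Nat.card_eq_fintype_card, Fintype.card_units, hm]
  have h2 : IsPrimitiveRoot g (D * m) := by
    rw [← h1, ← hg]; exact IsPrimitiveRoot.orderOf g
  have h3 : 0 < D * m := by rw [← h1]; exact Nat.card_pos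
  have h4 : IsPrimitiveRoot (g^m) D := h2.pow h3 (mul_comm _ _)
  have h5 : IsPrimitiveRoot ((g^m : Fˣ) : F) D := IsPrimitiveRoot.coe_units_iff.2 h4
  refine Eq.trans ?_ h5.card_nthRootsFinset
  rw [Nat.card_eq_fintype_card, Fintype.card_subtype]
  congr 1
  ext y
  simp [Polynomial.mem_nthRootsFinset hD]

lemma card_emb {A B J : Type} [Nonempty J] (f : A ↪ B) (P : J → A → Prop) :
    Nat.card {b : B // ∀ j, ∃ x, f x = b ∧ P j x} = Nat.card {x // ∀ j, P j x} := by
  symm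
  refine Nat.card_congr (Equiv.ofBijective (fun x => ⟨f x.1, fun j => ⟨x.1, rfl, x.2 j⟩⟩) ⟨?_, ?_⟩)
  · intro x y h
    exact Subtype.ext (f.injective (congrArg Subtype.val h))
  · rintro ⟨b, hb⟩
    obtain ⟨x, hx, _⟩ := hb (Classical.arbitrary J)
    refine ⟨⟨x, fun j => ?_⟩, Subtype.ext hx⟩
    obtain ⟨y, hy, hP⟩ := hb j
    have : x = y := f.injective (hx.trans hy.symm)
    rw [this]; exact hP

lemma graph {k t D lam : ℕ} {F : Type} [Field F] [Fintype F] {n : ℕ} (hn : 0 < n) (hk : 0 < k) (hlam : 0 < lam)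
    (ht : 0 < t) (htD : t < D) (hl : D = lam * t) (hFn : Fintype.card F ^ k ≤ n)
    (hsplit : Nat.card (Fin k → VV k F t) ≤ 2*(D^k).factorial * Nat.card {g : Fin k → VV k F t // Split D g})
    (hbig : 4 * (D^k).factorial * ((k * n)^k * (k * D^k)) ≤ Fintype.card F ^ (t+1)) :
    ∃ E : Fin k × Fin n → Fin n → Prop,
        (∀ a : Fin k → Fin n, Nat.card {b : Fin n // ∀ i, E (i, a i) b} ≤ D ^ k) ∧
        (n ^ k ≤ 4 * (D^k).factorial *
          (Nat.card {a : Fin k → Fin n // Nat.card {b : Fin n // ∀ i, E (i, a i) b} = D ^ k})) ∧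
        (∀ X : Finset (Fin k × Fin n), X.card = k → (∃ i : Fin k, ∀ a ∈ X, a.1 ≠ i) →
          Nat.card {b : Fin n // ∀ a ∈ X, E a b} * lam ≤ D ^ k) := by
  classical
  haveI : Nonempty (Fin n) := ⟨⟨0, hn⟩⟩
  haveI : Nonempty (Fin k) := ⟨⟨0, hk⟩⟩
  obtain ⟨G, hG1, hG2⟩ := good_exists (N := Fin n) hk ht htD hl hsplit (by simpa using hbig)
  have hemb : Nonempty ((Fin k → F) ↪ Fin n) := by
    apply Function.Embedding.nonempty_of_card_le
    simpa using hFn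
  obtain ⟨f⟩ := hemb
  have hz : ∀ a : Fin k → Fin n, Nat.card {b : Fin n // ∀ i, ∃ x, f x = b ∧ x i ^ D + eval x (G (i, a i)).1 = 0} =
      Nat.card (zeros D (gv (fun i => G (i, a i)))) := by
    intro a
    exact card_emb f (fun i x => x i ^ D + eval x (G (i, a i)).1 = 0)
  refine ⟨fun v b => ∃ x, f x = b ∧ x v.1 ^ D + eval x (G v).1 = 0, ?_, ?_, ?_⟩
  · intro a
    rw [hz a]
    exact card_zeros_le _ (gv_deg htD _)
  · simp only [hz]
    simpa [Split] using hG2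
  · intro X hX hmiss
    refine le_trans (le_of_eq ?_) (hG1 X hX hmiss)
    congr 1
    haveI : Nonempty X := (Finset.card_pos.1 (by omega)).to_subtype
    have := card_emb (J := X) f (fun v x => x v.1.1 ^ D + eval x (G v.1).1 = 0)
    simpa only [Subtype.forall] using this
end fin
end S9

open S9 in
theorem statement_9 (k lam : ℕ) (hk : 0 < k) (hlam : 1 < lam)
    (D : ℕ) (hD : D = lam * (k ^ 2 + 2)) :
    ∃ Q : ℕ, ∀ q : ℕ, IsPrimePow q → Q ≤ q →
      ∃ E : Fin k × Fin (q ^ k) → Fin (q ^ k) → Prop,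
        (∀ a : Fin k → Fin (q ^ k),
          Nat.card {b : Fin (q ^ k) // ∀ i, E (i, a i) b} ≤ D ^ k) ∧
        (((q : ℝ) ^ k) ^ k / (4 * (Nat.factorial (D ^ k) : ℝ)) ≤
          (Nat.card {a : Fin k → Fin (q ^ k) //
            Nat.card {b : Fin (q ^ k) // ∀ i, E (i, a i) b} = D ^ k} : ℝ)) ∧
        (∀ X : Finset (Fin k × Fin (q ^ k)), X.card = k →
          (∃ i : Fin k, ∀ a ∈ X, a.1 ≠ i) →
          (Nat.card {b : Fin (q ^ k) // ∀ a ∈ X, E a b} : ℝ) ≤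
            (D : ℝ) ^ k / (lam : ℝ)) := by
  have ht : 0 < k^2 + 2 := by positivity
  have htD : k^2 + 2 < D := by rw [hD]; nlinarith
  have hD0 : 0 < D := by omega
  obtain ⟨p, hpD, hp⟩ := Nat.exists_infinite_primes (D + 1)
  haveI : Fact p.Prime := ⟨hp⟩
  obtain ⟨Q1, hQ1⟩ := split_count k D (k^2+2) htD
  have hφ : 0 < D.totient := Nat.totient_pos.2 hD0
  obtain ⟨φ, hφ'⟩ : ∃ φ, φ = D.totient := ⟨_, rfl⟩
  rw [← hφ'] at hφ
  obtain ⟨b, hb⟩ : ∃ b, b = p^(2*φ) := ⟨_, rfl⟩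
  have hb1 : 1 < b := by rw [hb]; exact Nat.one_lt_pow (by omega) hp.one_lt
  obtain ⟨C0, hC0⟩ : ∃ C0, C0 = 4 * (D^k).factorial * ((k * b^k)^k * (k * D^k)) := ⟨_, rfl⟩
  refine ⟨b^(Q1 + C0 + 1), fun q hq hQq => ?_⟩
  have hq0 : q ≠ 0 := hq.ne_zero
  obtain ⟨j, hj⟩ : ∃ j, j = Nat.log b q := ⟨_, rfl⟩
  have hj1 : Q1 + C0 + 1 ≤ j := by rw [hj]; exact Nat.le_log_of_pow_le hb1 hQq
  have hle : b^j ≤ q := by rw [hj]; exact Nat.pow_log_le_self b hq0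
  have hlt : q < b^(j+1) := by rw [hj]; exact Nat.lt_pow_succ_log_self hb1 q
  have hcj : 2 * φ * j ≠ 0 := by
    have : 0 < j := by omega
    positivity
  haveI : Fintype (GaloisField p (2*φ*j)) := Fintype.ofFinite _
  have hcard0 : Fintype.card (GaloisField p (2*φ*j)) = b^j := by
    rw [← Nat.card_eq_fintype_card, GaloisField.card p _ hcj, hb, ← pow_mul]
  have hcard : Fintype.card (GaloisField p (2*φ*j)) = (p^(φ*j))^2 := by
    rw [hcard0, hb, ← pow_mul, ← pow_mul]; congr 1; ring
  have hjp : j ≤ p^(φ*j) := by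
    calc j ≤ φ*j := Nat.le_mul_of_pos_left _ hφ
      _ ≤ _ := (Nat.lt_pow_self hp.one_lt).le
  have hdvd : D ∣ Fintype.card (GaloisField p (2*φ*j)) - 1 := by
    rw [← Nat.modEq_iff_dvd' Fintype.card_pos, hcard, ← pow_mul]
    have hcop : Nat.Coprime p D := by
      rw [Nat.Prime.coprime_iff_not_dvd hp]
      intro h
      have := Nat.le_of_dvd hD0 h
      omega
    have h1 := (Nat.ModEq.pow_totient hcop).pow (j*2)
    rw [one_pow, ← hφ', ← pow_mul, ← mul_assoc] at h1
    exact h1.symm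
  have hsplit := hQ1 (GaloisField p (2*φ*j)) p (φ*j) hcard (by omega) (roots_card D hD0 hdvd)
  have hbj : C0 ≤ b^j := by
    have := (Nat.lt_pow_self (n := j) hb1).le
    omega
  obtain ⟨E, hE1, hE2, hE3⟩ := graph (F := GaloisField p (2*φ*j)) (n := q^k) (lam := lam) (by positivity) hk (by omega) ht htD hD
    (by rw [hcard0]; exact Nat.pow_le_pow_left hle k) hsplit (by
      rw [hcard0]
      calc 4 * (D^k).factorial * ((k * q^k)^k * (k * D^k))
          ≤ 4 * (D^k).factorial * ((k * (b^(j+1))^k)^k * (k * D^k)) := by gcongr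
        _ = C0 * (b^j)^(k^2) := by rw [hC0]; ring
        _ ≤ b^j * (b^j)^(k^2) := Nat.mul_le_mul_right _ hbj
        _ = (b^j)^(k^2+1) := by ring
        _ ≤ (b^j)^(k^2+2+1) := Nat.pow_le_pow_right (by positivity) (by omega))
  refine ⟨E, hE1, ?_, ?_⟩
  · rw [div_le_iff₀ (by positivity), mul_comm]
    exact_mod_cast hE2
  · intro X hX hmiss
    rw [le_div_iff₀ (by exact_mod_cast (by omega : 0 < lam))]
    exact_mod_cast hE3 X hX hmiss
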